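/- Let n ≥ 1 and 1 ≤ m ≤ n. Let U be a connected open neighborhood of 0 in ℂⁿ. Let X₁, …, X_m : U → ℂⁿ be analytic vector fields with X₁(0) = 0 which commute pairwise, i.e. [X_i, X_j](x) = 0 for all x ∈ U and all i, j, and let f₁, …, f_{n−m} : U → ℂ be analytic functions which are common first integrals, i.e. Df_j(x)(X_i(x)) = 0 for all x ∈ U, all i = 1,…,m and j = 1,…,n−m. Assume there exists a point x ∈ U at which the vectors X₁(x), …, X_m(x) are linearly independent over ℂ, and there exists a point x ∈ U at which the continuous linear functionals Df₁(x), …, Df_{n−m}(x) are linearly independent over ℂ. Then X₁ admits a convergent Poincaré–Dulac normalization. -/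

import Mathlib

/-- `Y` is in Poincaré–Dulac normal form on the neighborhood `U` of `0`:
writing the Jordan–Chevalley decomposition `DY(0) = S + N` with `S` semisimple,
`N` nilpotent and `S ∘ N = N ∘ S`, the Lie bracket `[Y, Yˢ]` (where `Yˢ x = S x`)
vanishes on `U`. -/
def InPDNormalForm (𝕂 : Type*) [NontriviallyNormedField 𝕂] {n : ℕ}
    (Y : (Fin n → 𝕂) → (Fin n → 𝕂)) (U : Set (Fin n → 𝕂)) : Prop :=
  ∃ S N : (Fin n → 𝕂) →L[𝕂] (Fin n → 𝕂),
    fderiv 𝕂 Y 0 = S + N ∧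
    Module.End.IsSemisimple (S : Module.End 𝕂 (Fin n → 𝕂)) ∧
    IsNilpotent (N : Module.End 𝕂 (Fin n → 𝕂)) ∧
    S ∘L N = N ∘L S ∧
    ∀ x ∈ U, VectorField.lieBracket 𝕂 Y (fun y => S y) x = 0

/-- `X` admits a convergent Poincaré–Dulac normalization: there are an analytic
vector field `Y` near `0`, in Poincaré–Dulac normal form with `Y 0 = 0`, and an
analytic map `φ` near `0` with `φ 0 = 0` and `Dφ(0)` invertible, such that
`Dφ(x) (Y x) = X (φ x)` for all `x` near `0`. -/
def AdmitsPDNormalization (𝕂 : Type*) [NontriviallyNormedField 𝕂] {n : ℕ}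
    (X : (Fin n → 𝕂) → (Fin n → 𝕂)) : Prop :=
  ∃ (V : Set (Fin n → 𝕂)) (Y φ : (Fin n → 𝕂) → (Fin n → 𝕂)),
    IsOpen V ∧ (0 : Fin n → 𝕂) ∈ V ∧
    AnalyticOnNhd 𝕂 Y V ∧ AnalyticOnNhd 𝕂 φ V ∧
    Y 0 = 0 ∧ φ 0 = 0 ∧ Function.Bijective (fderiv 𝕂 φ 0) ∧
    InPDNormalForm 𝕂 Y V ∧
    ∀ x ∈ V, fderiv 𝕂 φ x (Y x) = X (φ x)


open scoped PowerSeries Topology Matrix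
open Filter
set_option linter.unusedSectionVars false
noncomputable section
namespace PoincareDulac

/-- Power series all of whose coefficients of total degree `< d` vanish. -/
def ordGE (σ : Type*) (d : ℕ) : Submodule ℂ (MvPowerSeries σ ℂ) where
  carrier := {g | ∀ α : σ →₀ ℕ, α.degree < d → MvPowerSeries.coeff α g = 0}
  add_mem' := by
    intro a b ha hb α h
    simp [ha α h, hb α h]
  zero_mem' := by intro α _; simp
  smul_mem' := by
    intro c x hx α h
    simp [hx α h]

section
variable {σ : Type*}

theorem mem_ordGE {d : ℕ} {g : MvPowerSeries σ ℂ} :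
    g ∈ ordGE σ d ↔ ∀ α : σ →₀ ℕ, α.degree < d → MvPowerSeries.coeff α g = 0 := Iff.rfl

theorem ordGE_anti {d e : ℕ} (h : d ≤ e) : ordGE σ e ≤ ordGE σ d :=
  fun _ hg α hα => hg α (hα.trans_le h)

theorem mem_ordGE_zero (g : MvPowerSeries σ ℂ) : g ∈ ordGE σ 0 := fun α h => by simp at h

theorem eq_zero_of_forall_mem_ordGE {g : MvPowerSeries σ ℂ} (h : ∀ d, g ∈ ordGE σ d) : g = 0 := by
  ext α
  simpa using h (α.degree + 1) α (Nat.lt_succ_self _)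

theorem mul_mem_ordGE {d e : ℕ} {g h : MvPowerSeries σ ℂ} (hg : g ∈ ordGE σ d)
    (hh : h ∈ ordGE σ e) : g * h ∈ ordGE σ (d + e) := by
  classical
  intro α hα
  rw [MvPowerSeries.coeff_mul]
  refine Finset.sum_eq_zero fun p hp => ?_
  rw [Finset.HasAntidiagonal.mem_antidiagonal] at hp
  have : p.1.degree + p.2.degree = α.degree := by rw [← hp, map_add]
  by_cases h1 : p.1.degree < d
  · rw [hg _ h1, zero_mul]
  · rw [hh _ (by omega), mul_zero]

theorem mul_mem_ordGE_left {d : ℕ} {g : MvPowerSeries σ ℂ} (hg : g ∈ ordGE σ d)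
    (h : MvPowerSeries σ ℂ) : g * h ∈ ordGE σ d := by
  simpa using mul_mem_ordGE hg (mem_ordGE_zero h)

theorem mul_mem_ordGE_right {d : ℕ} {g : MvPowerSeries σ ℂ} (hg : g ∈ ordGE σ d)
    (h : MvPowerSeries σ ℂ) : h * g ∈ ordGE σ d := by
  rw [mul_comm]; exact mul_mem_ordGE_left hg h

theorem pderiv_mem_ordGE {d : ℕ} {g : MvPowerSeries σ ℂ} (hg : g ∈ ordGE σ (d + 1)) (k : σ) :
    MvPowerSeries.pderiv ℂ k g ∈ ordGE σ d := by
  intro α hα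
  rw [MvPowerSeries.coeff_pderiv, hg _ (by simp; omega)]
  simp

variable [Finite σ]

theorem sub_truncTotal_mem (d : ℕ) (g : MvPowerSeries σ ℂ) :
    g - (MvPowerSeries.truncTotal d g : MvPowerSeries σ ℂ) ∈ ordGE σ d := by
  intro α hα
  simp [MvPowerSeries.coeff_truncTotal _ hα]

end

section Ev
variable {σ : Type*} [Finite σ] {A : Type*} [CommRing A] [Algebra ℂ A]

theorem hasSubst_X_mul (y : σ → A⟦X⟧) :
    MvPowerSeries.HasSubst (S := A) (τ := Unit) (fun k => (PowerSeries.X * y k : A⟦X⟧)) := by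
  apply MvPowerSeries.hasSubst_of_constantCoeff_zero
  intro k
  have : PowerSeries.constantCoeff (PowerSeries.X * y k) = 0 := by simp
  exact this

/-- Substitution of `X * y k` for the variables of a power series. -/
def ev (y : σ → A⟦X⟧) : MvPowerSeries σ ℂ →ₐ[ℂ] A⟦X⟧ :=
  MvPowerSeries.substAlgHom (hasSubst_X_mul y)

@[simp] theorem ev_X (y : σ → A⟦X⟧) (k : σ) : ev y (MvPowerSeries.X k) = PowerSeries.X * y k :=
  MvPowerSeries.substAlgHom_X _ _

theorem ev_coe (y : σ → A⟦X⟧) (p : MvPolynomial σ ℂ) :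
    ev y (p : MvPowerSeries σ ℂ) = MvPolynomial.aeval (fun k => PowerSeries.X * y k) p :=
  MvPowerSeries.substAlgHom_coe _ _

theorem X_pow_dvd_ev (y : σ → A⟦X⟧) {d : ℕ} {g : MvPowerSeries σ ℂ} (hg : g ∈ ordGE σ d) :
    PowerSeries.X ^ d ∣ ev y g := by
  have hs := hasSubst_X_mul y
  have h := MvPowerSeries.le_order_subst hs g
  have h1 : (1 : ℕ∞) ≤ ⨅ k, MvPowerSeries.order (PowerSeries.X * y k : A⟦X⟧) := by
    refine le_iInf fun k => ?_
    rw [← PowerSeries.order_eq_order, PowerSeries.one_le_order_iff_constCoeff_eq_zero]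
    simp
  have h2 : (d : ℕ∞) ≤ g.order := MvPowerSeries.nat_le_order fun α hα => hg α hα
  have h3 : (d : ℕ∞) ≤ PowerSeries.order (ev y g) := by
    rw [PowerSeries.order_eq_order]
    calc (d : ℕ∞) ≤ 1 * d := by simp
      _ ≤ _ := mul_le_mul' h1 h2
      _ ≤ MvPowerSeries.order (MvPowerSeries.subst (fun k => PowerSeries.X * y k) g) := h
      _ = _ := by rw [ev, MvPowerSeries.coe_substAlgHom]
  rw [PowerSeries.X_pow_dvd_iff]
  intro m hm
  exact PowerSeries.coeff_of_lt_order _ (lt_of_lt_of_le (by exact_mod_cast hm) h3)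

theorem eq_zero_of_forall_X_pow_dvd {p : A⟦X⟧} (h : ∀ d : ℕ, PowerSeries.X ^ d ∣ p) : p = 0 := by
  ext m
  simpa using PowerSeries.X_pow_dvd_iff.1 (h (m + 1)) m (Nat.lt_succ_self _)

/-- A filtered additive map which kills polynomials vanishes. -/
theorem eq_zero_of_poly (L : MvPowerSeries σ ℂ →+ A⟦X⟧)
    (hL : ∀ d g, g ∈ ordGE σ (d + 1) → PowerSeries.X ^ d ∣ L g)
    (hp : ∀ p : MvPolynomial σ ℂ, L p = 0) (g) : L g = 0 := by
  refine eq_zero_of_forall_X_pow_dvd fun d => ?_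
  have := hL d _ (sub_truncTotal_mem (d + 1) g)
  rwa [map_sub, hp, sub_zero] at this

end Ev

section Dser
variable {A : Type*} [CommRing A] [Algebra ℂ A]

/-- Coefficientwise extension of a derivation to power series. -/
def dser (D : Derivation ℂ A A) : Derivation ℂ A⟦X⟧ A⟦X⟧ :=
  Derivation.mk'
    { toFun := fun p => PowerSeries.mk fun d => D (PowerSeries.coeff d p)
      map_add' := by intro p q; ext; simp
      map_smul' := by intro c q; ext; simp }
    (by
      intro p q
      ext d
      simp only [LinearMap.coe_mk, AddHom.coe_mk, PowerSeries.coeff_mk, PowerSeries.coeff_mul,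
        map_sum, smul_eq_mul, map_add, Derivation.leibniz, Finset.sum_add_distrib]
      congr 1
      rw [← Finset.Nat.sum_antidiagonal_swap]
      rfl)

variable (D : Derivation ℂ A A)
@[simp] theorem coeff_dser (d : ℕ) (p : A⟦X⟧) :
    PowerSeries.coeff d (dser D p) = D (PowerSeries.coeff d p) := by
  simp [dser]

@[simp] theorem dser_X : dser D PowerSeries.X = 0 := by
  ext d
  rw [coeff_dser, PowerSeries.coeff_X]
  split_ifs <;> simp

@[simp] theorem dser_X_pow (k : ℕ) : dser D (PowerSeries.X ^ k) = 0 := by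
  rw [Derivation.leibniz_pow]; simp

theorem dser_X_pow_mul (k : ℕ) (p : A⟦X⟧) :
    dser D (PowerSeries.X ^ k * p) = PowerSeries.X ^ k * dser D p := by
  rw [Derivation.leibniz]; simp

theorem X_pow_dvd_dser {k : ℕ} {p : A⟦X⟧} (h : PowerSeries.X ^ k ∣ p) :
    PowerSeries.X ^ k ∣ dser D p := by
  obtain ⟨q, rfl⟩ := h
  rw [dser_X_pow_mul]; exact dvd_mul_right _ _

variable {σ : Type*} [Fintype σ]

theorem aeval_derivation {B : Type*} [CommRing B] [Algebra ℂ B] (E : Derivation ℂ B B)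
    (z : σ → B) (p : MvPolynomial σ ℂ) :
    E (MvPolynomial.aeval z p) =
      ∑ k, MvPolynomial.aeval z (MvPolynomial.pderiv k p) * E (z k) := by
  classical
  induction p using MvPolynomial.induction_on with
  | C a => simp
  | add p q hp hq => simp [hp, hq, add_mul, Finset.sum_add_distrib]
  | mul_X p i hp =>
    simp only [map_mul, MvPolynomial.aeval_X, Derivation.leibniz, hp, smul_eq_mul,
      MvPolynomial.pderiv_X, map_add, add_mul, Finset.sum_add_distrib, Finset.mul_sum]
    rw [add_comm]
    simp only [Pi.single_apply, apply_ite, map_one, map_zero, mul_one, mul_zero, ite_mul,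
      zero_mul, Finset.sum_ite_eq, Finset.mem_univ, if_true]
    rw [add_comm]
    congr 1
    exact Finset.sum_congr rfl fun k _ => by ring

theorem dser_ev (y : σ → A⟦X⟧) (g : MvPowerSeries σ ℂ) :
    dser D (ev y g) =
      ∑ k, ev y (MvPowerSeries.pderiv ℂ k g) * (PowerSeries.X * dser D (y k)) := by
  rw [← sub_eq_zero]
  let L : MvPowerSeries σ ℂ →+ A⟦X⟧ :=
    { toFun := fun g => dser D (ev y g) -
        ∑ k, ev y (MvPowerSeries.pderiv ℂ k g) * (PowerSeries.X * dser D (y k))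
      map_zero' := by simp
      map_add' := by
        intro a b
        simp only [map_add, add_mul, Finset.sum_add_distrib]
        ring }
  refine eq_zero_of_poly L ?_ ?_ g
  · intro d g hg
    refine dvd_sub ?_ ?_
    · exact X_pow_dvd_dser D ((pow_dvd_pow _ (Nat.le_succ d)).trans (X_pow_dvd_ev y hg))
    · exact Finset.dvd_sum fun k _ =>
        Dvd.dvd.mul_right (X_pow_dvd_ev y (pderiv_mem_ordGE hg k)) _
  · intro p
    change dser D (ev y p) - _ = 0
    rw [ev_coe, aeval_derivation, sub_eq_zero]
    refine Finset.sum_congr rfl fun k _ => ?_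
    rw [MvPowerSeries.pderiv_coe, ev_coe]
    congr 1
    rw [Derivation.leibniz]; simp

end Dser

section TNorm
variable {A : Type*} [SeminormedCommRing A] [NormedAlgebra ℂ A] [NormOneClass A]

/-- The weighted `ℓ¹` norm of the truncation of a power series. -/
def tnorm (N : ℕ) (r : ℝ) (p : A⟦X⟧) : ℝ := ∑ d ∈ Finset.range N, ‖PowerSeries.coeff d p‖ * r ^ d

variable {N : ℕ} {r : ℝ}

theorem tnorm_nonneg (hr : 0 ≤ r) (p : A⟦X⟧) : 0 ≤ tnorm N r p :=
  Finset.sum_nonneg fun _ _ => by positivity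

theorem tnorm_add_le (hr : 0 ≤ r) (p q : A⟦X⟧) :
    tnorm N r (p + q) ≤ tnorm N r p + tnorm N r q := by
  rw [tnorm, tnorm, tnorm, ← Finset.sum_add_distrib]
  refine Finset.sum_le_sum fun d _ => ?_
  rw [map_add, ← add_mul]
  gcongr
  exact norm_add_le _ _

@[simp] theorem tnorm_zero : tnorm N r (0 : A⟦X⟧) = 0 := by simp [tnorm]

theorem tnorm_neg (p : A⟦X⟧) : tnorm N r (-p) = tnorm N r p := by simp [tnorm]

theorem tnorm_smul (c : ℂ) (p : A⟦X⟧) : tnorm N r (c • p) = ‖c‖ * tnorm N r p := by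
  simp [tnorm, norm_smul, Finset.mul_sum, mul_assoc]

theorem tnorm_sum_le {ι : Type*} (s : Finset ι) (hr : 0 ≤ r) (p : ι → A⟦X⟧) :
    tnorm N r (∑ i ∈ s, p i) ≤ ∑ i ∈ s, tnorm N r (p i) := by
  classical
  induction s using Finset.induction_on with
  | empty => simp
  | insert a s ha ih =>
    rw [Finset.sum_insert ha, Finset.sum_insert ha]
    exact (tnorm_add_le hr _ _).trans (by linarith)

theorem tnorm_mul_le (hr : 0 ≤ r) (p q : A⟦X⟧) :
    tnorm N r (p * q) ≤ tnorm N r p * tnorm N r q := by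
  set a : ℕ → ℝ := fun d => ‖PowerSeries.coeff d p‖ * r ^ d
  set b : ℕ → ℝ := fun d => ‖PowerSeries.coeff d q‖ * r ^ d
  have ha : ∀ d, 0 ≤ a d := fun d => by positivity
  have hb : ∀ d, 0 ≤ b d := fun d => by positivity
  calc tnorm N r (p * q) ≤ ∑ d ∈ Finset.range N, ∑ k ∈ Finset.range (d + 1), a k * b (d - k) := by
        refine Finset.sum_le_sum fun d _ => ?_
        rw [PowerSeries.coeff_mul,
          Finset.Nat.sum_antidiagonal_eq_sum_range_succ
            (fun i j => PowerSeries.coeff i p * PowerSeries.coeff j q)]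
        refine (mul_le_mul_of_nonneg_right (norm_sum_le _ _) (by positivity)).trans ?_
        rw [Finset.sum_mul]
        refine Finset.sum_le_sum fun k hk => ?_
        have hk' : k + (d - k) = d := by have := Finset.mem_range.1 hk; omega
        calc ‖PowerSeries.coeff k p * PowerSeries.coeff (d - k) q‖ * r ^ d
            ≤ (‖PowerSeries.coeff k p‖ * ‖PowerSeries.coeff (d - k) q‖) * r ^ d := by
              gcongr; exact norm_mul_le _ _
          _ = a k * b (d - k) := by
              simp only [a, b]; rw [← hk', pow_add, hk']; ring
    _ = ∑ m ∈ Finset.range N, ∑ k ∈ Finset.range (N - m), a m * b k :=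
        Finset.sum_range_diag_flip N (fun i j => a i * b j)
    _ ≤ ∑ m ∈ Finset.range N, ∑ k ∈ Finset.range N, a m * b k := by
        refine Finset.sum_le_sum fun m _ => ?_
        refine Finset.sum_le_sum_of_subset_of_nonneg ?_ fun _ _ _ => mul_nonneg (ha _) (hb _)
        exact Finset.range_mono (Nat.sub_le _ _)
    _ = _ := by rw [tnorm, tnorm, Finset.sum_mul_sum]

theorem tnorm_X_mul (p : A⟦X⟧) :
    tnorm (N + 1) r (PowerSeries.X * p) = r * tnorm N r p := by
  rw [tnorm, Finset.sum_range_succ', tnorm, Finset.mul_sum]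
  simp only [PowerSeries.coeff_succ_X_mul, PowerSeries.coeff_zero_X_mul, norm_zero, zero_mul,
    add_zero]
  exact Finset.sum_congr rfl fun _ _ => by ring

theorem tnorm_mono_left {N' : ℕ} (h : N ≤ N') (hr : 0 ≤ r) (p : A⟦X⟧) :
    tnorm N r p ≤ tnorm N' r p :=
  Finset.sum_le_sum_of_subset_of_nonneg (Finset.range_mono h) fun _ _ _ => by positivity

theorem tnorm_X_pow_mul (k : ℕ) (p : A⟦X⟧) :
    tnorm (N + k) r (PowerSeries.X ^ k * p) = r ^ k * tnorm N r p := by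
  induction k with
  | zero => simp
  | succ k ih => rw [pow_succ', mul_assoc, ← add_assoc, tnorm_X_mul, ih]; ring

theorem tnorm_X_pow_mul_le (hr : 0 ≤ r) (k : ℕ) (p : A⟦X⟧) :
    tnorm N r (PowerSeries.X ^ k * p) ≤ r ^ k * tnorm N r p := by
  rw [← tnorm_X_pow_mul]
  exact tnorm_mono_left (Nat.le_add_right _ _) hr _

theorem tnorm_X_mul_le (hr : 0 ≤ r) (p : A⟦X⟧) :
    tnorm N r (PowerSeries.X * p) ≤ r * tnorm N r p := by
  simpa using tnorm_X_pow_mul_le (N := N) hr 1 p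

theorem tnorm_C_le (a : A) : tnorm N r (PowerSeries.C a) ≤ ‖a‖ := by
  rcases N with _ | N
  · simp [tnorm]
  · rw [tnorm, Finset.sum_range_succ']
    simp [PowerSeries.coeff_C]

theorem tnorm_one_le : tnorm N r (1 : A⟦X⟧) ≤ 1 := by
  have := tnorm_C_le (N := N) (r := r) (1 : A)
  simpa using this

theorem tnorm_congr {p q : A⟦X⟧} (h : PowerSeries.X ^ N ∣ p - q) : tnorm N r p = tnorm N r q := by
  refine Finset.sum_congr rfl fun d hd => ?_
  have := PowerSeries.X_pow_dvd_iff.1 h d (Finset.mem_range.1 hd)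
  rw [map_sub, sub_eq_zero] at this
  rw [this]

theorem tnorm_X_pow_le (hr : 0 ≤ r) (k : ℕ) : tnorm N r (PowerSeries.X ^ k : A⟦X⟧) ≤ r ^ k := by
  have h := tnorm_X_pow_mul_le (N := N) hr k (1 : A⟦X⟧)
  rw [mul_one] at h
  exact h.trans (mul_le_of_le_one_right (by positivity) (tnorm_one_le))

variable (A) in
/-- Power series whose truncated norms are uniformly bounded, for small radii, on the truncation
levels where the hypothesis `Hyp` holds. -/
def Bd (Hyp : ℕ → ℝ → Prop) : Subalgebra ℂ A⟦X⟧ where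
  carrier := {p | ∃ C : ℝ, ∀ᶠ r in 𝓝[>] (0 : ℝ), ∀ N, Hyp N r → tnorm N r p ≤ C}
  mul_mem' := by
    rintro p q ⟨C, hC⟩ ⟨C', hC'⟩
    refine ⟨C * C', ?_⟩
    filter_upwards [hC, hC', self_mem_nhdsWithin] with r h h' hr N hN
    have hr : 0 ≤ r := le_of_lt hr
    exact (tnorm_mul_le hr p q).trans (mul_le_mul (h N hN) (h' N hN) (tnorm_nonneg hr _)
      ((tnorm_nonneg hr _).trans (h N hN)))
  add_mem' := by
    rintro p q ⟨C, hC⟩ ⟨C', hC'⟩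
    refine ⟨C + C', ?_⟩
    filter_upwards [hC, hC', self_mem_nhdsWithin] with r h h' hr N hN
    exact (tnorm_add_le (le_of_lt hr) p q).trans (add_le_add (h N hN) (h' N hN))
  algebraMap_mem' := by
    intro c
    refine ⟨‖c‖, Eventually.of_forall fun r N _ => ?_⟩
    rw [Algebra.algebraMap_eq_smul_one, tnorm_smul]
    exact mul_le_of_le_one_right (norm_nonneg _) tnorm_one_le

theorem mem_Bd {Hyp : ℕ → ℝ → Prop} {p : A⟦X⟧} :
    p ∈ Bd A Hyp ↔ ∃ C : ℝ, ∀ᶠ r in 𝓝[>] (0 : ℝ), ∀ N, Hyp N r → tnorm N r p ≤ C := Iff.rfl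

variable (A) in
/-- Convergent power series. -/
abbrev Conv : Subalgebra ℂ A⟦X⟧ := Bd A fun _ _ => True

variable {Hyp : ℕ → ℝ → Prop}

theorem Conv_le_Bd : Conv A ≤ Bd A Hyp := by
  rintro p ⟨C, hC⟩
  exact ⟨C, hC.mono fun r h N _ => h N trivial⟩

theorem C_mem_Bd (a : A) : PowerSeries.C a ∈ Bd A Hyp := by
  refine ⟨‖a‖, Eventually.of_forall fun r N _ => ?_⟩
  exact tnorm_C_le a

theorem X_mem_Bd : (PowerSeries.X : A⟦X⟧) ∈ Bd A Hyp := by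
  refine ⟨1, ?_⟩
  filter_upwards [self_mem_nhdsWithin,
    mem_nhdsWithin_of_mem_nhds (Iic_mem_nhds zero_lt_one)] with r hr hr1 N _
  have := tnorm_X_pow_le (A := A) (N := N) (le_of_lt hr) 1
  rw [pow_one, pow_one] at this
  exact this.trans hr1

theorem X_pow_mem_Bd (k : ℕ) : (PowerSeries.X ^ k : A⟦X⟧) ∈ Bd A Hyp := pow_mem X_mem_Bd k

theorem coe_polynomial_mem_Bd (p : Polynomial A) : (p : A⟦X⟧) ∈ Bd A Hyp := by
  induction p using Polynomial.induction_on with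
  | C a => simpa using C_mem_Bd a
  | add p q hp hq => simpa using add_mem hp hq
  | monomial n a _ => simpa using mul_mem (C_mem_Bd a) (X_pow_mem_Bd (n + 1))

theorem Bd_family {ι : Type*} [Finite ι] {p : ι → A⟦X⟧} (h : ∀ i, p i ∈ Bd A Hyp) :
    ∃ C : ℝ, 0 ≤ C ∧ ∀ᶠ r in 𝓝[>] (0 : ℝ), ∀ N, Hyp N r → ∀ i, tnorm N r (p i) ≤ C := by
  cases nonempty_fintype ι
  choose C hC using fun i => mem_Bd.1 (h i)
  refine ⟨∑ i, |C i|, Finset.sum_nonneg fun _ _ => abs_nonneg _, ?_⟩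
  filter_upwards [eventually_all.2 hC] with r h N hN i
  exact (h i N hN).trans ((le_abs_self _).trans
    (Finset.single_le_sum (f := fun i => |C i|) (fun _ _ => abs_nonneg _) (Finset.mem_univ i)))

theorem Conv_of_X_pow_mul {k : ℕ} {p : A⟦X⟧} (h : PowerSeries.X ^ k * p ∈ Conv A) : p ∈ Conv A := by
  obtain ⟨C, hC⟩ := h
  obtain ⟨r, hr, hr0⟩ := (hC.and self_mem_nhdsWithin).exists
  have hr0 : 0 < r := hr0
  refine ⟨C / r ^ k, ?_⟩
  filter_upwards [self_mem_nhdsWithin, mem_nhdsWithin_of_mem_nhds (Iic_mem_nhds hr0)]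
    with s hs hsr N _
  have h1 := hr (N + k) trivial
  rw [tnorm_X_pow_mul] at h1
  have hs : 0 < s := hs
  rw [le_div_iff₀ (by positivity), mul_comm]
  refine le_trans ?_ h1
  gcongr
  unfold tnorm
  gcongr
  exact hsr

theorem pow_le_of_mem_Conv {p : A⟦X⟧} (h : p ∈ Conv A) :
    ∃ K : ℝ, 0 < K ∧ ∀ d, ‖PowerSeries.coeff d p‖ ≤ K ^ (d + 1) := by
  obtain ⟨C, hC⟩ := h
  obtain ⟨r, hr, hr0⟩ := (hC.and self_mem_nhdsWithin).exists
  have hr0 : 0 < r := hr0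
  have hC0 : 0 ≤ C := (tnorm_nonneg hr0.le p).trans (hr 0 trivial)
  refine ⟨max (C + 1) r⁻¹, by positivity, fun d => ?_⟩
  have h1 : ‖PowerSeries.coeff d p‖ * r ^ d ≤ C := by
    refine le_trans ?_ (hr (d + 1) trivial)
    exact Finset.single_le_sum (f := fun d => ‖PowerSeries.coeff d p‖ * r ^ d)
      (fun _ _ => by positivity) (Finset.mem_range.2 (Nat.lt_succ_self d))
  rw [← le_div_iff₀ (by positivity)] at h1
  calc _ ≤ _ := h1
    _ = (r⁻¹) ^ d * C := by rw [inv_pow]; field_simp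
    _ ≤ (max (C + 1) r⁻¹) ^ d * (max (C + 1) r⁻¹) := by
      gcongr
      · exact le_max_right _ _
      · exact le_trans (by linarith) (le_max_left _ _)
    _ = _ := by rw [pow_succ]

theorem Conv_of_isBounded {p : A⟦X⟧} {r C : ℝ} (hr : 0 < r)
    (h : ∀ N, tnorm N r p ≤ C) : p ∈ Conv A := by
  refine ⟨C, ?_⟩
  filter_upwards [self_mem_nhdsWithin, mem_nhdsWithin_of_mem_nhds (Iic_mem_nhds hr)]
    with s hs hsr N _
  have hs : 0 < s := hs
  refine le_trans ?_ (h N)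
  unfold tnorm
  gcongr
  exact hsr

end TNorm

section CvgSeries
variable {σ : Type*}

/-- Absolutely convergent multivariate power series. -/
def Cvg (G : MvPowerSeries σ ℂ) : Prop :=
  ∃ ρ : ℝ, 0 < ρ ∧ Summable fun α : σ →₀ ℕ => ‖MvPowerSeries.coeff α G‖ * ρ ^ α.degree

variable {A : Type*} [SeminormedCommRing A] [NormedAlgebra ℂ A] [NormOneClass A]
  {N : ℕ} {r : ℝ} [Fintype σ]

theorem tnorm_prod_pow_le {ρ : ℝ} (hρ : 0 ≤ ρ) (hr : 0 ≤ r) (z : σ → A⟦X⟧)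
    (hz : ∀ k, tnorm N r (z k) ≤ ρ) (α : σ →₀ ℕ) :
    tnorm N r (α.prod fun k e => z k ^ e) ≤ ρ ^ α.degree := by
  have hpow : ∀ k (e : ℕ), tnorm N r (z k ^ e) ≤ ρ ^ e := by
    intro k e
    induction e with
    | zero => simpa using tnorm_one_le
    | succ e ih =>
      rw [pow_succ, pow_succ]
      exact (tnorm_mul_le hr _ _).trans (mul_le_mul ih (hz k) (tnorm_nonneg hr _) (by positivity))
  rw [Finsupp.prod, Finsupp.degree_apply, ← Finset.prod_pow_eq_pow_sum]
  induction α.support using Finset.cons_induction with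
  | empty => simpa using tnorm_one_le
  | cons a s ha ih =>
    rw [Finset.prod_cons, Finset.prod_cons]
    exact (tnorm_mul_le hr _ _).trans
      (mul_le_mul (hpow _ _) ih (tnorm_nonneg hr _) (by positivity))

theorem sum_support_truncTotal_le {G : MvPowerSeries σ ℂ} {w : (σ →₀ ℕ) → ℝ} (hw : ∀ α, 0 ≤ w α)
    (hG : Summable fun α => ‖MvPowerSeries.coeff α G‖ * w α) (d : ℕ) :
    ∑ α ∈ (MvPowerSeries.truncTotal d G).support,
      ‖(MvPowerSeries.truncTotal d G).coeff α‖ * w α ≤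
      ∑' α, ‖MvPowerSeries.coeff α G‖ * w α := by
  refine le_trans (Finset.sum_le_sum fun α _ => ?_)
    (hG.sum_le_tsum (MvPowerSeries.truncTotal d G).support fun α _ =>
      mul_nonneg (norm_nonneg _) (hw α))
  gcongr
  · exact hw α
  rw [MvPowerSeries.coeff_truncTotal_eq_ite]
  split_ifs <;> simp

theorem tnorm_ev_le {G : MvPowerSeries σ ℂ} {ρ : ℝ} (hρ : 0 ≤ ρ)
    (hG : Summable fun α : σ →₀ ℕ => ‖MvPowerSeries.coeff α G‖ * ρ ^ α.degree)
    (hr : 0 ≤ r) (y : σ → A⟦X⟧) (hy : ∀ k, tnorm N r (PowerSeries.X * y k) ≤ ρ) :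
    tnorm N r (ev y G) ≤ ∑' α : σ →₀ ℕ, ‖MvPowerSeries.coeff α G‖ * ρ ^ α.degree := by
  have h1 : PowerSeries.X ^ N ∣ ev y G - ev y (MvPowerSeries.truncTotal N G) := by
    rw [← map_sub]
    exact X_pow_dvd_ev y (sub_truncTotal_mem N G)
  rw [tnorm_congr h1, ev_coe, MvPolynomial.aeval_def, MvPolynomial.eval₂_eq]
  refine (tnorm_sum_le _ hr _).trans ?_
  refine le_trans (Finset.sum_le_sum fun α _ => ?_)
    (sum_support_truncTotal_le (fun α => by positivity) hG N)
  rw [← Algebra.smul_def, tnorm_smul]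
  gcongr
  exact tnorm_prod_pow_le hρ hr _ hy α

theorem ev_mem_Bd {Hyp : ℕ → ℝ → Prop} {G : MvPowerSeries σ ℂ} (hG : Cvg G) {y : σ → A⟦X⟧}
    (hy : ∀ k, y k ∈ Bd A Hyp) : ev y G ∈ Bd A Hyp := by
  obtain ⟨ρ, hρ, hG⟩ := hG
  obtain ⟨C, hC0, hC⟩ := Bd_family hy
  refine ⟨∑' α : σ →₀ ℕ, ‖MvPowerSeries.coeff α G‖ * ρ ^ α.degree, ?_⟩
  filter_upwards [hC, self_mem_nhdsWithin, mem_nhdsWithin_of_mem_nhds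
    (Iic_mem_nhds (show 0 < ρ / (C + 1) by positivity))] with r h hr hr' N hN
  have hr : 0 < r := hr
  refine tnorm_ev_le hρ.le hG hr.le y fun k => (tnorm_X_mul_le hr.le _).trans ?_
  calc r * tnorm N r (y k) ≤ ρ / (C + 1) * (C + 1) := by
        gcongr
        · exact tnorm_nonneg hr.le _
        · exact hr'
        · linarith [h N hN k]
    _ = ρ := by field_simp

/-- Second order Taylor expansion of a monomial, with a norm bound for all three parts. -/
theorem exists_taylor_monomial (ε : A⟦X⟧) (a h : σ → A⟦X⟧) {η ρ : ℝ} (hη : 0 ≤ η) (hρ : 0 ≤ ρ)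
    (α : σ →₀ ℕ) :
    ∃ q : A⟦X⟧,
      MvPolynomial.aeval (fun k => a k + ε * h k) (MvPolynomial.monomial α (1 : ℂ)) =
        MvPolynomial.aeval a (MvPolynomial.monomial α (1 : ℂ)) +
        ε * ∑ k, MvPolynomial.aeval a (MvPolynomial.pderiv k (MvPolynomial.monomial α (1 : ℂ))) * h k
        + ε ^ 2 * q ∧
      ∀ N r, 0 ≤ r → tnorm N r ε ≤ η → (∀ k, tnorm N r (a k) + η * tnorm N r (h k) ≤ ρ) →
        tnorm N r (MvPolynomial.aeval a (MvPolynomial.monomial α (1 : ℂ))) +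
        η * tnorm N r (∑ k, MvPolynomial.aeval a
          (MvPolynomial.pderiv k (MvPolynomial.monomial α (1 : ℂ))) * h k) +
        η ^ 2 * tnorm N r q ≤ ρ ^ α.degree := by
  classical
  obtain ⟨n, hn⟩ : ∃ n, α.degree = n := ⟨_, rfl⟩
  induction n generalizing α with
  | zero =>
    have : α = 0 := (Finsupp.degree_eq_zero_iff α).1 hn
    subst this
    refine ⟨0, by simp, fun N r hr _ _ => ?_⟩
    simpa using tnorm_one_le
  | succ n ih =>
    have hne : α ≠ 0 := by rintro rfl; simp at hn
    obtain ⟨i, hi⟩ := Finsupp.ne_iff.1 hne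
    have hle : Finsupp.single i 1 ≤ α := by
      rw [Finsupp.single_le_iff]; exact Nat.one_le_iff_ne_zero.2 hi
    obtain ⟨β, rfl⟩ := exists_add_of_le hle
    have hβ : β.degree = n := by simp at hn; omega
    obtain ⟨q, hq, hb⟩ := ih β hβ
    have hmon : MvPolynomial.monomial (Finsupp.single i 1 + β) (1 : ℂ) =
        MvPolynomial.monomial β 1 * MvPolynomial.X i := by
      rw [MvPolynomial.X, MvPolynomial.monomial_mul, add_comm]; simp
    rw [hmon]
    set p := MvPolynomial.monomial β (1 : ℂ)
    have hd : ∑ k, MvPolynomial.aeval a (MvPolynomial.pderiv k (p * MvPolynomial.X i)) * h k =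
        MvPolynomial.aeval a p * h i + a i * ∑ k, MvPolynomial.aeval a (MvPolynomial.pderiv k p) * h k := by
      simp only [Derivation.leibniz, MvPolynomial.pderiv_X, smul_eq_mul, map_add, map_mul,
        MvPolynomial.aeval_X, add_mul, Finset.sum_add_distrib, Finset.mul_sum]
      congr 1
      · rw [Finset.sum_eq_single i]
        · simp
        · intro k _ hk
          simp [hk.symm]
        · simp
      · exact Finset.sum_congr rfl fun k _ => by ring
    rw [hd]
    set b := ∑ k, MvPolynomial.aeval a (MvPolynomial.pderiv k p) * h k
    refine ⟨q * a i + b * h i + ε * (q * h i), ?_, ?_⟩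
    · rw [map_mul, map_mul, hq, MvPolynomial.aeval_X, MvPolynomial.aeval_X]
      ring
    · intro N r hr hε hN
      have h1 := hb N r hr hε hN
      have h2 := hN i
      have hdeg : (Finsupp.single i 1 + β).degree = β.degree + 1 := by simp; ring
      rw [hdeg, pow_succ, map_mul, MvPolynomial.aeval_X]
      set P := MvPolynomial.aeval a p
      have e1 := tnorm_mul_le (N := N) hr P (a i)
      have e2 : tnorm N r (P * h i + a i * b) ≤
          tnorm N r P * tnorm N r (h i) + tnorm N r (a i) * tnorm N r b :=
        (tnorm_add_le hr _ _).trans (add_le_add (tnorm_mul_le hr _ _) (tnorm_mul_le hr _ _))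
      have e3 : tnorm N r (q * a i + b * h i + ε * (q * h i)) ≤
          tnorm N r q * tnorm N r (a i) + tnorm N r b * tnorm N r (h i) +
            η * (tnorm N r q * tnorm N r (h i)) := by
        refine (tnorm_add_le hr _ _).trans (add_le_add ((tnorm_add_le hr _ _).trans
          (add_le_add (tnorm_mul_le hr _ _) (tnorm_mul_le hr _ _))) ((tnorm_mul_le hr _ _).trans ?_))
        exact mul_le_mul hε (tnorm_mul_le hr _ _) (tnorm_nonneg hr _) hη
      have n1 := tnorm_nonneg (N := N) hr P
      have n2 := tnorm_nonneg (N := N) hr b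
      have n3 := tnorm_nonneg (N := N) hr q
      have n4 := tnorm_nonneg (N := N) hr (a i)
      have n5 := tnorm_nonneg (N := N) hr (h i)
      calc _ ≤ tnorm N r P * tnorm N r (a i) +
            η * (tnorm N r P * tnorm N r (h i) + tnorm N r (a i) * tnorm N r b) +
            η ^ 2 * (tnorm N r q * tnorm N r (a i) + tnorm N r b * tnorm N r (h i) +
            η * (tnorm N r q * tnorm N r (h i))) :=
            add_le_add (add_le_add e1 (mul_le_mul_of_nonneg_left e2 hη))
              (mul_le_mul_of_nonneg_left e3 (sq_nonneg η))
        _ = (tnorm N r P + η * tnorm N r b + η ^ 2 * tnorm N r q) *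
            (tnorm N r (a i) + η * tnorm N r (h i)) := by ring
        _ ≤ _ := mul_le_mul h1 h2 (by positivity) (by positivity)

theorem exists_taylor_poly (ε : A⟦X⟧) (a h : σ → A⟦X⟧) {η ρ : ℝ} (hη : 0 ≤ η) (hρ : 0 ≤ ρ)
    (p : MvPolynomial σ ℂ) :
    ∃ q : A⟦X⟧,
      MvPolynomial.aeval (fun k => a k + ε * h k) p =
        MvPolynomial.aeval a p +
        ε * ∑ k, MvPolynomial.aeval a (MvPolynomial.pderiv k p) * h k + ε ^ 2 * q ∧
      ∀ N r, 0 ≤ r → tnorm N r ε ≤ η → (∀ k, tnorm N r (a k) + η * tnorm N r (h k) ≤ ρ) →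
        η ^ 2 * tnorm N r q ≤ ∑ α ∈ p.support, ‖p.coeff α‖ * ρ ^ α.degree := by
  choose q hq hb using exists_taylor_monomial (σ := σ) ε a h hη hρ
  refine ⟨∑ α ∈ p.support, p.coeff α • q α, ?_, ?_⟩
  · have hp : p = ∑ α ∈ p.support, p.coeff α • MvPolynomial.monomial α (1 : ℂ) := by
      conv_lhs => rw [p.as_sum]
      exact Finset.sum_congr rfl fun α _ => by rw [MvPolynomial.smul_monomial]; simp
    have hL : ∀ z : σ → A⟦X⟧, MvPolynomial.aeval z p =
        ∑ α ∈ p.support, p.coeff α • MvPolynomial.aeval z (MvPolynomial.monomial α (1 : ℂ)) := by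
      intro z
      conv_lhs => rw [hp]
      simp only [map_sum, map_smul]
    have hD : ∑ k, MvPolynomial.aeval a (MvPolynomial.pderiv k p) * h k = ∑ α ∈ p.support, p.coeff α •
        ∑ k, MvPolynomial.aeval a (MvPolynomial.pderiv k (MvPolynomial.monomial α (1 : ℂ))) * h k := by
      simp only [Finset.smul_sum]
      rw [Finset.sum_comm]
      refine Finset.sum_congr rfl fun k _ => ?_
      conv_lhs => rw [hp]
      simp only [map_sum, Derivation.map_smul, map_smul, Finset.sum_mul, smul_mul_assoc]
    rw [hD, hL, hL, Finset.mul_sum, Finset.mul_sum, ← Finset.sum_add_distrib,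
      ← Finset.sum_add_distrib]
    refine Finset.sum_congr rfl fun α _ => ?_
    rw [hq, mul_smul_comm, mul_smul_comm, smul_add, smul_add]
  · intro N r hr hε hN
    refine (mul_le_mul_of_nonneg_left (tnorm_sum_le _ hr _) (by positivity)).trans ?_
    rw [Finset.mul_sum]
    refine Finset.sum_le_sum fun α _ => ?_
    rw [tnorm_smul]
    have h1 := hb α N r hr hε hN
    have h2 := tnorm_nonneg (N := N) hr (MvPolynomial.aeval a (MvPolynomial.monomial α (1 : ℂ)))
    have h3 := mul_nonneg hη (tnorm_nonneg (N := N) hr (∑ k, MvPolynomial.aeval a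
          (MvPolynomial.pderiv k (MvPolynomial.monomial α (1 : ℂ))) * h k))
    calc η ^ 2 * (‖p.coeff α‖ * tnorm N r (q α)) = ‖p.coeff α‖ * (η ^ 2 * tnorm N r (q α)) := by ring
      _ ≤ _ := by gcongr; linarith

theorem X_pow_dvd_of_mul {k d : ℕ} {p : A⟦X⟧}
    (h : (PowerSeries.X : A⟦X⟧) ^ (d + k) ∣ PowerSeries.X ^ k * p) : PowerSeries.X ^ d ∣ p := by
  rw [PowerSeries.X_pow_dvd_iff] at h ⊢
  intro m hm
  have := h (m + k) (by omega)
  rwa [PowerSeries.coeff_X_pow_mul] at this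

theorem X_pow_mul_cancel {k : ℕ} {p q : A⟦X⟧}
    (h : (PowerSeries.X : A⟦X⟧) ^ k * p = PowerSeries.X ^ k * q) : p = q := by
  ext m
  have := congrArg (PowerSeries.coeff (m + k)) h
  rwa [PowerSeries.coeff_X_pow_mul, PowerSeries.coeff_X_pow_mul] at this

/-- Second order Taylor expansion with remainder control. -/
theorem exists_taylor {Hyp : ℕ → ℝ → Prop} {G : MvPowerSeries σ ℂ} (hG : Cvg G) {y h : σ → A⟦X⟧}
    (hy : ∀ k, y k ∈ Bd A Hyp) (hh : ∀ k, h k ∈ Bd A Hyp) (M : ℕ) :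
    ∃ Q ∈ Bd A Hyp, ev (fun k => y k + PowerSeries.X ^ M * h k) G =
      ev y G + PowerSeries.X ^ (M + 1) * ∑ k, ev y (MvPowerSeries.pderiv ℂ k G) * h k +
        PowerSeries.X ^ (2 * M + 2) * Q := by
  obtain ⟨ρ, hρ, hG⟩ := hG
  obtain ⟨C, hC0, hC⟩ := Bd_family hy
  obtain ⟨C', hC0', hC'⟩ := Bd_family hh
  set η : ℝ := ρ / (2 * (C' + 1))
  have hη : 0 < η := by positivity
  set ε : A⟦X⟧ := PowerSeries.X ^ (M + 1)
  have key := fun d => exists_taylor_poly ε (fun k => PowerSeries.X * y k) h hη.le hρ.le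
    (MvPowerSeries.truncTotal d G)
  choose q hq hb using key
  have hev : ∀ p : MvPolynomial σ ℂ, ev (fun k => y k + PowerSeries.X ^ M * h k) p =
      MvPolynomial.aeval (fun k => PowerSeries.X * y k + ε * h k) p := by
    intro p
    rw [ev_coe]
    congr 2
    funext k
    simp only [ε]
    ring
  set R : MvPowerSeries σ ℂ → A⟦X⟧ := fun G => ev (fun k => y k + PowerSeries.X ^ M * h k) G -
    ev y G - ε * ∑ k, ev y (MvPowerSeries.pderiv ℂ k G) * h k with hR
  have hRsub : ∀ a b, R a - R b = R (a - b) := by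
    intro a b
    simp only [hR, map_sub, sub_mul, Finset.sum_sub_distrib]
    ring
  have hRq : ∀ d, R (MvPowerSeries.truncTotal d G) = ε ^ 2 * q d := by
    intro d
    simp only [hR]
    rw [hev, hq, ev_coe]
    simp only [MvPowerSeries.pderiv_coe, ev_coe]
    ring
  have hRd : ∀ d, PowerSeries.X ^ d ∣ R G - ε ^ 2 * q d := by
    intro d
    rw [← hRq, hRsub]
    have hm := sub_truncTotal_mem d G
    refine dvd_sub (dvd_sub (X_pow_dvd_ev _ hm) (X_pow_dvd_ev _ hm)) ?_
    rw [Finset.mul_sum]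
    refine Finset.dvd_sum fun k _ => ?_
    rw [← mul_assoc]
    refine Dvd.dvd.mul_right ?_ _
    rcases d with _ | d
    · simp
    · rw [pow_succ' _ d]
      refine mul_dvd_mul ?_ (X_pow_dvd_ev _ (pderiv_mem_ordGE hm k))
      exact dvd_pow_self _ (Nat.succ_ne_zero M)
  have hε2 : ε ^ 2 = PowerSeries.X ^ (2 * M + 2) := by simp only [ε, ← pow_mul]; congr 1; ring
  obtain ⟨Q, hQ⟩ : PowerSeries.X ^ (2 * M + 2) ∣ R G := by
    have := hRd (2 * M + 2)
    rw [hε2] at this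
    exact (dvd_sub_left (dvd_mul_right _ _)).1 this
  refine ⟨Q, ?_, ?_⟩
  · refine ⟨(∑' α : σ →₀ ℕ, ‖MvPowerSeries.coeff α G‖ * ρ ^ α.degree) / η ^ 2, ?_⟩
    filter_upwards [hC, hC', self_mem_nhdsWithin, mem_nhdsWithin_of_mem_nhds
      (Iic_mem_nhds (show 0 < ρ / (2 * (C + 1)) by positivity)), mem_nhdsWithin_of_mem_nhds
      (Iic_mem_nhds hη), mem_nhdsWithin_of_mem_nhds (Iic_mem_nhds one_pos)]
      with r h1 h2 hr hr' hrη hr1 N hN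
    have hr : 0 < r := hr
    have hr1 : r ≤ 1 := hr1
    have hcong : PowerSeries.X ^ N ∣ Q - q (N + (2 * M + 2)) := by
      apply X_pow_dvd_of_mul (k := 2 * M + 2)
      have := hRd (N + (2 * M + 2))
      rwa [hQ, hε2, ← mul_sub] at this
    rw [tnorm_congr hcong, le_div_iff₀ (by positivity), mul_comm]
    refine (hb _ N r hr.le ?_ ?_).trans
      (sum_support_truncTotal_le (fun α => by positivity) hG _)
    · refine (tnorm_X_pow_le hr.le _).trans (le_trans ?_ hrη)
      rw [pow_succ]
      exact mul_le_of_le_one_left hr.le (pow_le_one₀ hr.le hr1)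
    · intro k
      have b1 : tnorm N r (PowerSeries.X * y k) ≤ ρ / (2 * (C + 1)) * (C + 1) := by
        refine (tnorm_X_mul_le hr.le _).trans ?_
        gcongr
        · exact tnorm_nonneg hr.le _
        · exact hr'
        · linarith [h1 N hN k]
      have b2 : η * tnorm N r (h k) ≤ ρ / (2 * (C' + 1)) * (C' + 1) := by
        gcongr
        linarith [h2 N hN k]
      have c1 : ρ / (2 * (C + 1)) * (C + 1) = ρ / 2 := by field_simp
      have c2 : ρ / (2 * (C' + 1)) * (C' + 1) = ρ / 2 := by field_simp
      linarith
  · rw [← hQ]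
    simp only [hR]
    ring

end CvgSeries

section Inverse
variable {A : Type*} [SeminormedCommRing A] [NormedAlgebra ℂ A] [NormOneClass A]

theorem exists_inverse_mem_Conv {u : A⟦X⟧} (hu : u ∈ Conv A)
    (h0 : IsUnit (PowerSeries.constantCoeff u)) : ∃ w ∈ Conv A, u * w = 1 := by
  obtain ⟨a, ha⟩ := h0
  set b : A := (↑a⁻¹ : A)
  set w := PowerSeries.invOfUnit u a
  have huw : u * w = 1 := PowerSeries.mul_invOfUnit u a ha.symm
  obtain ⟨v, hv⟩ : PowerSeries.X ∣ u - PowerSeries.C (a : A) := by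
    rw [PowerSeries.X_dvd_iff]; simp [ha]
  have hvC : v ∈ Conv A := by
    refine Conv_of_X_pow_mul (k := 1) ?_
    rw [pow_one, ← hv]
    exact sub_mem hu (C_mem_Bd _)
  have hw : w = PowerSeries.C b * (1 - PowerSeries.X * (v * w)) := by
    have h1 : PowerSeries.C (a : A) * w = 1 - PowerSeries.X * (v * w) := by
      rw [← mul_assoc, ← hv, sub_mul, huw]; ring
    have h2 : PowerSeries.C b * PowerSeries.C (a : A) = 1 := by
      rw [← map_mul]; simp [b]
    rw [← h1, ← mul_assoc, h2, one_mul]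
  refine ⟨w, ?_, huw⟩
  obtain ⟨C, hC⟩ := hvC
  set K := ‖b‖ + 1
  have hK : 0 < K := by positivity
  have hC0 : 0 ≤ C := by
    obtain ⟨r, hr, hr0⟩ := (hC.and self_mem_nhdsWithin).exists
    exact (tnorm_nonneg (le_of_lt hr0) v).trans (hr 0 trivial)
  refine ⟨K, ?_⟩
  filter_upwards [hC, self_mem_nhdsWithin, mem_nhdsWithin_of_mem_nhds
    (Iic_mem_nhds (show 0 < 1 / (K * (C * K) + 1) by positivity))] with r h hr hr' N _
  have hr : 0 < r := hr
  have hr' : r ≤ 1 / (K * (C * K) + 1) := hr'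
  rw [le_div_iff₀ (by positivity)] at hr'
  induction N with
  | zero => simpa [tnorm] using hK.le
  | succ N ih =>
    have h1 : tnorm (N + 1) r (PowerSeries.X * (v * w)) ≤ r * (C * K) := by
      rw [tnorm_X_mul]
      gcongr
      exact (tnorm_mul_le hr.le _ _).trans (mul_le_mul (h N trivial) ih (tnorm_nonneg hr.le _) hC0)
    have h2 : tnorm (N + 1) r (1 - PowerSeries.X * (v * w)) ≤ 1 + r * (C * K) := by
      rw [sub_eq_add_neg]
      refine (tnorm_add_le hr.le _ _).trans ?_
      rw [tnorm_neg]
      exact add_le_add tnorm_one_le h1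
    calc tnorm (N + 1) r w = tnorm (N + 1) r (PowerSeries.C b * (1 - PowerSeries.X * (v * w))) := by
          rw [← hw]
      _ ≤ ‖b‖ * (1 + r * (C * K)) := (tnorm_mul_le hr.le _ _).trans
          (mul_le_mul (tnorm_C_le b) h2 (tnorm_nonneg hr.le _) (norm_nonneg _))
      _ ≤ ‖b‖ + r * (K * (C * K)) := by
          have : ‖b‖ ≤ K := by simp [K]
          have h3 : 0 ≤ r * (C * K) := by positivity
          nlinarith
      _ ≤ K := by
          have : r * (K * (C * K)) ≤ 1 := by nlinarith
          linarith

theorem det_mem_subalgebra {R : Type*} [CommRing R] [Algebra ℂ R] (B : Subalgebra ℂ R) {ι : Type*} [Fintype ι]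
    [DecidableEq ι] {M : Matrix ι ι R} (h : ∀ i j, M i j ∈ B) : M.det ∈ B := by
  rw [Matrix.det_apply]
  refine sum_mem fun g _ => ?_
  rw [Units.smul_def]
  exact zsmul_mem (prod_mem fun i _ => h _ _) _

theorem adjugate_mem_subalgebra {R : Type*} [CommRing R] [Algebra ℂ R] (B : Subalgebra ℂ R) {ι : Type*} [Fintype ι]
    [DecidableEq ι] {M : Matrix ι ι R} (h : ∀ i j, M i j ∈ B) (i j : ι) : M.adjugate i j ∈ B := by
  rw [Matrix.adjugate_apply]
  refine det_mem_subalgebra B fun a b => ?_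
  rw [Matrix.updateRow_apply]
  split_ifs
  · rw [Pi.single_apply]; split_ifs
    · exact one_mem _
    · exact zero_mem _
  · exact h _ _

/-- A matrix whose determinant is `X ^ k` times a unit has an inverse up to `X ^ k`. -/
theorem exists_sharp (B : Subalgebra ℂ A⟦X⟧) {ι : Type*} [Fintype ι] [DecidableEq ι] {M : Matrix ι ι A⟦X⟧}
    (h : ∀ i j, M i j ∈ B) {k : ℕ} {u w : A⟦X⟧} (hd : M.det = PowerSeries.X ^ k * u)
    (hw : w ∈ B) (huw : u * w = 1) :
    ∃ S : Matrix ι ι A⟦X⟧, (∀ i j, S i j ∈ B) ∧ M * S = (PowerSeries.X ^ k : A⟦X⟧) • (1 : Matrix ι ι A⟦X⟧) ∧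
      S * M = (PowerSeries.X ^ k : A⟦X⟧) • (1 : Matrix ι ι A⟦X⟧) := by
  refine ⟨w • M.adjugate, fun i j => ?_, ?_, ?_⟩
  · rw [Matrix.smul_apply, smul_eq_mul]
    exact mul_mem hw (adjugate_mem_subalgebra B h i j)
  · rw [Matrix.mul_smul, Matrix.mul_adjugate, smul_smul, hd]
    congr 1
    linear_combination PowerSeries.X ^ k * huw
  · rw [Matrix.smul_mul, Matrix.adjugate_mul, smul_smul, hd]
    congr 1
    linear_combination PowerSeries.X ^ k * huw

end Inverse

section Core
variable {A : Type*} [SeminormedCommRing A] [NormedAlgebra ℂ A] [NormOneClass A]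
variable {σ ι κ : Type*} [Fintype σ] [Fintype ι] [Fintype κ] [DecidableEq ι] [DecidableEq κ]
  [DecidableEq σ]

/-- Values of a family of vector fields. -/
def xval (Xf : ι → σ → MvPowerSeries σ ℂ) (z : σ → A⟦X⟧) (i : ι) : σ → A⟦X⟧ :=
  fun b => ev z (Xf i b)

/-- Values of the Jacobian matrices. -/
def jac {ι : Type*} (F : ι → MvPowerSeries σ ℂ) (z : σ → A⟦X⟧) : Matrix ι σ A⟦X⟧ :=
  fun b a => ev z (MvPowerSeries.pderiv ℂ a (F b))

/-- The matrix with columns the vector fields and constant vectors. -/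
def frame (Xf : ι → σ → MvPowerSeries σ ℂ) (Cm : Matrix σ κ ℂ) :
    Matrix σ (ι ⊕ κ) (MvPowerSeries σ ℂ) :=
  fun b => Sum.elim (fun i => Xf i b) (fun j => algebraMap ℂ _ (Cm b j))

variable (Xf : ι → σ → MvPowerSeries σ ℂ) (F : κ → MvPowerSeries σ ℂ) (Cm : Matrix σ κ ℂ)

theorem frame_mulVec (z : σ → A⟦X⟧) (w : ι ⊕ κ → A⟦X⟧) :
    ((frame Xf Cm).map (ev z)) *ᵥ w =
      ∑ i, w (Sum.inl i) • xval Xf z i + Cm.map (algebraMap ℂ A⟦X⟧) *ᵥ fun j => w (Sum.inr j) := by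
  ext1 b
  simp only [Matrix.mulVec, dotProduct, frame, Fintype.sum_sum_type, Matrix.map_apply, Sum.elim_inl,
    Sum.elim_inr, Pi.add_apply, Finset.sum_apply, Pi.smul_apply, smul_eq_mul, xval, AlgHom.commutes]
  congr 1
  exact Finset.sum_congr rfl fun i _ => mul_comm _ _

theorem jac_mulVec_xval (hF : ∀ i j, ∑ a, Xf i a * MvPowerSeries.pderiv ℂ a (F j) = 0)
    (z : σ → A⟦X⟧) (i : ι) : jac F z *ᵥ xval Xf z i = 0 := by
  ext1 j
  have := congrArg (ev z) (hF i j)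
  simp only [map_sum, map_mul, map_zero] at this
  simp only [Matrix.mulVec, dotProduct, jac, xval, Pi.zero_apply]
  rw [← this]
  exact Finset.sum_congr rfl fun i _ => mul_comm _ _

theorem jac_comm (hX : ∀ i l b, ∑ a, Xf i a * MvPowerSeries.pderiv ℂ a (Xf l b) =
      ∑ a, Xf l a * MvPowerSeries.pderiv ℂ a (Xf i b))
    (z : σ → A⟦X⟧) (i l : ι) : jac (Xf l) z *ᵥ xval Xf z i = jac (Xf i) z *ᵥ xval Xf z l := by
  ext1 b
  have := congrArg (ev z) (hX i l b)
  simp only [map_sum, map_mul] at this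
  simp only [Matrix.mulVec, dotProduct, jac, xval]
  simpa only [mul_comm] using this

theorem dser_ev_eq {ι : Type*} (D : Derivation ℂ A A) (F : ι → MvPowerSeries σ ℂ) (z : σ → A⟦X⟧) (j : ι) :
    dser D (ev z (F j)) = (jac F z *ᵥ fun a => PowerSeries.X * dser D (z a)) j := by
  rw [dser_ev]; rfl

/-- Along the formal orbit the velocity is a combination, with constant coefficients, of the
commuting vector fields. -/
theorem exists_constant_coefficients (D : Derivation ℂ A A) (z : σ → A⟦X⟧)
    (hF : ∀ i j, ∑ a, Xf i a * MvPowerSeries.pderiv ℂ a (F j) = 0)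
    (hFz : ∀ j, dser D (ev z (F j)) = 0)
    (Z : σ → MvPowerSeries σ ℂ) (hZ : ∀ a, PowerSeries.X * dser D (z a) = ev z (Z a))
    (hZX : ∀ i b, ∑ a, Z a * MvPowerSeries.pderiv ℂ a (Xf i b) =
      ∑ a, Xf i a * MvPowerSeries.pderiv ℂ a (Z b))
    {k l : ℕ} (S : Matrix (ι ⊕ κ) σ A⟦X⟧)
    (hPS : ((frame Xf Cm).map (ev z)) * S = (PowerSeries.X ^ k : A⟦X⟧) • (1 : Matrix σ σ A⟦X⟧))
    (hSP : S * ((frame Xf Cm).map (ev z)) =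
      (PowerSeries.X ^ k : A⟦X⟧) • (1 : Matrix (ι ⊕ κ) (ι ⊕ κ) A⟦X⟧))
    (S2 : Matrix κ κ A⟦X⟧) (hS2 : S2 * (jac F z * Cm.map (algebraMap ℂ A⟦X⟧)) =
      (PowerSeries.X ^ l : A⟦X⟧) • (1 : Matrix κ κ A⟦X⟧)) :
    ∃ a : ι → A⟦X⟧, (∀ i, dser D (a i) = 0) ∧
      ∀ b, PowerSeries.X ^ k * (PowerSeries.X * dser D (z b)) = ∑ i, a i * ev z (Xf i b) := by
  set V : σ → A⟦X⟧ := fun a => PowerSeries.X * dser D (z a) with hV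
  set w := S *ᵥ V with hw
  have h1 : (PowerSeries.X ^ k : A⟦X⟧) • V = ((frame Xf Cm).map (ev z)) *ᵥ w := by
    rw [hw, Matrix.mulVec_mulVec, hPS, Matrix.smul_mulVec, Matrix.one_mulVec]
  have hJV : jac F z *ᵥ V = 0 := by
    ext1 j
    rw [← dser_ev_eq, hFz]; rfl
  rw [frame_mulVec] at h1
  have hκ : (fun j => w (Sum.inr j)) = 0 := by
    have h2 := congrArg (fun v => S2 *ᵥ (jac F z *ᵥ v)) h1
    simp only [Matrix.mulVec_smul, hJV, Matrix.mulVec_add, Matrix.mulVec_sum, jac_mulVec_xval Xf F hF,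
      smul_zero, Finset.sum_const_zero, zero_add, Matrix.mulVec_zero] at h2
    rw [Matrix.mulVec_mulVec, Matrix.mulVec_mulVec, Matrix.mul_assoc, hS2, Matrix.smul_mulVec,
      Matrix.one_mulVec] at h2
    ext1 j
    have h3 := congrFun h2 j
    simp only [Pi.zero_apply, Pi.smul_apply, smul_eq_mul] at h3
    exact X_pow_mul_cancel (k := l) (by rw [← h3]; simp)
  rw [hκ, Matrix.mulVec_zero, add_zero] at h1
  have h1' : ∀ b, PowerSeries.X ^ k * ev z (Z b) = ∑ i, w (Sum.inl i) * ev z (Xf i b) := by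
    intro b
    have := congrFun h1 b
    simpa [hV, hZ, xval] using this
  refine ⟨fun i => w (Sum.inl i), ?_, fun b => by rw [hZ]; exact h1' b⟩
  have h4 : ∀ b, ∑ i, dser D (w (Sum.inl i)) * ev z (Xf i b) = 0 := by
    intro b
    have h5 := congrArg (dser D) (h1' b)
    rw [dser_X_pow_mul, map_sum, dser_ev] at h5
    simp only [Derivation.leibniz, smul_eq_mul, Finset.sum_add_distrib, dser_ev, hZ] at h5
    have h6 : ∑ i, w (Sum.inl i) * ∑ a, ev z (MvPowerSeries.pderiv ℂ a (Xf i b)) * ev z (Z a) =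
        PowerSeries.X ^ k * ∑ a, ev z (MvPowerSeries.pderiv ℂ a (Z b)) * ev z (Z a) := by
      have : ∀ i, ∑ a, ev z (MvPowerSeries.pderiv ℂ a (Xf i b)) * ev z (Z a) =
          ∑ a, ev z (Xf i a) * ev z (MvPowerSeries.pderiv ℂ a (Z b)) := by
        intro i
        have := congrArg (ev z) (hZX i b)
        simp only [map_sum, map_mul] at this
        rw [← this]
        exact Finset.sum_congr rfl fun a _ => mul_comm _ _
      simp only [this, Finset.mul_sum]
      rw [Finset.sum_comm]
      refine Finset.sum_congr rfl fun a _ => ?_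
      have h7 := h1' a
      rw [mul_left_comm, h7, Finset.mul_sum]
      exact Finset.sum_congr rfl fun i _ => by ring
    rw [h6] at h5
    have h8 : ∑ i, ev z (Xf i b) * dser D (w (Sum.inl i)) = 0 := by linear_combination -h5
    rw [← h8]
    exact Finset.sum_congr rfl fun a _ => mul_comm _ _
  have h9 : ((frame Xf Cm).map (ev z)) *ᵥ (Sum.elim (fun i => dser D (w (Sum.inl i))) 0) = 0 := by
    rw [frame_mulVec]
    ext1 b
    have h0 : (fun j : κ => (0 : κ → A⟦X⟧) j) = 0 := rfl
    simp only [Sum.elim_inl, Sum.elim_inr, h0, Matrix.mulVec_zero, add_zero, Finset.sum_apply,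
      Pi.smul_apply, smul_eq_mul, xval]
    exact h4 b
  intro i
  have h10 := congrArg (fun v => S *ᵥ v) h9
  simp only [Matrix.mulVec_zero] at h10
  rw [Matrix.mulVec_mulVec, hSP, Matrix.smul_mulVec, Matrix.one_mulVec] at h10
  have h11 := congrFun h10 (Sum.inl i)
  simp only [Pi.smul_apply, Sum.elim_inl, smul_eq_mul, Pi.zero_apply] at h11
  exact X_pow_mul_cancel (k := k) (by rw [h11]; simp)

end Core

theorem Cvg.pderiv {σ : Type*} {G : MvPowerSeries σ ℂ} (hG : Cvg G) (k : σ) :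
    Cvg (MvPowerSeries.pderiv ℂ k G) := by
  obtain ⟨ρ, hρ, hG⟩ := hG
  refine ⟨ρ / 2, by positivity, ?_⟩
  have hinj : Function.Injective fun α : σ →₀ ℕ => α + Finsupp.single k 1 := add_left_injective _
  refine Summable.of_nonneg_of_le (fun α => by positivity) (fun α => ?_)
    ((hG.comp_injective hinj).mul_left ρ⁻¹)
  rw [MvPowerSeries.coeff_pderiv, norm_mul]
  have h1 : ‖((α k : ℂ) + 1)‖ ≤ 2 ^ α.degree := by
    have h2 : α k + 1 ≤ 2 ^ α.degree :=
      (Nat.succ_le_of_lt Nat.lt_two_pow_self).trans (Nat.pow_le_pow_right (by norm_num)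
        (Finsupp.le_degree k α))
    have h3 : ((α k : ℂ) + 1) = ((α k + 1 : ℕ) : ℂ) := by push_cast; ring
    rw [h3, Complex.norm_natCast]
    exact_mod_cast h2
  simp only [Function.comp]
  have hdeg : (α + Finsupp.single k 1).degree = α.degree + 1 := by simp
  rw [hdeg]
  calc _ ≤ ‖MvPowerSeries.coeff (α + Finsupp.single k 1) G‖ * 2 ^ α.degree * (ρ / 2) ^ α.degree := by
        gcongr
    _ = _ := by rw [div_pow, pow_succ]; field_simp

section Core
variable {A : Type*} [SeminormedCommRing A] [NormedAlgebra ℂ A] [NormOneClass A]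

theorem exists_eq_trunc_add (N : ℕ) (p : A⟦X⟧) :
    ∃ q : A⟦X⟧, p = (PowerSeries.trunc N p : A⟦X⟧) + PowerSeries.X ^ N * q ∧
      ∀ d, PowerSeries.coeff d q = PowerSeries.coeff (d + N) p := by
  refine ⟨PowerSeries.mk fun d => PowerSeries.coeff (d + N) p, ?_, fun d => by simp⟩
  ext d
  rw [map_add, Polynomial.coeff_coe, PowerSeries.coeff_trunc, PowerSeries.coeff_X_pow_mul']
  by_cases h : d < N
  · simp [h]
  · have h' : N ≤ d := not_lt.1 h
    simp [h, h', Nat.sub_add_cancel h']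

theorem coeff_mul_mem (I : Ideal A) {p q : A⟦X⟧} (h : ∀ d, PowerSeries.coeff d q ∈ I) (d : ℕ) :
    PowerSeries.coeff d (p * q) ∈ I := by
  rw [PowerSeries.coeff_mul]
  exact sum_mem fun x _ => I.mul_mem_left _ (h _)

theorem dser_trunc (D : Derivation ℂ A A) (N : ℕ) (p : A⟦X⟧) :
    dser D (PowerSeries.trunc N p : A⟦X⟧) = (PowerSeries.trunc N (dser D p) : A⟦X⟧) := by
  ext d
  rw [coeff_dser, Polynomial.coeff_coe, Polynomial.coeff_coe, PowerSeries.coeff_trunc,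
    PowerSeries.coeff_trunc]
  split_ifs <;> simp

theorem tnorm_le_of_coeff_le {N : ℕ} {r c : ℝ} (hr : 0 ≤ r) {p q : A⟦X⟧}
    (h : ∀ d, ‖PowerSeries.coeff d p‖ ≤ c * ‖PowerSeries.coeff d q‖) :
    tnorm N r p ≤ c * tnorm N r q := by
  rw [tnorm, tnorm, Finset.mul_sum]
  refine Finset.sum_le_sum fun d _ => ?_
  rw [← mul_assoc]
  gcongr
  exact h d

variable {σ ι κ : Type*} [Fintype σ] [Fintype ι] [Fintype κ] [DecidableEq ι] [DecidableEq κ]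
  [DecidableEq σ]
variable (Xf : ι → σ → MvPowerSeries σ ℂ) (F : κ → MvPowerSeries σ ℂ) (Cm : Matrix σ κ ℂ)

theorem X_pow_dvd_ev_sub {G : MvPowerSeries σ ℂ} {N : ℕ} {z z' : σ → A⟦X⟧}
    (h : ∀ a, PowerSeries.X ^ N ∣ z a - z' a) : PowerSeries.X ^ (N + 1) ∣ ev z G - ev z' G := by
  have hp : ∀ p : MvPolynomial σ ℂ, PowerSeries.X ^ (N + 1) ∣ ev z p - ev z' p := by
    intro p
    rw [ev_coe, ev_coe]
    rw [← Ideal.mem_span_singleton, ← Ideal.Quotient.eq]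
    have : ∀ w : σ → A⟦X⟧, Ideal.Quotient.mk (Ideal.span {(PowerSeries.X : A⟦X⟧) ^ (N + 1)})
        (MvPolynomial.aeval (fun k => PowerSeries.X * w k) p) =
        MvPolynomial.eval₂ ((Ideal.Quotient.mk (Ideal.span {(PowerSeries.X : A⟦X⟧) ^ (N + 1)})).comp
          (algebraMap ℂ A⟦X⟧)) (fun k => Ideal.Quotient.mk _ (PowerSeries.X * w k)) p := by
      intro w
      rw [MvPolynomial.aeval_def, MvPolynomial.hom_eval₂]
    rw [this, this]
    congr 1
    funext k
    rw [Ideal.Quotient.eq, Ideal.mem_span_singleton, ← mul_sub, pow_succ']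
    exact mul_dvd_mul_left _ (h k)
  have h1 := X_pow_dvd_ev z (sub_truncTotal_mem (N + 1) G)
  have h2 := X_pow_dvd_ev z' (sub_truncTotal_mem (N + 1) G)
  have h3 := hp (MvPowerSeries.truncTotal (N + 1) G)
  rw [map_sub] at h1 h2
  have := dvd_sub (dvd_add h1 h3) h2
  convert this using 1
  ring

theorem matrix_mulVec_mem (B : Subalgebra ℂ A⟦X⟧) {α β : Type*} [Fintype β] {M : Matrix α β A⟦X⟧}
    (hM : ∀ i j, M i j ∈ B) {v : β → A⟦X⟧} (hv : ∀ j, v j ∈ B) (i : α) : (M *ᵥ v) i ∈ B :=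
  sum_mem fun j _ => mul_mem (hM i j) (hv j)

/-- The linear algebra behind the linearized equation along an approximate orbit. -/
theorem linearized_identity (D : Derivation ℂ A A) (z : σ → A⟦X⟧)
    (hX : ∀ i l b, ∑ a, Xf i a * MvPowerSeries.pderiv ℂ a (Xf l b) =
      ∑ a, Xf l a * MvPowerSeries.pderiv ℂ a (Xf i b))
    {k M : ℕ} (τ : ι → A⟦X⟧) (u : κ → A⟦X⟧) (v : σ → A⟦X⟧)
    (hv : v = ∑ i, τ i • xval Xf z i + Cm.map (algebraMap ℂ A⟦X⟧) *ᵥ u)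
    (a α : ι → A⟦X⟧) (e : σ → A⟦X⟧) (Q : ι → σ → A⟦X⟧)
    (he : ∀ b, e b = PowerSeries.X ^ k * (PowerSeries.X * dser D (z b)) - ∑ i, a i * ev z (Xf i b))
    (hmain : ∀ b, PowerSeries.X ^ k *
        (PowerSeries.X * dser D (z b) + PowerSeries.X ^ M * dser D (v b)) =
      ∑ i, (a i + PowerSeries.X ^ (M + k) * α i) * (ev z (Xf i b) +
        PowerSeries.X ^ M * (jac (Xf i) z *ᵥ v) b + PowerSeries.X ^ (2 * M) * Q i b)) (b : σ) :
    PowerSeries.X ^ (k + M) * (∑ i, (dser D (τ i) - α i) * ev z (Xf i b) +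
      (Cm.map (algebraMap ℂ A⟦X⟧) *ᵥ fun j => dser D (u j)) b) =
    - e b - PowerSeries.X ^ M * ∑ i, τ i * (jac (Xf i) z *ᵥ e) b +
      PowerSeries.X ^ M * ∑ i, a i * (jac (Xf i) z *ᵥ (Cm.map (algebraMap ℂ A⟦X⟧) *ᵥ u)) b +
      PowerSeries.X ^ (2 * M) * ∑ i, a i * Q i b + PowerSeries.X ^ (2 * M + k) *
        ∑ i, α i * ((jac (Xf i) z *ᵥ v) b + PowerSeries.X ^ M * Q i b) := by
  set t : A⟦X⟧ := PowerSeries.X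
  set Cu := Cm.map (algebraMap ℂ A⟦X⟧) *ᵥ u with hCu
  -- derivative of the displacement
  have hCD : ∀ b, dser D (Cu b) = (Cm.map (algebraMap ℂ A⟦X⟧) *ᵥ fun j => dser D (u j)) b := by
    intro b
    simp only [hCu, Matrix.mulVec, dotProduct, map_sum, Derivation.leibniz, Matrix.map_apply,
      Derivation.map_algebraMap, mul_zero, add_zero, smul_eq_mul]
  have hdv : dser D (v b) = ∑ i, τ i * dser D (ev z (Xf i b)) + ∑ i, dser D (τ i) * ev z (Xf i b) +
      (Cm.map (algebraMap ℂ A⟦X⟧) *ᵥ fun j => dser D (u j)) b := by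
    rw [hv]
    simp only [Pi.add_apply, map_add, Finset.sum_apply, Pi.smul_apply, smul_eq_mul, map_sum, hCD,
      Derivation.leibniz, Finset.sum_add_distrib, xval]
    congr 2
    exact Finset.sum_congr rfl fun i _ => mul_comm _ _
  -- the drift of the vector fields along the approximate orbit
  have hdx : ∀ i, t ^ k * dser D (ev z (Xf i b)) =
      ∑ l, a l * (jac (Xf l) z *ᵥ xval Xf z i) b + (jac (Xf i) z *ᵥ e) b := by
    intro i
    have h1 : (t ^ k • fun b => t * dser D (z b)) = ∑ l, a l • xval Xf z l + e := by
      ext1 b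
      simp only [Pi.add_apply, Finset.sum_apply, Pi.smul_apply, smul_eq_mul, xval, he]
      ring
    have h2 := congrArg (fun v => (jac (Xf i) z *ᵥ v) b) h1
    simp only [Matrix.mulVec_smul, Matrix.mulVec_add, Matrix.mulVec_sum, Pi.add_apply,
      Finset.sum_apply, Pi.smul_apply, smul_eq_mul] at h2
    rw [dser_ev_eq D (Xf i), h2]
    simp only [jac_comm Xf hX z i]
  have hJv : ∀ l, (jac (Xf l) z *ᵥ v) b =
      ∑ i, τ i * (jac (Xf l) z *ᵥ xval Xf z i) b + (jac (Xf l) z *ᵥ Cu) b := by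
    intro l
    rw [hv]
    simp only [Matrix.mulVec_smul, Matrix.mulVec_add, Matrix.mulVec_sum, Pi.add_apply,
      Finset.sum_apply, Pi.smul_apply, smul_eq_mul]
  have hV1 : t ^ k * ∑ i, τ i * dser D (ev z (Xf i b)) =
      ∑ l, a l * ∑ i, τ i * (jac (Xf l) z *ᵥ xval Xf z i) b +
        ∑ i, τ i * (jac (Xf i) z *ᵥ e) b := by
    simp only [Finset.mul_sum]
    rw [Finset.sum_comm, ← Finset.sum_add_distrib]
    refine Finset.sum_congr rfl fun i _ => ?_
    rw [mul_left_comm, hdx, mul_add, Finset.mul_sum]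
    congr 1
    exact Finset.sum_congr rfl fun l _ => by ring
  have hsum : ∑ l, a l * (jac (Xf l) z *ᵥ v) b =
      ∑ l, a l * ∑ i, τ i * (jac (Xf l) z *ᵥ xval Xf z i) b + ∑ l, a l * (jac (Xf l) z *ᵥ Cu) b := by
    rw [← Finset.sum_add_distrib]
    exact Finset.sum_congr rfl fun l _ => by rw [hJv]; ring
  have hm := hmain b
  have hexp : ∑ i, (a i + t ^ (M + k) * α i) * (ev z (Xf i b) +
        t ^ M * (jac (Xf i) z *ᵥ v) b + t ^ (2 * M) * Q i b) =
      ∑ i, a i * ev z (Xf i b) + t ^ M * ∑ i, a i * (jac (Xf i) z *ᵥ v) b +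
      t ^ (2 * M) * ∑ i, a i * Q i b + t ^ (M + k) * ∑ i, α i * ev z (Xf i b) +
      t ^ (2 * M + k) * ∑ i, α i * ((jac (Xf i) z *ᵥ v) b + t ^ M * Q i b) := by
    simp only [Finset.mul_sum, ← Finset.sum_add_distrib]
    exact Finset.sum_congr rfl fun l _ => by ring
  rw [hexp, hsum, hdv] at hm
  have hsub : ∑ i, (dser D (τ i) - α i) * ev z (Xf i b) =
      ∑ i, dser D (τ i) * ev z (Xf i b) - ∑ i, α i * ev z (Xf i b) := by
    rw [← Finset.sum_sub_distrib]
    exact Finset.sum_congr rfl fun l _ => by ring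
  rw [hsub]
  have he' := he b
  rw [show k + M = M + k by ring]
  linear_combination hm - t ^ M * hV1 + he'

end Core

section Core
variable {A : Type*} [SeminormedCommRing A] [NormedAlgebra ℂ A] [NormOneClass A]
variable {σ ι κ : Type*} [Fintype σ] [Fintype ι] [Fintype κ] [DecidableEq ι] [DecidableEq κ]
  [DecidableEq σ]

theorem exists_sharp_of_det {ν : Type*} [Fintype ν] [DecidableEq ν]
    (G : Matrix ν ν (MvPowerSeries σ ℂ)) {z' z : σ → A⟦X⟧} {k : ℕ} {u : A⟦X⟧}
    (hu : ev z' G.det = PowerSeries.X ^ k * u) (hu0 : IsUnit (PowerSeries.constantCoeff u))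
    (hz : ∀ a, PowerSeries.X ^ k ∣ z a - z' a) (B : Subalgebra ℂ A⟦X⟧)
    (hB : ∀ p ∈ B, IsUnit (PowerSeries.constantCoeff p) → ∃ w ∈ B, p * w = 1)
    (hBX : ∀ p, PowerSeries.X ^ k * p ∈ B → p ∈ B) (hG : ∀ i j, ev z (G i j) ∈ B) :
    ∃ S : Matrix ν ν A⟦X⟧, (∀ i j, S i j ∈ B) ∧
      G.map (ev z) * S = (PowerSeries.X ^ k : A⟦X⟧) • (1 : Matrix ν ν A⟦X⟧) ∧
      S * G.map (ev z) = (PowerSeries.X ^ k : A⟦X⟧) • (1 : Matrix ν ν A⟦X⟧) := by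
  obtain ⟨q, hq⟩ := X_pow_dvd_ev_sub (G := G.det) hz
  have hdet : ev z G.det = PowerSeries.X ^ k * (u + PowerSeries.X * q) := by
    rw [hu] at hq
    linear_combination hq
  have hmap : (G.map (ev z)).det = ev z G.det := by
    rw [← AlgHom.mapMatrix_apply, ← AlgHom.map_det]
  have hmem : u + PowerSeries.X * q ∈ B := by
    refine hBX _ ?_
    rw [← hdet, ← hmap]
    exact det_mem_subalgebra B fun i j => hG i j
  obtain ⟨w, hw, hw1⟩ := hB _ hmem (by simpa using hu0)
  exact exists_sharp B (M := G.map (ev z)) (fun i j => hG i j) (hmap.trans hdet) hw hw1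

theorem exists_inverse_of_isUnit {p : A⟦X⟧} (h : IsUnit (PowerSeries.constantCoeff p)) :
    ∃ w, p * w = 1 := (PowerSeries.isUnit_iff_constantCoeff.2 h).exists_right_inv

variable (Xf : ι → σ → MvPowerSeries σ ℂ) (F : κ → MvPowerSeries σ ℂ) (Cm : Matrix σ κ ℂ)

/-- The Jacobian matrix of a family of series applied to constant vectors. -/
def jacC : Matrix κ κ (MvPowerSeries σ ℂ) :=
  fun i j => ∑ a, MvPowerSeries.pderiv ℂ a (F i) * algebraMap ℂ _ (Cm a j)

theorem jacC_map (z : σ → A⟦X⟧) :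
    (jacC F Cm).map (ev z) = jac F z * Cm.map (algebraMap ℂ A⟦X⟧) := by
  refine Matrix.ext fun i j => ?_
  rw [Matrix.map_apply, jacC, Matrix.mul_apply, map_sum]
  exact Finset.sum_congr rfl fun a _ => by simp [jac]

theorem exists_sharp_frame (e : ι ⊕ κ ≃ σ) {z' z : σ → A⟦X⟧} {k : ℕ} {u : A⟦X⟧}
    (hu : ev z' ((frame Xf Cm).submatrix id e.symm).det = PowerSeries.X ^ k * u)
    (hu0 : IsUnit (PowerSeries.constantCoeff u))
    (hz : ∀ a, PowerSeries.X ^ k ∣ z a - z' a) (B : Subalgebra ℂ A⟦X⟧)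
    (hB : ∀ p ∈ B, IsUnit (PowerSeries.constantCoeff p) → ∃ w ∈ B, p * w = 1)
    (hBX : ∀ p, PowerSeries.X ^ k * p ∈ B → p ∈ B) (hG : ∀ i j, ev z (frame Xf Cm i j) ∈ B) :
    ∃ S : Matrix (ι ⊕ κ) σ A⟦X⟧, (∀ i j, S i j ∈ B) ∧
      (frame Xf Cm).map (ev z) * S = (PowerSeries.X ^ k : A⟦X⟧) • (1 : Matrix σ σ A⟦X⟧) ∧
      S * (frame Xf Cm).map (ev z) =
        (PowerSeries.X ^ k : A⟦X⟧) • (1 : Matrix (ι ⊕ κ) (ι ⊕ κ) A⟦X⟧) := by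
  obtain ⟨S, hS, h1, h2⟩ := exists_sharp_of_det _ hu hu0 hz B hB hBX (fun i j => hG i _)
  refine ⟨S.submatrix e id, fun i j => hS _ _, ?_, ?_⟩
  · rw [← h1]
    refine Matrix.ext fun i j => ?_
    simp only [Matrix.mul_apply, Matrix.submatrix_apply, Matrix.map_apply, id]
    exact Fintype.sum_equiv e _ _ fun x => by simp
  · have h3 := congrArg (fun M : Matrix σ σ A⟦X⟧ => M.submatrix e e) h2
    simp only [Matrix.submatrix_smul, Matrix.submatrix_one_equiv, Pi.smul_apply] at h3
    rw [← h3]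
    refine Matrix.ext fun i j => ?_
    simp [Matrix.mul_apply]

/-- Convergence of a formal periodic family of orbits of a formal vector field commuting with an
integrable system. -/
theorem mem_Conv_of_formal_orbit (D : Derivation ℂ A A) (I : Ideal A) {c : ℝ} (hc : 0 ≤ c)
    (hInt : ∀ τ α h : A, τ ∈ I → D α = 0 → D τ = α + h → ‖τ‖ ≤ c * ‖h‖ ∧ ‖α‖ ≤ c * ‖h‖)
    (hXc : ∀ i b, Cvg (Xf i b)) (hFc : ∀ j, Cvg (F j))
    (hX : ∀ i l b, ∑ a, Xf i a * MvPowerSeries.pderiv ℂ a (Xf l b) =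
      ∑ a, Xf l a * MvPowerSeries.pderiv ℂ a (Xf i b))
    (hF : ∀ i j, ∑ a, Xf i a * MvPowerSeries.pderiv ℂ a (F j) = 0)
    (z' : σ → A⟦X⟧) (hz'I : ∀ a d, PowerSeries.coeff (d + 1) (z' a) ∈ I)
    (hF1 : ∀ j, ev z' (F j) ∈ Conv A) (hF0 : ∀ j, dser D (ev z' (F j)) = 0)
    (Z : σ → MvPowerSeries σ ℂ) (hZ : ∀ a, PowerSeries.X * dser D (z' a) = ev z' (Z a))
    (hZX : ∀ i b, ∑ a, Z a * MvPowerSeries.pderiv ℂ a (Xf i b) =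
      ∑ a, Xf i a * MvPowerSeries.pderiv ℂ a (Z b))
    (e : ι ⊕ κ ≃ σ) {k l : ℕ} {g1 g2 : A⟦X⟧}
    (hg1 : ev z' ((frame Xf Cm).submatrix id e.symm).det = PowerSeries.X ^ k * g1)
    (hg1u : IsUnit (PowerSeries.constantCoeff g1))
    (hg2 : ev z' (jacC F Cm).det = PowerSeries.X ^ l * g2)
    (hg2u : IsUnit (PowerSeries.constantCoeff g2)) (a : σ) : z' a ∈ Conv A := by
  set t : A⟦X⟧ := PowerSeries.X with ht
  -- the velocity has constant coefficients
  obtain ⟨A', hA'0, hA'⟩ : ∃ a : ι → A⟦X⟧, (∀ i, dser D (a i) = 0) ∧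
      ∀ b, t ^ k * (t * dser D (z' b)) = ∑ i, a i * ev z' (Xf i b) := by
    obtain ⟨S, -, h1, h2⟩ := exists_sharp_frame Xf Cm e hg1 hg1u (z := z') (by simp) ⊤
      (fun p _ hp => by simpa using exists_inverse_of_isUnit hp) (by simp) (by simp)
    obtain ⟨S2, -, h3, h4⟩ := exists_sharp_of_det _ hg2 hg2u (z := z') (by simp) ⊤
      (fun p _ hp => by simpa using exists_inverse_of_isUnit hp) (by simp) (by simp)
    rw [jacC_map] at h4
    exact exists_constant_coefficients Xf F Cm D z' hF hF0 Z hZ hZX S h1 h2 S2 h4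
  -- truncation
  choose h hh hhc using fun a => exists_eq_trunc_add (5 * k + 2 * l + 3) (z' a)
  set z : σ → A⟦X⟧ := fun a => (PowerSeries.trunc (5 * k + 2 * l + 3) (z' a) : A⟦X⟧) with hz
  have hzz : ∀ a, z' a = z a + t ^ (5 * k + 2 * l + 3) * h a := hh
  have hzC : ∀ a, z a ∈ Conv A := fun a => coe_polynomial_mem_Bd _
  have hdvd : ∀ a, t ^ (5 * k + 2 * l + 3) ∣ z a - z' a := fun a => ⟨- h a, by rw [hzz]; ring⟩
  have hhI : ∀ a d, PowerSeries.coeff d (h a) ∈ I := by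
    intro a d
    rw [hhc, show d + (5 * k + 2 * l + 3) = d + (5 * k + 2 * l + 2) + 1 by ring]
    exact hz'I _ _
  choose α0 hα0 hα0c using fun i => exists_eq_trunc_add (4 * k + l + 3) (A' i)
  set a0 : ι → A⟦X⟧ := fun i => (PowerSeries.trunc (4 * k + l + 3) (A' i) : A⟦X⟧) with ha0
  have hAA : ∀ i, A' i = a0 i + t ^ (4 * k + l + 3) * α0 i := hα0
  have ha0C : ∀ i, a0 i ∈ Conv A := fun i => coe_polynomial_mem_Bd _
  set α : ι → A⟦X⟧ := fun i => t ^ (k + 1) * α0 i with hα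
  have hα0D : ∀ i, dser D (α0 i) = 0 := by
    intro i
    ext d
    rw [coeff_dser, hα0c, ← coeff_dser, hA'0]; simp
  have hαD : ∀ i, dser D (α i) = 0 := by
    intro i
    simp only [hα, ht]
    rw [dser_X_pow_mul, hα0D, mul_zero]
  have hevC : ∀ {G : MvPowerSeries σ ℂ}, Cvg G → ev z G ∈ Conv A := fun hG => ev_mem_Bd hG hzC
  have hJC : ∀ i b a, jac (Xf i) z b a ∈ Conv A := fun i b a => hevC ((hXc i b).pderiv a)
  have hframeC : ∀ i j, (frame Xf Cm).map (ev z) i j ∈ Conv A := by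
    rintro b (i | j)
    · exact hevC (hXc i b)
    · simp [frame, algebraMap_mem]
  have hCmC : ∀ b j, (Cm.map (algebraMap ℂ A⟦X⟧)) b j ∈ Conv A :=
    fun b j => algebraMap_mem (Conv A) (Cm b j)
  obtain ⟨S, hSC, hPS, hSP⟩ := exists_sharp_frame Xf Cm e hg1 hg1u
    (fun a => (pow_dvd_pow t (by omega)).trans (hdvd a)) (Conv A)
    (fun p hp hu => exists_inverse_mem_Conv hp hu) (fun p hp => Conv_of_X_pow_mul hp) hframeC
  obtain ⟨S2, hS2C, -, hS2⟩ := exists_sharp_of_det _ hg2 hg2u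
    (fun a => (pow_dvd_pow t (by omega)).trans (hdvd a)) (Conv A)
    (fun p hp hu => exists_inverse_mem_Conv hp hu) (fun p hp => Conv_of_X_pow_mul hp)
    (by
      intro i j
      have h1 := congrFun (congrFun (jacC_map F Cm z) i) j
      rw [Matrix.map_apply] at h1
      rw [h1, Matrix.mul_apply]
      exact sum_mem fun b _ => mul_mem (hevC ((hFc i).pderiv b)) (hCmC b j))
  rw [jacC_map] at hS2
  -- the displacement in the frame
  set w0 := S *ᵥ h with hw0
  have hw0I : ∀ x d, PowerSeries.coeff d (w0 x) ∈ I := by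
    intro x d
    simp only [hw0, Matrix.mulVec, dotProduct, map_sum]
    exact sum_mem fun b _ => coeff_mul_mem I (hhI b) d
  have hPw0 : ((frame Xf Cm).map (ev z)) *ᵥ w0 = (t ^ k) • h := by
    rw [hw0, Matrix.mulVec_mulVec, hPS, Matrix.smul_mulVec, Matrix.one_mulVec]
  set τ : ι → A⟦X⟧ := fun i => t ^ (2 * k + l + 2) * w0 (Sum.inl i) with hτ
  set u' : κ → A⟦X⟧ := fun j => t ^ (l + 1) * w0 (Sum.inr j) with hu'
  set u : κ → A⟦X⟧ := fun j => t ^ (2 * k + 1) * u' j with hu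
  have hτI : ∀ i d, PowerSeries.coeff d (τ i) ∈ I := fun i d => coeff_mul_mem I (hw0I _) d
  set v : σ → A⟦X⟧ := ∑ i, τ i • xval Xf z i + Cm.map (algebraMap ℂ A⟦X⟧) *ᵥ u with hv
  have hvw : v = t ^ (2 * k + l + 2) • (((frame Xf Cm).map (ev z)) *ᵥ w0) := by
    rw [frame_mulVec, hv, smul_add, Finset.smul_sum, ← Matrix.mulVec_smul]
    congr 1
    · simp only [hτ, mul_smul]
    · congr 1
      ext1 j
      simp only [hu, hu', Pi.smul_apply, smul_eq_mul]
      ring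
  have hzv : z' = fun a => z a + t ^ (2 * k + l + 1) * v a := by
    ext1 a
    rw [hvw, hPw0, hzz]
    simp only [Pi.smul_apply, smul_eq_mul]
    ring
  set Hyp : ℕ → ℝ → Prop := fun N r => (∀ i, tnorm N r (τ i) ≤ 1) ∧ (∀ j, tnorm N r (u' j) ≤ 1) ∧
    ∀ i, tnorm N r (α i) ≤ 1 with hHyp
  have hτB : ∀ i, τ i ∈ Bd A Hyp := fun i => ⟨1, Eventually.of_forall fun r N h => h.1 i⟩
  have hu'B : ∀ i, u' i ∈ Bd A Hyp := fun i => ⟨1, Eventually.of_forall fun r N h => h.2.1 i⟩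
  have hαB : ∀ i, α i ∈ Bd A Hyp := fun i => ⟨1, Eventually.of_forall fun r N h => h.2.2 i⟩
  have hCB : ∀ {p}, p ∈ Conv A → p ∈ Bd A Hyp := fun hp => Conv_le_Bd hp
  have hvmem : ∀ B : Subalgebra ℂ A⟦X⟧, Conv A ≤ B → (∀ i, τ i ∈ B) → (∀ j, u' j ∈ B) →
      ∀ a, v a ∈ B := by
    intro B hB h1 h2 a
    simp only [hv, Pi.add_apply, Finset.sum_apply, Pi.smul_apply, smul_eq_mul]
    refine add_mem (sum_mem fun i _ => mul_mem (h1 i) (hB (hevC (hXc i a)))) ?_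
    exact matrix_mulVec_mem B (fun i j => hB (hCmC i j))
      (fun j => mul_mem (hB (X_pow_mem_Bd _)) (h2 j)) a
  have hvB := hvmem _ Conv_le_Bd hτB hu'B
  -- first integrals
  have hE1 : ∃ U : κ → A⟦X⟧, (∀ j, U j ∈ Bd A Hyp) ∧ ∀ j, u' j = t * U j := by
    choose Q hQ hQ' using fun j => exists_taylor (hFc j) (fun a => hCB (hzC a)) hvB (2 * k + l + 1)
    choose e1 he1 using fun j => X_pow_dvd_ev_sub (G := F j) hdvd
    have he1C : ∀ j, e1 j ∈ Conv A := by
      intro j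
      refine Conv_of_X_pow_mul (k := 5 * k + 2 * l + 3 + 1) ?_
      rw [← ht, ← he1]
      exact sub_mem (hevC (hFc j)) (hF1 j)
    have hJv : jac F z *ᵥ v = t ^ (2 * k + 1) •
        ((jac F z * Cm.map (algebraMap ℂ A⟦X⟧)) *ᵥ u') := by
      rw [hv, Matrix.mulVec_add, Matrix.mulVec_sum]
      simp only [Matrix.mulVec_smul, jac_mulVec_xval Xf F hF, smul_zero, Finset.sum_const_zero,
        zero_add]
      rw [Matrix.mulVec_mulVec, ← Matrix.mulVec_smul]
      rfl
    have hmain : (jac F z * Cm.map (algebraMap ℂ A⟦X⟧)) *ᵥ u' =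
        t ^ (l + 1) • (fun j => - (t ^ k * e1 j + Q j)) := by
      ext1 j
      have h1 := hQ' j
      rw [← hzv] at h1
      have h2 : ∑ a, ev z (MvPowerSeries.pderiv ℂ a (F j)) * v a = (jac F z *ᵥ v) j := rfl
      rw [h2, hJv, Pi.smul_apply, smul_eq_mul] at h1
      have h3 := he1 j
      simp only [Pi.smul_apply, smul_eq_mul]
      refine X_pow_mul_cancel (k := 4 * k + l + 3) ?_
      rw [← ht] at h1 h3 ⊢
      linear_combination (-1 : A⟦X⟧) * h1 - h3
    refine ⟨S2 *ᵥ fun j => - (t ^ k * e1 j + Q j), ?_, ?_⟩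
    · exact matrix_mulVec_mem _ (fun i j => hCB (hS2C i j)) fun j =>
        neg_mem (add_mem (mul_mem (X_pow_mem_Bd _) (hCB (he1C j))) (hQ j))
    · intro j
      have h4 := congrArg (fun x => (S2 *ᵥ x) j) hmain
      simp only [Matrix.mulVec_smul] at h4
      rw [Matrix.mulVec_mulVec, hS2, Matrix.smul_mulVec, Matrix.one_mulVec] at h4
      simp only [Pi.smul_apply, smul_eq_mul] at h4
      refine X_pow_mul_cancel (k := l) ?_
      rw [← ht]
      linear_combination h4
  -- linearized equation
  have hE2 : ∃ R : ι → A⟦X⟧, (∀ i, R i ∈ Bd A Hyp) ∧ ∀ i, dser D (τ i) = α i + t * R i := by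
    choose Q hQ hQ' using fun i b =>
      exists_taylor (hXc i b) (fun a => hCB (hzC a)) hvB (2 * k + l + 1)
    set er : σ → A⟦X⟧ := fun b => t ^ k * (t * dser D (z b)) - ∑ i, a0 i * ev z (Xf i b) with her
    have hdz : ∀ b, dser D (z b) ∈ Conv A := by
      intro b
      simp only [hz]
      rw [dser_trunc]
      exact coe_polynomial_mem_Bd _
    have herd : ∀ b, t ^ (4 * k + l + 3) ∣ er b := by
      intro b
      have h1 : er b = t ^ k * (t * dser D (z b - z' b)) +
          ∑ i, (t ^ (4 * k + l + 3) * (α0 i * ev z (Xf i b)) -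
            A' i * (ev z (Xf i b) - ev z' (Xf i b))) := by
        have h2 : ∀ i, t ^ (4 * k + l + 3) * (α0 i * ev z (Xf i b)) -
            A' i * (ev z (Xf i b) - ev z' (Xf i b)) =
            A' i * ev z' (Xf i b) - a0 i * ev z (Xf i b) := by
          intro i
          rw [hAA]; ring
        simp only [h2, Finset.sum_sub_distrib, her, map_sub]
        rw [← hA']
        ring
      rw [h1]
      refine dvd_add ?_ (Finset.dvd_sum fun i _ => dvd_sub (dvd_mul_right _ _) ?_)
      · have h3 := X_pow_dvd_dser D (hdvd b)
        have h4 := mul_dvd_mul_left (t ^ k) (mul_dvd_mul_left t h3)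
        refine dvd_trans ?_ h4
        rw [← ht, ← pow_succ', ← pow_add]
        exact pow_dvd_pow _ (by omega)
      · refine Dvd.dvd.mul_left (dvd_trans ?_ (X_pow_dvd_ev_sub hdvd)) _
        exact pow_dvd_pow _ (by omega)
    choose e2 he2 using herd
    have he2C : ∀ b, e2 b ∈ Conv A := by
      intro b
      refine Conv_of_X_pow_mul (k := 4 * k + l + 3) ?_
      rw [← ht, ← he2]
      exact sub_mem (mul_mem (X_pow_mem_Bd _) (mul_mem X_mem_Bd (hdz b)))
        (sum_mem fun i _ => mul_mem (ha0C i) (hevC (hXc i b)))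
    have hid := linearized_identity Xf Cm D z hX (k := k) (M := 2 * k + l + 2) τ u v hv a0 α er Q
      (fun b => rfl) (by
        intro b
        have h1 := hA' b
        have h2 : ∀ i, ev z' (Xf i b) = ev z (Xf i b) + t ^ (2 * k + l + 2) *
            (jac (Xf i) z *ᵥ v) b + t ^ (2 * (2 * k + l + 2)) * Q i b := by
          intro i
          have := hQ' i b
          rw [← hzv] at this
          rw [this]
          have h2 : ∑ a, ev z (MvPowerSeries.pderiv ℂ a (Xf i b)) * v a = (jac (Xf i) z *ᵥ v) b :=
            rfl
          rw [h2]; ring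
        have h3 : dser D (z' b) = dser D (z b) + t ^ (2 * k + l + 1) * dser D (v b) := by
          rw [hzv, map_add]
          congr 1
          exact dser_X_pow_mul _ _ _
        rw [h3] at h1
        simp only [h2] at h1
        have h4 : ∀ i, A' i = a0 i + t ^ (2 * k + l + 2 + k) * α i := by
          intro i
          rw [hAA, hα]; ring
        simp only [h4] at h1
        rw [← ht, ← h1]
        ring)
    have her2 : er = t ^ (4 * k + l + 3) • e2 := by
      ext1 b; rw [he2]; rfl
    set Cu' := Cm.map (algebraMap ℂ A⟦X⟧) *ᵥ u' with hCu'
    have hCu : Cm.map (algebraMap ℂ A⟦X⟧) *ᵥ u = t ^ (2 * k + 1) • Cu' := by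
      rw [hCu', ← Matrix.mulVec_smul]; rfl
    set R0 : σ → A⟦X⟧ := fun b => - e2 b - t ^ (2 * k + l + 2) * ∑ i, τ i * (jac (Xf i) z *ᵥ e2) b +
      ∑ i, a0 i * (jac (Xf i) z *ᵥ Cu') b + t ^ (l + 1) * ∑ i, a0 i * Q i b +
      t ^ (k + l + 1) * ∑ i, α i * ((jac (Xf i) z *ᵥ v) b + t ^ (2 * k + l + 2) * Q i b) with hR0
    have hJB : ∀ i (x : σ → A⟦X⟧), (∀ b, x b ∈ Bd A Hyp) → ∀ b, (jac (Xf i) z *ᵥ x) b ∈ Bd A Hyp :=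
      fun i x hx b => matrix_mulVec_mem _ (fun _ _ => hCB (hJC i _ _)) hx b
    have hR0B : ∀ b, R0 b ∈ Bd A Hyp := by
      intro b
      have hCu'B : ∀ b, Cu' b ∈ Bd A Hyp :=
        fun b => matrix_mulVec_mem _ (fun i j => hCB (hCmC i j)) hu'B b
      refine add_mem (add_mem (add_mem (sub_mem (neg_mem (hCB (he2C b))) ?_) ?_) ?_) ?_
      · exact mul_mem (X_pow_mem_Bd _) (sum_mem fun i _ => mul_mem (hτB i)
          (hJB i _ (fun b => hCB (he2C b)) b))
      · exact sum_mem fun i _ => mul_mem (hCB (ha0C i)) (hJB i _ hCu'B b)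
      · exact mul_mem (X_pow_mem_Bd _) (sum_mem fun i _ => mul_mem (hCB (ha0C i)) (hQ i b))
      · exact mul_mem (X_pow_mem_Bd _) (sum_mem fun i _ => mul_mem (hαB i)
          (add_mem (hJB i _ hvB b) (mul_mem (X_pow_mem_Bd _) (hQ i b))))
    have hP : ((frame Xf Cm).map (ev z)) *ᵥ
        (Sum.elim (fun i => dser D (τ i) - α i) fun j => dser D (u j)) = t ^ (k + 1) • R0 := by
      ext1 b
      rw [frame_mulVec]
      have h1 := hid b
      rw [her2, hCu] at h1
      have hpull : ∀ (x y : ι → A⟦X⟧) (s : A⟦X⟧), ∑ i, x i * (s * y i) = s * ∑ i, x i * y i := by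
        intro x y s
        rw [Finset.mul_sum]
        exact Finset.sum_congr rfl fun i _ => by ring
      simp only [Matrix.mulVec_smul, Pi.smul_apply, smul_eq_mul, ← ht] at h1
      rw [hpull, hpull] at h1
      simp only [Sum.elim_inl, Sum.elim_inr, Pi.add_apply, Finset.sum_apply, Pi.smul_apply,
        smul_eq_mul, xval]
      refine X_pow_mul_cancel (k := k + (2 * k + l + 2)) ?_
      rw [← ht, h1]
      simp only [hR0]
      ring
    refine ⟨fun i => (S *ᵥ R0) (Sum.inl i), fun i =>
      matrix_mulVec_mem _ (fun i j => hCB (hSC i j)) hR0B _, fun i => ?_⟩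
    have h4 := congrArg (fun x => (S *ᵥ x) (Sum.inl i)) hP
    simp only [Matrix.mulVec_smul] at h4
    rw [Matrix.mulVec_mulVec, hSP, Matrix.smul_mulVec, Matrix.one_mulVec] at h4
    simp only [Pi.smul_apply, smul_eq_mul, Sum.elim_inl] at h4
    refine X_pow_mul_cancel (k := k) ?_
    rw [← ht]
    linear_combination h4
  obtain ⟨U, hU, hU'⟩ := hE1
  obtain ⟨R, hR, hR'⟩ := hE2
  obtain ⟨C1, hC10, hC1⟩ := Bd_family hU
  obtain ⟨C2, hC20, hC2⟩ := Bd_family hR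
  obtain ⟨r, ⟨⟨h1, h2⟩, hr0⟩, hr1⟩ := (((hC1.and hC2).and self_mem_nhdsWithin).and
    (mem_nhdsWithin_of_mem_nhds
      (Iic_mem_nhds (show 0 < (1 + C1 + c * C2)⁻¹ by positivity)))).exists
  have hr0 : 0 < r := hr0
  have hr1 : r * (1 + C1 + c * C2) ≤ 1 := by
    have := mul_le_mul_of_nonneg_right (Set.mem_Iic.1 hr1) (show 0 ≤ 1 + C1 + c * C2 by positivity)
    rwa [inv_mul_cancel₀ (by positivity)] at this
  have hall : ∀ N, Hyp N r := by
    intro N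
    induction N with
    | zero => simp [hHyp, tnorm]
    | succ N ih =>
      have hb : ∀ i, c * tnorm (N + 1) r (t * R i) ≤ 1 := by
        intro i
        rw [ht, tnorm_X_mul]
        have h3 := h2 N ih i
        calc c * (r * tnorm N r (R i)) ≤ c * (r * C2) := by gcongr
          _ ≤ r * (1 + C1 + c * C2) := by nlinarith [mul_nonneg hr0.le hC10]
          _ ≤ 1 := hr1
      have hcoef : ∀ i d, ‖PowerSeries.coeff d (τ i)‖ ≤ c * ‖PowerSeries.coeff d (t * R i)‖ ∧
          ‖PowerSeries.coeff d (α i)‖ ≤ c * ‖PowerSeries.coeff d (t * R i)‖ := by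
        intro i d
        refine hInt _ _ _ (hτI i d) ?_ ?_
        · rw [← coeff_dser, hαD]; simp
        · rw [← coeff_dser, hR', map_add]
      refine ⟨fun i => ?_, fun j => ?_, fun i => ?_⟩
      · exact (tnorm_le_of_coeff_le hr0.le fun d => (hcoef i d).1).trans (hb i)
      · rw [hU', ht, tnorm_X_mul]
        have h3 := h1 N ih j
        calc r * tnorm N r (U j) ≤ r * C1 := by gcongr
          _ ≤ r * (1 + C1 + c * C2) := by
            have : 0 ≤ c * C2 := by positivity
            nlinarith [mul_nonneg hr0.le this]
          _ ≤ 1 := hr1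
      · exact (tnorm_le_of_coeff_le hr0.le fun d => (hcoef i d).2).trans (hb i)
  rw [hzv]
  exact add_mem (hzC a) (mul_mem (X_pow_mem_Bd _) (hvmem _ le_rfl
    (fun i => Conv_of_isBounded hr0 fun N => (hall N).1 i)
    (fun i => Conv_of_isBounded hr0 fun N => (hall N).2.1 i) a))

end Core

/-- Smooth complex functions of a real variable. -/
def smoothFn : Subalgebra ℂ (ℝ → ℂ) where
  carrier := {f | ContDiff ℝ ⊤ f}
  mul_mem' := fun {f g} (hf : ContDiff ℝ ⊤ f) (hg : ContDiff ℝ ⊤ g) => hf.mul hg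
  add_mem' := fun {f g} (hf : ContDiff ℝ ⊤ f) (hg : ContDiff ℝ ⊤ g) => hf.add hg
  algebraMap_mem' c := show ContDiff ℝ ⊤ (fun _ : ℝ => c) from contDiff_const

theorem smoothFn_contDiff (f : smoothFn) : ContDiff ℝ ⊤ f.1 := f.2

/-- Restriction to a period. -/
def smoothRestrict : smoothFn →ₐ[ℂ] C(Set.Icc (0 : ℝ) (2 * Real.pi), ℂ) where
  toFun f := ⟨fun s => f.1 s, (smoothFn_contDiff f).continuous.comp continuous_subtype_val⟩
  map_one' := rfl
  map_mul' _ _ := rfl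
  map_zero' := rfl
  map_add' _ _ := rfl
  commutes' _ := rfl

instance : SeminormedCommRing smoothFn := SeminormedCommRing.induced _ _ smoothRestrict

instance : NormedAlgebra ℂ smoothFn := NormedAlgebra.induced ℂ _ _ smoothRestrict

theorem smoothFn_norm_def (f : smoothFn) : ‖f‖ = ‖smoothRestrict f‖ := rfl

instance : NormOneClass smoothFn where
  norm_one := by
    have : Nonempty (Set.Icc (0 : ℝ) (2 * Real.pi)) := ⟨⟨0, by simp [Real.pi_pos.le]⟩⟩
    rw [smoothFn_norm_def, map_one, norm_one]

theorem norm_apply_le (f : smoothFn) {s : ℝ} (hs : s ∈ Set.Icc (0 : ℝ) (2 * Real.pi)) :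
    ‖f.1 s‖ ≤ ‖f‖ := (smoothRestrict f).norm_coe_le_norm ⟨s, hs⟩

theorem smoothFn_norm_le {f : smoothFn} {C : ℝ} (hC : 0 ≤ C)
    (h : ∀ s ∈ Set.Icc (0 : ℝ) (2 * Real.pi), ‖f.1 s‖ ≤ C) : ‖f‖ ≤ C :=
  (ContinuousMap.norm_le _ hC).2 fun s => h s.1 s.2

/-- Differentiation of smooth functions. -/
def smoothDeriv : Derivation ℂ smoothFn smoothFn :=
  Derivation.mk'
    { toFun := fun f => ⟨deriv f.1, by
        have := (smoothFn_contDiff f)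
        exact ((contDiff_succ_iff_deriv (n := ⊤)).1 (by simpa using this)).2.2⟩
      map_add' := fun f g => by
        ext s
        exact deriv_add ((smoothFn_contDiff f).differentiable (by simp) s)
          ((smoothFn_contDiff g).differentiable (by simp) s)
      map_smul' := fun c f => by
        ext s
        exact deriv_const_smul c ((smoothFn_contDiff f).differentiable (by simp) s) }
    (fun f g => by
      ext s
      have := deriv_mul ((smoothFn_contDiff f).differentiable (by simp) s)
          ((smoothFn_contDiff g).differentiable (by simp) s)
      refine this.trans ?_
      change _ = f.1 s * deriv g.1 s + g.1 s * deriv f.1 s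
      ring)

theorem smoothDeriv_apply (f : smoothFn) : (smoothDeriv f).1 = deriv f.1 := rfl

theorem smoothFn_hasDerivAt (f : smoothFn) (s : ℝ) : HasDerivAt f.1 ((smoothDeriv f).1 s) s :=
  ((smoothFn_contDiff f).differentiable (by simp) s).hasDerivAt

/-- Functions vanishing at the ends of a period. -/
def smoothEnds : Ideal smoothFn where
  carrier := {f | f.1 0 = 0 ∧ f.1 (2 * Real.pi) = 0}
  add_mem' := by
    rintro f g ⟨h1, h2⟩ ⟨h3, h4⟩
    exact ⟨by change f.1 0 + g.1 0 = 0; rw [h1, h3, add_zero],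
      by change f.1 _ + g.1 _ = 0; rw [h2, h4, add_zero]⟩
  zero_mem' := ⟨rfl, rfl⟩
  smul_mem' := by
    rintro f g ⟨h3, h4⟩
    exact ⟨by change f.1 0 * g.1 0 = 0; rw [h3, mul_zero],
      by change f.1 _ * g.1 _ = 0; rw [h4, mul_zero]⟩

theorem smooth_integral_bound (τ α h : smoothFn) (hτ : τ ∈ smoothEnds) (hα : smoothDeriv α = 0)
    (hD : smoothDeriv τ = α + h) :
    ‖τ‖ ≤ (1 + 4 * Real.pi) * ‖h‖ ∧ ‖α‖ ≤ (1 + 4 * Real.pi) * ‖h‖ := by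
  have hpi := Real.pi_pos
  have hαc : ∀ s, α.1 s = α.1 0 := by
    intro s
    refine is_const_of_deriv_eq_zero ((smoothFn_contDiff α).differentiable (by simp)) ?_ s 0
    intro s
    rw [← smoothDeriv_apply, hα]; rfl
  have hcont := (smoothFn_contDiff h).continuous
  have hInt : ∀ s, τ.1 s = s * α.1 0 + ∫ x in (0 : ℝ)..s, h.1 x := by
    intro s
    have h1 := intervalIntegral.integral_eq_sub_of_hasDerivAt (a := 0) (b := s)
      (fun x _ => smoothFn_hasDerivAt τ x)
      ((smoothFn_contDiff (smoothDeriv τ)).continuous.intervalIntegrable _ _)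
    rw [hτ.1, sub_zero, hD] at h1
    rw [← h1]
    have h2 : ∀ x, (α + h).1 x = α.1 0 + h.1 x := fun x => by rw [← hαc x]; rfl
    simp only [h2]
    rw [intervalIntegral.integral_add (by simp) (hcont.intervalIntegrable _ _)]
    simp
  have hb : ∀ s ∈ Set.Icc (0 : ℝ) (2 * Real.pi), ‖∫ x in (0 : ℝ)..s, h.1 x‖ ≤ ‖h‖ * s := by
    intro s hs
    have := intervalIntegral.norm_integral_le_of_norm_le_const (a := 0) (b := s) (f := h.1)
      (C := ‖h‖) (by
        intro x hx
        rw [Set.uIoc_of_le hs.1] at hx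
        exact norm_apply_le h ⟨hx.1.le, hx.2.trans hs.2⟩)
    simpa [abs_of_nonneg hs.1] using this
  have h2pi : 2 * Real.pi ∈ Set.Icc (0 : ℝ) (2 * Real.pi) := ⟨by positivity, le_rfl⟩
  have hα0 : ‖α.1 0‖ ≤ ‖h‖ := by
    have h1 := hInt (2 * Real.pi)
    rw [hτ.2] at h1
    have h2 : ((2 * Real.pi : ℝ) : ℂ) * α.1 0 = - ∫ x in (0 : ℝ)..(2 * Real.pi), h.1 x := by
      linear_combination -h1
    have h3 := congrArg norm h2
    rw [norm_mul, norm_neg, Complex.norm_real, Real.norm_of_nonneg (by positivity)] at h3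
    have h4 := hb _ h2pi
    rw [← h3, mul_comm] at h4
    exact le_of_mul_le_mul_right h4 (by positivity)
  have hn : 0 ≤ ‖h‖ := norm_nonneg h
  refine ⟨smoothFn_norm_le (by positivity) fun s hs => ?_,
    smoothFn_norm_le (by positivity) fun s hs => ?_⟩
  · rw [hInt]
    calc _ ≤ ‖(s : ℂ) * α.1 0‖ + ‖h‖ * s := (norm_add_le _ _).trans (by gcongr; exact hb s hs)
      _ ≤ (2 * Real.pi) * ‖h‖ + ‖h‖ * (2 * Real.pi) := by
        rw [norm_mul, Complex.norm_real, Real.norm_of_nonneg hs.1]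
        gcongr
        · exact hs.2
        · exact hs.2
      _ ≤ _ := by nlinarith
  · rw [hαc]
    nlinarith

theorem isUnit_smoothFn {f : smoothFn} (h : ∀ s, f.1 s ≠ 0) : IsUnit f := by
  refine IsUnit.of_mul_eq_one ⟨fun s => (f.1 s)⁻¹, (smoothFn_contDiff f).inv h⟩ ?_
  ext s
  exact mul_inv_cancel₀ (h s)

section FiniteDim
variable {V : Type*} [AddCommGroup V] [Module ℂ V] [FiniteDimensional ℂ V]

theorem exists_functional_calculus (f : Module.End ℂ V) (c : ℂ → ℂ) :
    ∃ T : Module.End ℂ V, ∀ μ, ∀ v ∈ f.maxGenEigenspace μ, T v = c μ • v := by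
  classical
  have hInt : DirectSum.IsInternal f.maxGenEigenspace :=
    (DirectSum.isInternal_submodule_iff_iSupIndep_and_iSup_eq_top _).2
      ⟨f.independent_maxGenEigenspace, f.iSup_maxGenEigenspace_eq_top⟩
  let e := LinearEquiv.ofBijective (DirectSum.coeLinearMap f.maxGenEigenspace) hInt
  refine ⟨(DirectSum.toModule ℂ ℂ V fun μ => c μ • (f.maxGenEigenspace μ).subtype) ∘ₗ
    e.symm.toLinearMap, fun μ v hv => ?_⟩
  have h1 : e (DirectSum.lof ℂ ℂ (fun μ => f.maxGenEigenspace μ) μ ⟨v, hv⟩) = v := by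
    exact DirectSum.coeLinearMap_lof _ _ _
  have h2 := (LinearEquiv.symm_apply_eq e).2 h1.symm
  rw [LinearMap.comp_apply, LinearEquiv.coe_coe, h2, DirectSum.toModule_lof]
  rfl

end FiniteDim

section Calc
variable {σ : Type*} [Finite σ]

instance finiteDimensional_quotient (d : ℕ) :
    FiniteDimensional ℂ (MvPowerSeries σ ℂ ⧸ ordGE σ d) := by
  have hfin : Finite {α : σ →₀ ℕ // α.degree < d} :=
    (Finsupp.finite_of_degree_lt d).to_subtype
  let L : MvPowerSeries σ ℂ →ₗ[ℂ] ({α : σ →₀ ℕ // α.degree < d} → ℂ) :=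
    LinearMap.pi fun α => MvPowerSeries.coeff α.1
  have hL : LinearMap.ker L = ordGE σ d := by
    ext g
    rw [LinearMap.mem_ker, mem_ordGE]
    constructor
    · intro h α hα
      exact congrFun h ⟨α, hα⟩
    · intro h
      ext α
      exact h α.1 α.2
  rw [← hL]
  exact Module.Finite.equiv L.quotKerEquivRange.symm

/-- The operator `E - μ`. -/
def shift (E : Derivation ℂ (MvPowerSeries σ ℂ) (MvPowerSeries σ ℂ)) (μ : ℂ) :
    Module.End ℂ (MvPowerSeries σ ℂ) := E.toLinearMap - μ • 1

theorem shift_apply (E : Derivation ℂ (MvPowerSeries σ ℂ) (MvPowerSeries σ ℂ)) (μ : ℂ)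
    (g : MvPowerSeries σ ℂ) : shift E μ g = E g - μ • g := rfl

/-- Generalized eigenvectors modulo `ordGE σ d`. -/
def IsGE (E : Derivation ℂ (MvPowerSeries σ ℂ) (MvPowerSeries σ ℂ)) (d : ℕ) (μ : ℂ)
    (g : MvPowerSeries σ ℂ) : Prop := ∃ k : ℕ, (shift E μ ^ k) g ∈ ordGE σ d

/-- Derivations preserving the order filtration. -/
def Filtered (E : Derivation ℂ (MvPowerSeries σ ℂ) (MvPowerSeries σ ℂ)) : Prop :=
  ∀ d, ∀ g ∈ ordGE σ d, E g ∈ ordGE σ d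

variable {E : Derivation ℂ (MvPowerSeries σ ℂ) (MvPowerSeries σ ℂ)} (hE : Filtered E)

theorem IsGE.anti {d e : ℕ} (h : d ≤ e) {μ : ℂ} {g : MvPowerSeries σ ℂ} (hg : IsGE E e μ g) :
    IsGE E d μ g := ⟨hg.choose, ordGE_anti h hg.choose_spec⟩

theorem IsGE_of_mem {d : ℕ} {μ : ℂ} {g : MvPowerSeries σ ℂ} (hg : g ∈ ordGE σ d) :
    IsGE E d μ g := ⟨0, by simpa using hg⟩

theorem shift_pow_mem (hE : Filtered E) (d : ℕ) (μ : ℂ) (k : ℕ) {g : MvPowerSeries σ ℂ} (hg : g ∈ ordGE σ d) :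
    (shift E μ ^ k) g ∈ ordGE σ d := by
  induction k with
  | zero => simpa using hg
  | succ k ih =>
    rw [pow_succ', Module.End.mul_apply]
    exact sub_mem (hE _ _ ih) (Submodule.smul_mem _ _ ih)

/-- The induced endomorphism of the jets. -/
def quotMap (d : ℕ) : Module.End ℂ (MvPowerSeries σ ℂ ⧸ ordGE σ d) :=
  (ordGE σ d).mapQ (ordGE σ d) E.toLinearMap (hE d)

theorem quotMap_pow (d : ℕ) (μ : ℂ) (k : ℕ) (g : MvPowerSeries σ ℂ) :
    ((quotMap hE d - μ • 1) ^ k) ((ordGE σ d).mkQ g) = (ordGE σ d).mkQ ((shift E μ ^ k) g) := by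
  induction k generalizing g with
  | zero => simp
  | succ k ih =>
    rw [pow_succ, pow_succ, Module.End.mul_apply, Module.End.mul_apply, ← ih]
    rfl

theorem mkQ_mem_iff (d : ℕ) (μ : ℂ) (g : MvPowerSeries σ ℂ) :
    (ordGE σ d).mkQ g ∈ (quotMap hE d).maxGenEigenspace μ ↔ IsGE E d μ g := by
  rw [Module.End.mem_maxGenEigenspace]
  refine exists_congr fun k => ?_
  rw [quotMap_pow, Submodule.mkQ_apply, Submodule.Quotient.mk_eq_zero]

/-- Induction over sums of generalized eigenvectors. -/
theorem ge_induction (hE : Filtered E) (d : ℕ) {P : MvPowerSeries σ ℂ → Prop}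
    (h1 : ∀ μ g, IsGE E d μ g → P g) (h2 : ∀ g h, P g → P h → P (g + h)) (g) : P g := by
  have hall : ∀ x ∈ ⨆ μ, (quotMap hE d).maxGenEigenspace μ, ∀ g, (ordGE σ d).mkQ g = x → P g := by
    intro x hx
    induction hx using Submodule.iSup_induction' with
    | mem μ x hx =>
      rintro g rfl
      exact h1 μ g ((mkQ_mem_iff hE d μ g).1 hx)
    | zero =>
      intro g hg
      rw [Submodule.mkQ_apply, Submodule.Quotient.mk_eq_zero] at hg
      exact h1 0 g (IsGE_of_mem hg)
    | add x y _ _ ihx ihy =>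
      intro g hg
      obtain ⟨y', rfl⟩ := (ordGE σ d).mkQ_surjective y
      have h3 : (ordGE σ d).mkQ (g - y') = x := by rw [map_sub, hg]; simp
      have := h2 _ _ (ihx _ h3) (ihy _ rfl)
      simpa using this
  refine hall _ ?_ g rfl
  rw [Module.End.iSup_maxGenEigenspace_eq_top]
  trivial

theorem exists_fcalc (hE : Filtered E) (c : ℂ → ℂ) : ∃ T : MvPowerSeries σ ℂ →ₗ[ℂ] MvPowerSeries σ ℂ,
    ∀ d μ g, IsGE E d μ g → T g - c μ • g ∈ ordGE σ d := by
  choose Td hTd using fun d => exists_functional_calculus (quotMap hE d) c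
  choose s hs using fun (d : ℕ) (g : MvPowerSeries σ ℂ) =>
    (ordGE σ d).mkQ_surjective (Td d ((ordGE σ d).mkQ g))
  have hmk : ∀ d (g h : MvPowerSeries σ ℂ), (ordGE σ d).mkQ g = (ordGE σ d).mkQ h ↔
      g - h ∈ ordGE σ d := fun d g h => by
    rw [Submodule.mkQ_apply, Submodule.mkQ_apply, Submodule.Quotient.eq]
  have hge : ∀ d μ g, IsGE E d μ g → s d g - c μ • g ∈ ordGE σ d := by
    intro d μ g hg
    rw [← hmk, hs, hTd d μ _ ((mkQ_mem_iff hE d μ g).2 hg), map_smul]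
  have hadd : ∀ d g h, s d (g + h) - (s d g + s d h) ∈ ordGE σ d := by
    intro d g h
    rw [← hmk, map_add, hs, hs, hs, map_add, map_add]
  have hsmul : ∀ d (a : ℂ) g, s d (a • g) - a • s d g ∈ ordGE σ d := by
    intro d a g
    rw [← hmk, map_smul, hs, hs, map_smul, map_smul]
  have hcompat : ∀ d e, e ≤ d → ∀ g, s d g - s e g ∈ ordGE σ e := by
    intro d e hde g
    induction g using ge_induction hE d with
    | h1 μ g hg =>
      have := sub_mem (ordGE_anti hde (hge d μ g hg)) (hge e μ g (hg.anti hde))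
      simpa using this
    | h2 g h ihg ihh =>
      have := sub_mem (add_mem (ordGE_anti hde (hadd d g h)) (add_mem ihg ihh)) (hadd e g h)
      convert this using 1
      abel
  let T0 : MvPowerSeries σ ℂ → MvPowerSeries σ ℂ :=
    fun g α => MvPowerSeries.coeff α (s (α.degree + 1) g)
  have hT0 : ∀ d g, T0 g - s d g ∈ ordGE σ d := by
    intro d g α hα
    have h1 : MvPowerSeries.coeff α (T0 g) = MvPowerSeries.coeff α (s (α.degree + 1) g) := rfl
    have := hcompat d (α.degree + 1) hα g α (Nat.lt_succ_self _)
    rw [map_sub] at this ⊢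
    rw [h1]
    linear_combination -this
  refine ⟨{ toFun := T0, map_add' := fun g h => ?_, map_smul' := fun a g => ?_ }, ?_⟩
  · rw [← sub_eq_zero]
    refine eq_zero_of_forall_mem_ordGE fun d => ?_
    have := add_mem (hadd d g h) (sub_mem (hT0 d (g + h)) (add_mem (hT0 d g) (hT0 d h)))
    convert this using 1
    abel
  · rw [← sub_eq_zero]
    refine eq_zero_of_forall_mem_ordGE fun d => ?_
    have := add_mem (hsmul d a g) (sub_mem (hT0 d (a • g)) (Submodule.smul_mem _ a (hT0 d g)))
    convert this using 1
    rw [smul_sub, RingHom.id_apply]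
    abel
  · intro d μ g hg
    have := add_mem (hT0 d g) (hge d μ g hg)
    rw [LinearMap.coe_mk, AddHom.coe_mk]
    convert this using 1
    abel

/-- Functional calculus: `fcalc hE c` acts by `c μ` on generalized eigenvectors of `E` of
eigenvalue `μ`. -/
def fcalc (c : ℂ → ℂ) : MvPowerSeries σ ℂ →ₗ[ℂ] MvPowerSeries σ ℂ := (exists_fcalc hE c).choose

theorem fcalc_spec (c : ℂ → ℂ) {d : ℕ} {μ : ℂ} {g : MvPowerSeries σ ℂ} (hg : IsGE E d μ g) :
    fcalc hE c g - c μ • g ∈ ordGE σ d := (exists_fcalc hE c).choose_spec d μ g hg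

theorem fcalc_mem (c : ℂ → ℂ) {d : ℕ} {g : MvPowerSeries σ ℂ} (hg : g ∈ ordGE σ d) :
    fcalc hE c g ∈ ordGE σ d := by
  have := add_mem (fcalc_spec hE c (IsGE_of_mem (μ := 0) hg)) (Submodule.smul_mem _ (c 0) hg)
  simpa using this

theorem fcalc_eq_smul (c : ℂ → ℂ) {μ : ℂ} {g : MvPowerSeries σ ℂ} (hg : ∀ d, IsGE E d μ g) :
    fcalc hE c g = c μ • g :=
  sub_eq_zero.1 (eq_zero_of_forall_mem_ordGE fun d => fcalc_spec hE c (hg d))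

theorem fcalc_eq_of_derivation_eq_zero (c : ℂ → ℂ) {g : MvPowerSeries σ ℂ} (hg : E g = 0) :
    fcalc hE c g = c 0 • g :=
  fcalc_eq_smul hE c fun d => ⟨1, by simp [shift_apply, hg]⟩

theorem linearMap_ext (hE : Filtered E) {L : MvPowerSeries σ ℂ →ₗ[ℂ] MvPowerSeries σ ℂ} {e : ℕ}
    (h : ∀ d μ g, IsGE E (d + e) μ g → L g ∈ ordGE σ d) : L = 0 := by
  ext1 g
  refine eq_zero_of_forall_mem_ordGE fun d => ?_
  induction g using ge_induction hE (d + e) with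
  | h1 μ g hg => exact h d μ g hg
  | h2 g h ihg ihh => rw [map_add]; exact add_mem ihg ihh

theorem fcalc_fcalc (c c' : ℂ → ℂ) (g : MvPowerSeries σ ℂ) :
    fcalc hE c (fcalc hE c' g) = fcalc hE (fun μ => c μ * c' μ) g := by
  have : fcalc hE c ∘ₗ fcalc hE c' - fcalc hE (fun μ => c μ * c' μ) = 0 := by
    refine linearMap_ext hE (e := 0) fun d μ g hg => ?_
    rw [add_zero] at hg
    have h1 := fcalc_mem hE c (fcalc_spec hE c' hg)
    have h2 := Submodule.smul_mem _ (c' μ) (fcalc_spec hE c hg)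
    have h3 := fcalc_spec hE (fun μ => c μ * c' μ) hg
    have := sub_mem (add_mem h1 h2) h3
    convert this using 1
    simp only [LinearMap.sub_apply, LinearMap.comp_apply, map_sub, map_smul, smul_sub, smul_smul,
      mul_comm (c' μ)]
    abel
  exact sub_eq_zero.1 (LinearMap.congr_fun this g)

theorem fcalc_congr {c c' : ℂ → ℂ} (h : ∀ d μ g, IsGE E d μ g → g ∉ ordGE σ d → c μ = c' μ) :
    fcalc hE c = fcalc hE c' := by
  refine sub_eq_zero.1 (linearMap_ext hE (e := 0) fun d μ g hg => ?_)
  by_cases hgd : g ∈ ordGE σ d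
  · exact sub_mem (fcalc_mem hE c hgd) (fcalc_mem hE c' hgd)
  · have h1 := sub_mem (fcalc_spec hE c hg) (fcalc_spec hE c' hg)
    rw [h d μ g hg hgd] at h1
    simpa using h1

theorem fcalc_one : fcalc hE (fun _ => 1) = LinearMap.id := by
  refine sub_eq_zero.1 (linearMap_ext hE (e := 0) fun d μ g hg => ?_)
  simpa using fcalc_spec hE (fun _ => 1) hg

theorem fcalc_comm (c : ℂ → ℂ) {Y : MvPowerSeries σ ℂ →ₗ[ℂ] MvPowerSeries σ ℂ}
    (hY : ∀ g, Y (E g) = E (Y g)) (hY' : ∀ d, ∀ g ∈ ordGE σ (d + 1), Y g ∈ ordGE σ d)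
    (g : MvPowerSeries σ ℂ) : fcalc hE c (Y g) = Y (fcalc hE c g) := by
  have : fcalc hE c ∘ₗ Y - Y ∘ₗ fcalc hE c = 0 := by
    refine linearMap_ext hE (e := 1) fun d μ g hg => ?_
    have h1 : IsGE E d μ (Y g) := by
      obtain ⟨k, hk⟩ := hg
      refine ⟨k, ?_⟩
      have : ∀ k g, (shift E μ ^ k) (Y g) = Y ((shift E μ ^ k) g) := by
        intro k
        induction k with
        | zero => simp
        | succ k ih =>
          intro g
          rw [pow_succ, Module.End.mul_apply, Module.End.mul_apply, ← ih]
          simp [shift_apply, hY]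
      rw [this]
      exact hY' d _ hk
    have := sub_mem (fcalc_spec hE c h1) (hY' d _ (fcalc_spec hE c hg))
    simpa using this
  exact sub_eq_zero.1 (LinearMap.congr_fun this g)

theorem IsGE.mul {d : ℕ} {μ ν : ℂ} {g h : MvPowerSeries σ ℂ} (hE : Filtered E) (hg : IsGE E d μ g)
    (hh : IsGE E d ν h) : IsGE E d (μ + ν) (g * h) := by
  obtain ⟨k, hk⟩ := hg
  obtain ⟨l, hl⟩ := hh
  refine ⟨k + l, ?_⟩
  have key : ∀ n k l g h, k + l = n → (shift E μ ^ k) g ∈ ordGE σ d → (shift E ν ^ l) h ∈ ordGE σ d →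
      (shift E (μ + ν) ^ n) (g * h) ∈ ordGE σ d := by
    intro n
    induction n with
    | zero =>
      intro k l g h hn hk hl
      obtain rfl : k = 0 := by omega
      simpa using mul_mem_ordGE_left (by simpa using hk) h
    | succ n ih =>
      intro k l g h hn hk hl
      rcases k with _ | k
      · exact shift_pow_mem hE d _ _ (mul_mem_ordGE_left (by simpa using hk) h)
      rcases l with _ | l
      · exact shift_pow_mem hE d _ _ (mul_mem_ordGE_right (by simpa using hl) g)
      have h1 : shift E (μ + ν) (g * h) = shift E μ g * h + g * shift E ν h := by
        simp only [shift_apply, Derivation.leibniz, smul_eq_mul, sub_mul, mul_sub, add_smul,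
          smul_mul_assoc, mul_smul_comm]
        ring
      rw [pow_succ, Module.End.mul_apply, h1, map_add]
      refine add_mem (ih k (l + 1) _ _ (by omega) ?_ hl) (ih (k + 1) l _ _ (by omega) hk ?_)
      · rwa [pow_succ, Module.End.mul_apply] at hk
      · rwa [pow_succ, Module.End.mul_apply] at hl
  exact key _ k l g h rfl hk hl

theorem bilinear_ext {B : MvPowerSeries σ ℂ →ₗ[ℂ] MvPowerSeries σ ℂ →ₗ[ℂ] MvPowerSeries σ ℂ}
    (hE : Filtered E)
    (h : ∀ d μ ν g g', IsGE E d μ g → IsGE E d ν g' → B g g' ∈ ordGE σ d)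
    (g g' : MvPowerSeries σ ℂ) : B g g' = 0 := by
  refine eq_zero_of_forall_mem_ordGE fun d => ?_
  induction g using ge_induction hE d with
  | h1 μ g hg =>
    induction g' using ge_induction hE d with
    | h1 ν g' hg' => exact h d μ ν g g' hg hg'
    | h2 x y hx hy => rw [map_add]; exact add_mem hx hy
  | h2 x y hx hy => rw [map_add]; exact add_mem hx hy

theorem fcalc_mul {c : ℂ → ℂ} (hc : ∀ μ ν, c (μ + ν) = c μ * c ν) (g h : MvPowerSeries σ ℂ) :
    fcalc hE c (g * h) = fcalc hE c g * fcalc hE c h := by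
  have := bilinear_ext (B := (LinearMap.mul ℂ (MvPowerSeries σ ℂ)).compr₂ (fcalc hE c) -
    (LinearMap.mul ℂ (MvPowerSeries σ ℂ)).compl₁₂ (fcalc hE c) (fcalc hE c)) hE ?_ g h
  · exact sub_eq_zero.1 this
  · intro d μ ν g h hg hh
    have h1 := fcalc_spec hE c (IsGE.mul hE hg hh)
    have h2 := mul_mem_ordGE_left (fcalc_spec hE c hg) (fcalc hE c h)
    have h3 := Submodule.smul_mem _ (c μ) (mul_mem_ordGE_right (fcalc_spec hE c hh) g)
    have := sub_mem h1 (add_mem h2 h3)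
    convert this using 1
    simp only [LinearMap.sub_apply, LinearMap.compr₂_apply, LinearMap.mul_apply',
      LinearMap.compl₁₂_apply, hc, sub_mul, mul_sub, smul_mul_assoc, mul_smul_comm, smul_sub,
      smul_smul]
    abel

theorem fcalc_leibniz {c : ℂ → ℂ} (hc : ∀ μ ν, c (μ + ν) = c μ + c ν) (g h : MvPowerSeries σ ℂ) :
    fcalc hE c (g * h) = g * fcalc hE c h + h * fcalc hE c g := by
  have := bilinear_ext (B := (LinearMap.mul ℂ (MvPowerSeries σ ℂ)).compr₂ (fcalc hE c) -
    ((LinearMap.mul ℂ (MvPowerSeries σ ℂ)).compl₂ (fcalc hE c) +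
    ((LinearMap.mul ℂ (MvPowerSeries σ ℂ)).compl₂ (fcalc hE c)).flip)) hE ?_ g h
  · exact sub_eq_zero.1 this
  · intro d μ ν g h hg hh
    have h1 := fcalc_spec hE c (IsGE.mul hE hg hh)
    have h2 := mul_mem_ordGE_right (fcalc_spec hE c hg) h
    have h3 := mul_mem_ordGE_right (fcalc_spec hE c hh) g
    have := sub_mem h1 (add_mem h2 h3)
    convert this using 1
    simp only [LinearMap.sub_apply, LinearMap.compr₂_apply, LinearMap.mul_apply',
      LinearMap.compl₂_apply, LinearMap.add_apply, LinearMap.flip_apply, hc, mul_sub, mul_smul_comm,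
      add_smul, mul_comm h g]
    abel

theorem fcalc_map_one {c : ℂ → ℂ} (hc : c 0 = 1) : fcalc hE c 1 = 1 := by
  rw [fcalc_eq_of_derivation_eq_zero hE c (by simp), hc, one_smul]

/-- Functional calculus by a character, as an algebra homomorphism. -/
def fcalcHom {c : ℂ → ℂ} (hc : ∀ μ ν, c (μ + ν) = c μ * c ν) (hc0 : c 0 = 1) :
    MvPowerSeries σ ℂ →ₐ[ℂ] MvPowerSeries σ ℂ :=
  AlgHom.ofLinearMap (fcalc hE c) (fcalc_map_one hE hc0) (fcalc_mul hE hc)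

/-- Functional calculus by an additive function, as a derivation. -/
def fcalcDer {c : ℂ → ℂ} (hc : ∀ μ ν, c (μ + ν) = c μ + c ν) :
    Derivation ℂ (MvPowerSeries σ ℂ) (MvPowerSeries σ ℂ) :=
  Derivation.mk' (fcalc hE c) fun g h => fcalc_leibniz hE hc g h

end Calc

section Torus
variable {σ : Type*} [Finite σ]

theorem X_mem_ordGE (a : σ) : (MvPowerSeries.X a : MvPowerSeries σ ℂ) ∈ ordGE σ 1 := by
  intro α hα
  have : α = 0 := Finsupp.degree_eq_zero_iff α |>.1 (by omega)
  subst this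
  simp

theorem monomial_mem_ordGE (α : σ →₀ ℕ) (a : ℂ) :
    (MvPowerSeries.monomial α a : MvPowerSeries σ ℂ) ∈ ordGE σ α.degree := by
  classical
  intro β hβ
  rw [MvPowerSeries.coeff_monomial, if_neg]
  rintro rfl
  exact lt_irrefl _ hβ

/-- An algebra endomorphism which is the identity to first order on the coordinates is the identity
to first order on every power of the maximal ideal. -/
theorem sub_self_mem_ordGE (T : MvPowerSeries σ ℂ →ₐ[ℂ] MvPowerSeries σ ℂ)
    (hT : ∀ d, ∀ g ∈ ordGE σ d, T g ∈ ordGE σ d)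
    (hX : ∀ a, T (MvPowerSeries.X a) - MvPowerSeries.X a ∈ ordGE σ 2) {d : ℕ}
    {g : MvPowerSeries σ ℂ} (hg : g ∈ ordGE σ d) : T g - g ∈ ordGE σ (d + 1) := by
  classical
  have hmon : ∀ α : σ →₀ ℕ, T (MvPowerSeries.monomial α 1) - MvPowerSeries.monomial α 1 ∈
      ordGE σ (α.degree + 1) := by
    have hadd : ∀ α β : σ →₀ ℕ,
        T (MvPowerSeries.monomial α 1) - MvPowerSeries.monomial α 1 ∈ ordGE σ (α.degree + 1) →
        T (MvPowerSeries.monomial β 1) - MvPowerSeries.monomial β 1 ∈ ordGE σ (β.degree + 1) →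
        T (MvPowerSeries.monomial (α + β) 1) - MvPowerSeries.monomial (α + β) 1 ∈
          ordGE σ ((α + β).degree + 1) := by
      intro α β hα hβ
      have h1 := mul_mem_ordGE hα (hT _ _ (monomial_mem_ordGE β 1))
      have h2 := mul_mem_ordGE (monomial_mem_ordGE α 1) hβ
      have h3 : (MvPowerSeries.monomial (α + β) (1 : ℂ)) =
          MvPowerSeries.monomial α 1 * MvPowerSeries.monomial β 1 := by
        rw [MvPowerSeries.monomial_mul_monomial, one_mul]
      have h4 : (α + β).degree = α.degree + β.degree := map_add _ _ _
      rw [h3, map_mul, h4]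
      have := add_mem (ordGE_anti (by omega) h1 : _ ∈ ordGE σ (α.degree + β.degree + 1))
        (ordGE_anti (by omega) h2)
      convert this using 1
      ring
    have hzero : T (MvPowerSeries.monomial 0 1) - MvPowerSeries.monomial 0 1 ∈
      ordGE σ ((0 : σ →₀ ℕ).degree + 1) := by
      have : (MvPowerSeries.monomial (0 : σ →₀ ℕ) (1 : ℂ)) = 1 := rfl
      rw [this, map_one, sub_self]
      exact zero_mem _
    intro α
    induction α using Finsupp.induction_linear with
    | zero => exact hzero
    | add α β hα hβ => exact hadd α β hα hβ
    | single a n =>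
      induction n with
      | zero => simp
      | succ n ih =>
        rw [Finsupp.single_add]
        refine hadd _ _ ih ?_
        rw [Finsupp.degree_single]
        exact hX a
  have hsplit := sub_truncTotal_mem (d + 1) g
  have h1 := sub_mem (hT _ _ hsplit) hsplit
  have h2 : T (MvPowerSeries.truncTotal (d + 1) g : MvPowerSeries σ ℂ) -
      (MvPowerSeries.truncTotal (d + 1) g : MvPowerSeries σ ℂ) ∈ ordGE σ (d + 1) := by
    have hp : (MvPowerSeries.truncTotal (d + 1) g : MvPowerSeries σ ℂ) =
        ∑ α ∈ (MvPowerSeries.truncTotal (d + 1) g).support,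
          MvPolynomial.coeff α (MvPowerSeries.truncTotal (d + 1) g) •
            MvPowerSeries.monomial α (1 : ℂ) := by
      conv_lhs => rw [MvPolynomial.as_sum (MvPowerSeries.truncTotal (d + 1) g)]
      rw [← MvPolynomial.coeToMvPowerSeries.ringHom_apply, map_sum]
      refine Finset.sum_congr rfl fun α _ => ?_
      rw [MvPolynomial.coeToMvPowerSeries.ringHom_apply, MvPolynomial.coe_monomial, ← map_smul,
        smul_eq_mul, mul_one]
    rw [hp, map_sum, ← Finset.sum_sub_distrib]
    refine sum_mem fun α hα => ?_
    rw [map_smul, ← smul_sub]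
    refine Submodule.smul_mem _ _ (ordGE_anti ?_ (hmon α))
    by_contra hlt
    refine MvPolynomial.mem_support_iff.1 hα ?_
    rw [MvPowerSeries.coeff_truncTotal _ (by omega)]
    exact hg _ (by omega)
  have := add_mem h1 h2
  convert this using 1
  rw [map_sub]
  abel

variable {E : Derivation ℂ (MvPowerSeries σ ℂ) (MvPowerSeries σ ℂ)}

theorem eq_one_of_isGE (hE : Filtered E) {c : ℂ → ℂ} (hc : ∀ μ ν, c (μ + ν) = c μ * c ν)
    (hc0 : c 0 = 1) (h2 : ∀ μ g, IsGE E 2 μ g → g ∉ ordGE σ 2 → c μ = 1) {d : ℕ} {μ : ℂ}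
    {g : MvPowerSeries σ ℂ} (hg : IsGE E d μ g) (hgd : g ∉ ordGE σ d) : c μ = 1 := by
  classical
  have hT2 : ∀ g, fcalcHom hE hc hc0 g - g ∈ ordGE σ 2 := by
    intro g
    induction g using ge_induction hE 2 with
    | h1 μ g hg =>
      by_cases hg2 : g ∈ ordGE σ 2
      · exact sub_mem (fcalc_mem hE c hg2) hg2
      · have := fcalc_spec hE c hg
        rwa [h2 μ g hg hg2, one_smul] at this
    | h2 g h ihg ihh =>
      rw [map_add, add_sub_add_comm]
      exact add_mem ihg ihh
  have hex : ∃ e, g ∉ ordGE σ e := ⟨d, hgd⟩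
  obtain ⟨e, he⟩ : ∃ e, Nat.find hex = e + 1 :=
    Nat.exists_eq_succ_of_ne_zero fun h => by
      have := Nat.find_spec hex
      rw [h] at this
      exact this (mem_ordGE_zero g)
  have hge : g ∈ ordGE σ e := not_not.1 (Nat.find_min hex (by omega))
  have hge' : g ∉ ordGE σ (e + 1) := he ▸ Nat.find_spec hex
  have hle : e + 1 ≤ d := he ▸ Nat.find_min' hex hgd
  have h3 := sub_self_mem_ordGE (fcalcHom hE hc hc0) (fun d g hg => fcalc_mem hE c hg)
    (fun a => hT2 _) hge
  have h4 := sub_mem h3 (fcalc_spec hE c (hg.anti hle))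
  have h5 : (c μ - 1) • g ∈ ordGE σ (e + 1) := by
    convert h4 using 1
    change _ = fcalc hE c g - g - (fcalc hE c g - c μ • g)
    rw [sub_smul, one_smul]
    abel
  by_contra hne
  refine hge' ?_
  have := Submodule.smul_mem _ (c μ - 1)⁻¹ h5
  rwa [smul_smul, inv_mul_cancel₀ (sub_ne_zero.2 hne), one_smul] at this

/-- The character `μ ↦ exp (i s χ μ)`. -/
def chr (χ : ℂ →+ ℂ) (s μ : ℂ) : ℂ := Complex.exp (Complex.I * s * χ μ)

theorem chr_add (χ : ℂ →+ ℂ) (s μ ν : ℂ) : chr χ s (μ + ν) = chr χ s μ * chr χ s ν := by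
  simp [chr, mul_add, Complex.exp_add]

theorem chr_zero (χ : ℂ →+ ℂ) (s : ℂ) : chr χ s 0 = 1 := by simp [chr]

/-- `χ` takes integral values at the eigenvalues of `E` on `d`-jets. -/
def IntegralAt (E : Derivation ℂ (MvPowerSeries σ ℂ) (MvPowerSeries σ ℂ)) (χ : ℂ →+ ℂ) (d : ℕ) :
    Prop := ∀ μ g, IsGE E d μ g → g ∉ ordGE σ d → ∃ k : ℤ, χ μ = k

theorem IntegralAt.all (hE : Filtered E) {χ : ℂ →+ ℂ} (h : IntegralAt E χ 2) (d : ℕ) :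
    IntegralAt E χ d := by
  have key : ∀ μ : ℂ, chr χ (2 * Real.pi) μ = 1 ↔ ∃ k : ℤ, χ μ = k := by
    intro μ
    rw [chr, Complex.exp_eq_one_iff]
    refine exists_congr fun k => ?_
    have h2 : (2 * Real.pi * Complex.I : ℂ) ≠ 0 := by
      simp [Real.pi_ne_zero]
    rw [show Complex.I * (2 * Real.pi) * χ μ = χ μ * (2 * Real.pi * Complex.I) by ring]
    exact mul_left_inj' h2
  intro μ g hg hgd
  exact (key μ).1 (eq_one_of_isGE hE (chr_add χ _) (chr_zero χ _)
    (fun ν g' hg' hgd' => (key ν).2 (h ν g' hg' hgd')) hg hgd)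

/-- The (complexified) circle action generated by `fcalc hE χ`. -/
def tor (hE : Filtered E) (χ : ℂ →+ ℂ) (s : ℂ) : MvPowerSeries σ ℂ →ₐ[ℂ] MvPowerSeries σ ℂ :=
  fcalcHom hE (chr_add χ s) (chr_zero χ s)

theorem tor_apply (hE : Filtered E) (χ : ℂ →+ ℂ) (s : ℂ) (g : MvPowerSeries σ ℂ) :
    tor hE χ s g = fcalc hE (chr χ s) g := rfl

theorem tor_mem (hE : Filtered E) (χ : ℂ →+ ℂ) (s : ℂ) {d : ℕ} {g : MvPowerSeries σ ℂ}
    (hg : g ∈ ordGE σ d) : tor hE χ s g ∈ ordGE σ d := fcalc_mem hE _ hg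

theorem tor_zero (hE : Filtered E) (χ : ℂ →+ ℂ) (g : MvPowerSeries σ ℂ) : tor hE χ 0 g = g := by
  have : chr χ 0 = fun _ => 1 := by ext μ; simp [chr]
  rw [tor_apply, this, fcalc_one, LinearMap.id_apply]

theorem tor_tor (hE : Filtered E) (χ : ℂ →+ ℂ) (s t : ℂ) (g : MvPowerSeries σ ℂ) :
    tor hE χ s (tor hE χ t g) = tor hE χ (s + t) g := by
  rw [tor_apply, tor_apply, tor_apply, fcalc_fcalc]
  congr 2
  ext μ
  rw [chr, chr, chr, ← Complex.exp_add]
  ring_nf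

theorem tor_period (hE : Filtered E) {χ : ℂ →+ ℂ} (h : IntegralAt E χ 2) (s : ℂ) (k : ℤ)
    (g : MvPowerSeries σ ℂ) : tor hE χ (s + k * (2 * Real.pi)) g = tor hE χ s g := by
  rw [tor_apply, tor_apply]
  congr 1
  refine fcalc_congr hE fun d μ g hg hgd => ?_
  obtain ⟨l, hl⟩ := h.all hE d μ g hg hgd
  rw [chr, chr, Complex.exp_eq_exp_iff_exists_int]
  refine ⟨k * l, ?_⟩
  rw [hl]
  push_cast
  ring

theorem tor_of_derivation_eq_zero (hE : Filtered E) (χ : ℂ →+ ℂ) (s : ℂ) {g : MvPowerSeries σ ℂ}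
    (hg : E g = 0) : tor hE χ s g = g := by
  rw [tor_apply, fcalc_eq_of_derivation_eq_zero hE _ hg, chr_zero, one_smul]

/-- The generator of the action `tor`. -/
def gen (hE : Filtered E) (χ : ℂ →+ ℂ) : Derivation ℂ (MvPowerSeries σ ℂ) (MvPowerSeries σ ℂ) :=
  fcalcDer hE (c := fun μ => Complex.I * χ μ) fun μ ν => by simp [mul_add]

theorem gen_apply (hE : Filtered E) (χ : ℂ →+ ℂ) (g : MvPowerSeries σ ℂ) :
    gen hE χ g = fcalc hE (fun μ => Complex.I * χ μ) g := rfl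

theorem hasDerivAt_tor (hE : Filtered E) (χ : ℂ →+ ℂ) {d : ℕ} (L : MvPowerSeries σ ℂ →ₗ[ℂ] ℂ)
    (hL : ∀ g ∈ ordGE σ d, L g = 0) (g : MvPowerSeries σ ℂ) (s : ℂ) :
    HasDerivAt (fun s => L (tor hE χ s g)) (L (tor hE χ s (gen hE χ g))) s := by
  induction g using ge_induction hE d with
  | h1 μ g hg =>
    have h1 : ∀ s, L (tor hE χ s g) = chr χ s μ * L g := by
      intro s
      have := hL _ (fcalc_spec hE (chr χ s) hg)
      rw [map_sub, map_smul, sub_eq_zero] at this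
      exact this
    have h2 : L (tor hE χ s (gen hE χ g)) = chr χ s μ * (Complex.I * χ μ) * L g := by
      rw [tor_apply, gen_apply, fcalc_fcalc]
      have := hL _ (fcalc_spec hE (fun μ => chr χ s μ * (Complex.I * χ μ)) hg)
      rw [map_sub, map_smul, sub_eq_zero] at this
      exact this
    rw [h2]
    simp only [h1]
    refine HasDerivAt.mul_const ?_ _
    have h3 : HasDerivAt (fun s : ℂ => Complex.I * s * χ μ) (Complex.I * χ μ) s := by
      have := ((hasDerivAt_id s).const_mul Complex.I).mul_const (χ μ)
      simpa using this
    exact h3.cexp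
  | h2 g h ihg ihh =>
    simp only [map_add]
    exact ihg.add ihh

theorem differentiable_tor (hE : Filtered E) (χ : ℂ →+ ℂ) {d : ℕ} (L : MvPowerSeries σ ℂ →ₗ[ℂ] ℂ)
    (hL : ∀ g ∈ ordGE σ d, L g = 0) (g : MvPowerSeries σ ℂ) :
    Differentiable ℂ fun s => L (tor hE χ s g) :=
  fun s => (hasDerivAt_tor hE χ L hL g s).differentiableAt

end Torus

section Orbit
variable {σ : Type*} [Finite σ]

theorem map_ev_eq {A B : Type*} [CommRing A] [Algebra ℂ A] [CommRing B] [Algebra ℂ B]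
    (φ : A →ₐ[ℂ] B) (y : σ → A⟦X⟧) (Ψ : MvPowerSeries σ ℂ →ₐ[ℂ] B⟦X⟧)
    (hΨ : ∀ d, ∀ g ∈ ordGE σ d, PowerSeries.X ^ d ∣ Ψ g)
    (hX : ∀ a, PowerSeries.map φ.toRingHom (PowerSeries.X * y a) = Ψ (MvPowerSeries.X a))
    (g : MvPowerSeries σ ℂ) : PowerSeries.map φ.toRingHom (ev y g) = Ψ g := by
  rw [← sub_eq_zero]
  refine eq_zero_of_poly
    ((((PowerSeries.map φ.toRingHom).comp (ev y).toRingHom).toAddMonoidHom -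
      Ψ.toRingHom.toAddMonoidHom)) ?_ ?_ g
  · intro d g hg
    refine dvd_sub ?_ ?_
    · obtain ⟨q, hq⟩ := X_pow_dvd_ev y (ordGE_anti d.le_succ hg)
      refine ⟨PowerSeries.map φ.toRingHom q, ?_⟩
      have := congrArg (PowerSeries.map φ.toRingHom) hq
      rwa [map_mul, map_pow, PowerSeries.map_X] at this
    · exact hΨ _ _ (ordGE_anti d.le_succ hg)
  · intro p
    change PowerSeries.map φ.toRingHom (ev y p) - Ψ p = 0
    rw [sub_eq_zero]
    induction p using MvPolynomial.induction_on with
    | C a =>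
      have h1 : ((MvPolynomial.C a : MvPolynomial σ ℂ) : MvPowerSeries σ ℂ) =
          algebraMap ℂ (MvPowerSeries σ ℂ) a := by
        rw [MvPolynomial.coe_C]; rfl
      rw [h1, AlgHom.commutes, AlgHom.commutes]
      ext d
      rw [PowerSeries.coeff_map, PowerSeries.algebraMap_apply, PowerSeries.algebraMap_apply,
        PowerSeries.coeff_C, PowerSeries.coeff_C]
      split_ifs
      · exact AlgHom.commutes _ _
      · exact map_zero _
    | add p q hp hq => rw [MvPolynomial.coe_add, map_add, map_add, map_add, hp, hq]
    | mul_X p a hp =>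
      rw [MvPolynomial.coe_mul, map_mul, map_mul, map_mul, hp, MvPolynomial.coe_X, ev_X, hX]

/-- Restriction of a series to the line spanned by `v`. -/
def lineEv (v : σ → ℂ) : MvPowerSeries σ ℂ →ₐ[ℂ] ℂ⟦X⟧ := ev fun k => PowerSeries.C (v k)

/-- The value at `v` of the homogeneous component of degree `d`. -/
def hval (d : ℕ) (v : σ → ℂ) : MvPowerSeries σ ℂ →ₗ[ℂ] ℂ :=
  PowerSeries.coeff d ∘ₗ (lineEv v).toLinearMap

theorem hval_apply (d : ℕ) (v : σ → ℂ) (g : MvPowerSeries σ ℂ) :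
    hval d v g = PowerSeries.coeff d (lineEv v g) := rfl

theorem hval_eq_zero {d e : ℕ} (h : d < e) (v : σ → ℂ) {g : MvPowerSeries σ ℂ}
    (hg : g ∈ ordGE σ e) : hval d v g = 0 :=
  PowerSeries.X_pow_dvd_iff.1 (X_pow_dvd_ev _ hg) d h

variable {E : Derivation ℂ (MvPowerSeries σ ℂ) (MvPowerSeries σ ℂ)} (hE : Filtered E)
  (χ : ℂ →+ ℂ) (v : σ → ℂ)

theorem differentiable_hval_tor (d : ℕ) (g : MvPowerSeries σ ℂ) :
    Differentiable ℂ fun s => hval d v (tor hE χ s g) :=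
  differentiable_tor hE χ (hval d v) (fun _ hg => hval_eq_zero (Nat.lt_succ_self d) v hg) g

/-- A homogeneous component along the real circle action, as a smooth function. -/
def orbitCoeff (d : ℕ) (g : MvPowerSeries σ ℂ) : smoothFn :=
  ⟨fun s : ℝ => hval d v (tor hE χ s g),
    show ContDiff ℝ ⊤ _ from
      ((differentiable_hval_tor hE χ v d g).contDiff.restrict_scalars ℝ).comp
        Complex.ofRealCLM.contDiff⟩

theorem smoothDeriv_orbitCoeff (d : ℕ) (g : MvPowerSeries σ ℂ) :
    smoothDeriv (orbitCoeff hE χ v d g) = orbitCoeff hE χ v d (gen hE χ g) := by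
  ext s
  rw [smoothDeriv_apply]
  exact ((hasDerivAt_tor hE χ (hval d v) (fun _ hg => hval_eq_zero (Nat.lt_succ_self d) v hg)
    g s).comp_ofReal).deriv

/-- The formal orbit of `v` under the circle action. -/
def orbit (a : σ) : smoothFn⟦X⟧ :=
  PowerSeries.mk fun d => orbitCoeff hE χ v (d + 1) (MvPowerSeries.X a)

/-- Evaluation of smooth functions at a point. -/
def evalAt (s : ℝ) : smoothFn →ₐ[ℂ] ℂ := (Pi.evalAlgHom ℂ (fun _ : ℝ => ℂ) s).comp smoothFn.val

theorem map_ev_orbit (s : ℝ) (g : MvPowerSeries σ ℂ) :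
    PowerSeries.map (evalAt s).toRingHom (ev (orbit hE χ v) g) = lineEv v (tor hE χ s g) := by
  refine map_ev_eq (evalAt s) _ ((lineEv v).comp (tor hE χ s))
    (fun d g hg => X_pow_dvd_ev _ (tor_mem hE χ s hg)) (fun a => ?_) g
  ext d
  rcases d with _ | d
  · rw [map_mul, PowerSeries.map_X, PowerSeries.coeff_zero_X_mul]
    exact (hval_eq_zero zero_lt_one v (tor_mem hE χ s (X_mem_ordGE a))).symm
  · rw [map_mul, PowerSeries.map_X, PowerSeries.coeff_succ_X_mul, PowerSeries.coeff_map, orbit,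
      PowerSeries.coeff_mk]
    rfl

theorem coeff_ev_orbit (d : ℕ) (g : MvPowerSeries σ ℂ) :
    PowerSeries.coeff d (ev (orbit hE χ v) g) = orbitCoeff hE χ v d g := by
  ext s
  have := congrArg (PowerSeries.coeff d) (map_ev_orbit hE χ v s g)
  rwa [PowerSeries.coeff_map] at this

theorem X_mul_dser_orbit (a : σ) : PowerSeries.X * dser smoothDeriv (orbit hE χ v a) =
    ev (orbit hE χ v) (gen hE χ (MvPowerSeries.X a)) := by
  have h1 : PowerSeries.X * orbit hE χ v a = ev (orbit hE χ v) (MvPowerSeries.X a) :=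
    (ev_X _ a).symm
  have h2 := dser_X_pow_mul smoothDeriv 1 (orbit hE χ v a)
  rw [pow_one, h1] at h2
  rw [← h2]
  ext1 d
  rw [coeff_dser, coeff_ev_orbit, coeff_ev_orbit, smoothDeriv_orbitCoeff]

theorem hval_X (d : ℕ) (a : σ) : hval (d + 2) v (MvPowerSeries.X a) = 0 := by
  rw [hval_apply, lineEv, ev_X, PowerSeries.coeff_succ_X_mul, PowerSeries.coeff_C, if_neg (by omega)]

theorem coeff_orbit_mem {χ : ℂ →+ ℂ} (h : IntegralAt E χ 2) (a : σ) (d : ℕ) :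
    PowerSeries.coeff (d + 1) (orbit hE χ v a) ∈ smoothEnds := by
  rw [orbit, PowerSeries.coeff_mk]
  constructor
  · change hval (d + 2) v (tor hE χ ((0 : ℝ) : ℂ) _) = 0
    rw [Complex.ofReal_zero, tor_zero, hval_X]
  · change hval (d + 2) v (tor hE χ ((2 * Real.pi : ℝ) : ℂ) _) = 0
    have := tor_period hE h 0 1 (MvPowerSeries.X a)
    rw [zero_add, tor_zero, Int.cast_one, one_mul] at this
    push_cast
    rw [this, hval_X]

theorem ev_orbit_of_derivation_eq_zero {g : MvPowerSeries σ ℂ} (hg : E g = 0) :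
    ev (orbit hE χ v) g =
      ev (fun k => PowerSeries.C (algebraMap ℂ smoothFn (v k))) g := by
  have h0 : ev (fun k => PowerSeries.C (algebraMap ℂ smoothFn (v k))) g =
      PowerSeries.map (algebraMap ℂ smoothFn) (lineEv v g) := by
    refine (map_ev_eq (Algebra.ofId ℂ smoothFn) _ (ev _) (fun d g hg => X_pow_dvd_ev _ hg)
      (fun a => ?_) g).symm
    rw [map_mul, PowerSeries.map_X, PowerSeries.map_C, ev_X]
    rfl
  rw [h0]
  ext d s
  rw [coeff_ev_orbit, PowerSeries.coeff_map]
  change hval d v (tor hE χ s g) = hval d v g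
  rw [tor_of_derivation_eq_zero hE χ _ hg]

theorem dser_ev_orbit_of_derivation_eq_zero {g : MvPowerSeries σ ℂ} (hg : E g = 0) :
    dser smoothDeriv (ev (orbit hE χ v) g) = 0 := by
  ext1 d
  rw [coeff_dser, coeff_ev_orbit, smoothDeriv_orbitCoeff, gen_apply,
    fcalc_eq_of_derivation_eq_zero hE _ hg]
  ext s
  simp [orbitCoeff]

theorem exists_ev_orbit_eq {χ : ℂ →+ ℂ} {d : ℕ} {g : MvPowerSeries σ ℂ} (hg : g ∈ ordGE σ d)
    (h0 : ∀ s : ℝ, hval d v (tor hE χ s g) ≠ 0) : ∃ q : smoothFn⟦X⟧,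
      ev (orbit hE χ v) g = PowerSeries.X ^ d * q ∧ IsUnit (PowerSeries.constantCoeff q) := by
  obtain ⟨q, hq⟩ := X_pow_dvd_ev (orbit hE χ v) hg
  refine ⟨q, hq, isUnit_smoothFn fun s => ?_⟩
  have := congrArg (PowerSeries.coeff (0 + d)) hq
  rw [PowerSeries.coeff_X_pow_mul, zero_add, coeff_ev_orbit,
    PowerSeries.coeff_zero_eq_constantCoeff_apply] at this
  rw [← this]
  exact h0 s

end Orbit

section VF
variable {σ : Type*} [Fintype σ]

theorem derivation_eq_zero (D : Derivation ℂ (MvPowerSeries σ ℂ) (MvPowerSeries σ ℂ)) {e : ℕ}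
    (hD : ∀ d, ∀ g ∈ ordGE σ (d + e), D g ∈ ordGE σ d) (hX : ∀ a, D (MvPowerSeries.X a) = 0)
    (g : MvPowerSeries σ ℂ) : D g = 0 := by
  have hp : ∀ p : MvPolynomial σ ℂ, D (p : MvPowerSeries σ ℂ) = 0 := by
    intro p
    induction p using MvPolynomial.induction_on with
    | C a =>
      have h1 : ((MvPolynomial.C a : MvPolynomial σ ℂ) : MvPowerSeries σ ℂ) =
          algebraMap ℂ (MvPowerSeries σ ℂ) a := by
        rw [MvPolynomial.coe_C]; rfl
      rw [h1, Derivation.map_algebraMap]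
    | add p q hp hq => rw [MvPolynomial.coe_add, map_add, hp, hq, add_zero]
    | mul_X p a hp =>
      rw [MvPolynomial.coe_mul, Derivation.leibniz, hp, MvPolynomial.coe_X, hX, smul_zero,
        smul_zero, add_zero]
  refine eq_zero_of_forall_mem_ordGE fun d => ?_
  have := hD d _ (sub_truncTotal_mem (d + e) g)
  rwa [map_sub, hp, sub_zero] at this

/-- The derivation attached to a formal vector field. -/
def vf (Y : σ → MvPowerSeries σ ℂ) : Derivation ℂ (MvPowerSeries σ ℂ) (MvPowerSeries σ ℂ) :=
  ∑ a, Y a • MvPowerSeries.pderiv ℂ a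

theorem vf_apply (Y : σ → MvPowerSeries σ ℂ) (g : MvPowerSeries σ ℂ) :
    vf Y g = ∑ a, Y a * MvPowerSeries.pderiv ℂ a g := by
  rw [vf, ← Derivation.coeFnAddMonoidHom_apply, map_sum, Finset.sum_apply]
  rfl

theorem vf_X (Y : σ → MvPowerSeries σ ℂ) (a : σ) : vf Y (MvPowerSeries.X a) = Y a := by
  classical
  rw [vf_apply, Finset.sum_eq_single a]
  · simp [MvPowerSeries.pderiv_X_self]
  · intro b _ hb
    simp [MvPowerSeries.pderiv_X_of_ne hb.symm]
  · simp

theorem vf_mem (Y : σ → MvPowerSeries σ ℂ) {d : ℕ} {g : MvPowerSeries σ ℂ}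
    (hg : g ∈ ordGE σ (d + 1)) : vf Y g ∈ ordGE σ d := by
  rw [vf_apply]
  exact sum_mem fun a _ => mul_mem_ordGE_right (pderiv_mem_ordGE hg a) _

theorem vf_filtered {Y : σ → MvPowerSeries σ ℂ} (hY : ∀ a, Y a ∈ ordGE σ 1) :
    Filtered (vf Y) := by
  intro d g hg
  rcases d with _ | d
  · exact mem_ordGE_zero _
  rw [vf_apply]
  refine sum_mem fun a _ => ?_
  have := mul_mem_ordGE (hY a) (pderiv_mem_ordGE hg a)
  rwa [add_comm] at this

theorem eq_vf (D : Derivation ℂ (MvPowerSeries σ ℂ) (MvPowerSeries σ ℂ))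
    (hD : ∀ d, ∀ g ∈ ordGE σ (d + 1), D g ∈ ordGE σ d) :
    D = vf fun a => D (MvPowerSeries.X a) := by
  refine Derivation.ext fun g => sub_eq_zero.1 ?_
  exact derivation_eq_zero (D - vf fun a => D (MvPowerSeries.X a)) (e := 1)
    (fun d g hg => sub_mem (hD d g hg) (vf_mem _ hg))
    (fun a => by rw [Derivation.sub_apply, vf_X, sub_self]) g

theorem vf_comm {Y Z : σ → MvPowerSeries σ ℂ} (h : ∀ b, vf Y (Z b) = vf Z (Y b))
    (g : MvPowerSeries σ ℂ) : vf Y (vf Z g) = vf Z (vf Y g) := by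
  have := derivation_eq_zero ⁅vf Y, vf Z⁆ (e := 2) (fun d g hg => ?_) (fun a => ?_) g
  · rwa [Derivation.commutator_apply, sub_eq_zero] at this
  · rw [Derivation.commutator_apply]
    exact sub_mem (vf_mem _ (vf_mem _ hg)) (vf_mem _ (vf_mem _ hg))
  · rw [Derivation.commutator_apply, vf_X, vf_X, h, sub_self]

end VF

section Growth
variable {σ ι κ : Type*} [Fintype σ] [Fintype ι] [Fintype κ] [DecidableEq ι] [DecidableEq κ]
  [DecidableEq σ]

/-- Formal data of an integrable system; `i₀` is the vector field to be normalized. -/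
structure FormalSystem (Xf : ι → σ → MvPowerSeries σ ℂ) (F : κ → MvPowerSeries σ ℂ) (i₀ : ι) :
    Prop where
  cvgX : ∀ i b, Cvg (Xf i b)
  cvgF : ∀ j, Cvg (F j)
  comm : ∀ i l b, vf (Xf i) (Xf l b) = vf (Xf l) (Xf i b)
  integral : ∀ i j, vf (Xf i) (F j) = 0
  vanish : ∀ b, Xf i₀ b ∈ ordGE σ 1

variable {Xf : ι → σ → MvPowerSeries σ ℂ} {F : κ → MvPowerSeries σ ℂ} {i₀ : ι}

theorem FormalSystem.filtered (h : FormalSystem Xf F i₀) : Filtered (vf (Xf i₀)) :=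
  vf_filtered h.vanish

theorem growth_tor (h : FormalSystem Xf F i₀) (Cm : Matrix σ κ ℂ) (e : ι ⊕ κ ≃ σ)
    {χ : ℂ →+ ℂ} (hχ : IntegralAt (vf (Xf i₀)) χ 2) {k l : ℕ}
    (hk : ((frame Xf Cm).submatrix id e.symm).det ∈ ordGE σ k)
    (hl : (jacC F Cm).det ∈ ordGE σ l) {v : σ → ℂ}
    (hv1 : ∀ s : ℝ, hval k v (tor h.filtered χ s ((frame Xf Cm).submatrix id e.symm).det) ≠ 0)
    (hv2 : ∀ s : ℝ, hval l v (tor h.filtered χ s (jacC F Cm).det) ≠ 0)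
    {g : MvPowerSeries σ ℂ} (hg : Cvg g) :
    ∃ K : ℝ, 0 < K ∧ ∀ d, ∀ s ∈ Set.Icc (0 : ℝ) (2 * Real.pi),
      ‖hval d v (tor h.filtered χ s g)‖ ≤ K ^ (d + 1) := by
  obtain ⟨g1, hg1, hg1u⟩ := exists_ev_orbit_eq h.filtered v hk hv1
  obtain ⟨g2, hg2, hg2u⟩ := exists_ev_orbit_eq h.filtered v hl hv2
  have hgen : ∀ d, ∀ g ∈ ordGE σ (d + 1), gen h.filtered χ g ∈ ordGE σ d := fun d g hg =>
    fcalc_mem h.filtered _ (ordGE_anti d.le_succ hg)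
  have hconv : ∀ a, orbit h.filtered χ v a ∈ Conv smoothFn := by
    refine mem_Conv_of_formal_orbit Xf F Cm smoothDeriv smoothEnds (c := 1 + 4 * Real.pi)
      (by positivity) smooth_integral_bound h.cvgX h.cvgF
      (fun i l b => by rw [← vf_apply, ← vf_apply, h.comm])
      (fun i j => by rw [← vf_apply, h.integral]) _ (coeff_orbit_mem h.filtered v hχ)
      (fun j => ?_) (fun j => dser_ev_orbit_of_derivation_eq_zero _ _ _ (h.integral i₀ j))
      (fun a => gen h.filtered χ (MvPowerSeries.X a)) (X_mul_dser_orbit h.filtered χ v)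
      (fun i b => ?_) e hg1 hg1u hg2 hg2u
    · rw [ev_orbit_of_derivation_eq_zero _ _ _ (h.integral i₀ j)]
      exact ev_mem_Bd (h.cvgF j) fun k => C_mem_Bd _
    · rw [← vf_apply, ← vf_apply, ← eq_vf _ hgen, gen_apply, gen_apply, ← vf_X (Xf i) b]
      exact fcalc_comm h.filtered _ (Y := (vf (Xf i)).toLinearMap) (vf_comm (h.comm i i₀))
        (fun d g hg => vf_mem _ hg) _
  obtain ⟨K, hK, hK'⟩ := pow_le_of_mem_Conv (ev_mem_Bd hg hconv)
  refine ⟨K, hK, fun d s hs => le_trans ?_ (hK' d)⟩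
  rw [coeff_ev_orbit]
  exact norm_apply_le (orbitCoeff h.filtered χ v d g) hs

end Growth

section Generic
variable {σ : Type*} [Fintype σ]

/-- Exponents of total degree `d`. -/
def degFin (σ : Type*) [Finite σ] (d : ℕ) : Finset (σ →₀ ℕ) :=
  (Finsupp.finite_of_degree_eq (σ := σ) d).toFinset

theorem mem_degFin {d : ℕ} {α : σ →₀ ℕ} : α ∈ degFin σ d ↔ α.degree = d := by simp [degFin]

theorem linearMap_eq_zero_of_monomial {V : Type*} [AddCommGroup V] [Module ℂ V]
    (L : MvPowerSeries σ ℂ →ₗ[ℂ] V) {e : ℕ} (hL : ∀ g ∈ ordGE σ e, L g = 0)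
    (hm : ∀ α : σ →₀ ℕ, L (MvPowerSeries.monomial α 1) = 0) (g : MvPowerSeries σ ℂ) : L g = 0 := by
  have h1 := hL _ (sub_truncTotal_mem e g)
  rw [map_sub, sub_eq_zero] at h1
  rw [h1]
  have hp : (MvPowerSeries.truncTotal e g : MvPowerSeries σ ℂ) =
      ∑ α ∈ (MvPowerSeries.truncTotal e g).support,
        MvPolynomial.coeff α (MvPowerSeries.truncTotal e g) •
          MvPowerSeries.monomial α (1 : ℂ) := by
    conv_lhs => rw [MvPolynomial.as_sum (MvPowerSeries.truncTotal e g)]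
    rw [← MvPolynomial.coeToMvPowerSeries.ringHom_apply, map_sum]
    refine Finset.sum_congr rfl fun α _ => ?_
    rw [MvPolynomial.coeToMvPowerSeries.ringHom_apply, MvPolynomial.coe_monomial, ← map_smul,
      smul_eq_mul, mul_one]
  rw [hp, map_sum]
  exact Finset.sum_eq_zero fun α _ => by rw [map_smul, hm, smul_zero]

theorem lineEv_monomial (v : σ → ℂ) (α : σ →₀ ℕ) : lineEv v (MvPowerSeries.monomial α 1) =
    PowerSeries.X ^ α.degree * PowerSeries.C (∏ a, v a ^ α a) := by
  have h1 : (MvPowerSeries.monomial α (1 : ℂ)) =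
      ((MvPolynomial.monomial α (1 : ℂ) : MvPolynomial σ ℂ) : MvPowerSeries σ ℂ) :=
    (MvPolynomial.coe_monomial _ _).symm
  rw [h1, lineEv, ev_coe, MvPolynomial.aeval_monomial, map_one, one_mul,
    Finsupp.prod_fintype _ _ (by simp), Finsupp.degree_eq_sum]
  simp_rw [mul_pow]
  rw [Finset.prod_mul_distrib, Finset.prod_pow_eq_pow_sum, map_prod]
  simp_rw [map_pow]

theorem hval_monomial (d : ℕ) (v : σ → ℂ) (α : σ →₀ ℕ) : hval d v (MvPowerSeries.monomial α 1) =
    if α.degree = d then ∏ a, v a ^ α a else 0 := by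
  rw [hval_apply, lineEv_monomial, PowerSeries.coeff_X_pow_mul', PowerSeries.coeff_C]
  by_cases h : α.degree = d
  · simp [h]
  · rw [if_neg h]
    split_ifs <;> first | omega | rfl

theorem hval_eq_sum (d : ℕ) (v : σ → ℂ) (g : MvPowerSeries σ ℂ) :
    hval d v g = ∑ α ∈ degFin σ d, MvPowerSeries.coeff α g * ∏ a, v a ^ α a := by
  classical
  rw [← sub_eq_zero]
  have h : (hval d v - ∑ α ∈ degFin σ d, (∏ a, v a ^ α a) •
      (MvPowerSeries.coeff α : MvPowerSeries σ ℂ →ₗ[ℂ] ℂ) :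
      MvPowerSeries σ ℂ →ₗ[ℂ] ℂ) g = 0 := ?_
  · rw [LinearMap.sub_apply, LinearMap.sum_apply] at h
    simpa [mul_comm] using h
  refine linearMap_eq_zero_of_monomial _ (e := d + 1) (fun g hg => ?_) (fun α => ?_) g
  · rw [LinearMap.sub_apply, hval_eq_zero (Nat.lt_succ_self d) v hg, LinearMap.sum_apply, zero_sub,
      neg_eq_zero]
    refine Finset.sum_eq_zero fun α hα => ?_
    rw [LinearMap.smul_apply, hg α (by rw [mem_degFin.1 hα]; exact Nat.lt_succ_self d), smul_zero]
  · rw [LinearMap.sub_apply, hval_monomial, LinearMap.sum_apply, sub_eq_zero]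
    simp_rw [LinearMap.smul_apply, MvPowerSeries.coeff_monomial, smul_eq_mul, mul_ite, mul_one,
      mul_zero]
    rw [Finset.sum_ite_eq']
    simp only [mem_degFin]

theorem hval_smul (d : ℕ) (c : ℂ) (v : σ → ℂ) (g : MvPowerSeries σ ℂ) :
    hval d (c • v) g = c ^ d * hval d v g := by
  rw [hval_eq_sum, hval_eq_sum, Finset.mul_sum]
  refine Finset.sum_congr rfl fun α hα => ?_
  simp_rw [Pi.smul_apply, smul_eq_mul, mul_pow]
  rw [Finset.prod_mul_distrib, Finset.prod_pow_eq_pow_sum, ← Finsupp.degree_eq_sum,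
    mem_degFin.1 hα]
  ring

theorem continuous_hval (d : ℕ) (g : MvPowerSeries σ ℂ) : Continuous fun v => hval d v g := by
  simp_rw [hval_eq_sum]
  fun_prop

theorem differentiable_hval (d : ℕ) (g : MvPowerSeries σ ℂ) :
    Differentiable ℂ fun v => hval d v g := by
  simp_rw [hval_eq_sum]
  fun_prop

theorem continuous_hval_tor {E : Derivation ℂ (MvPowerSeries σ ℂ) (MvPowerSeries σ ℂ)}
    (hE : Filtered E) (χ : ℂ →+ ℂ) (d : ℕ) (g : MvPowerSeries σ ℂ) :
    Continuous fun p : (σ → ℂ) × ℝ => hval d p.1 (tor hE χ p.2 g) := by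
  have h : ∀ α : σ →₀ ℕ, Continuous fun s : ℝ => MvPowerSeries.coeff α (tor hE χ s g) := fun α =>
    (differentiable_tor hE χ (d := α.degree + 1) (MvPowerSeries.coeff α)
      (fun g hg => hg α (Nat.lt_succ_self _)) g).continuous.comp Complex.continuous_ofReal
  simp_rw [hval_eq_sum]
  exact continuous_finsetSum _ fun α _ => ((h α).comp continuous_snd).mul (by fun_prop)

theorem exists_hval_ne_zero {d : ℕ} {g : MvPowerSeries σ ℂ} (hg : g ∈ ordGE σ d)
    (hg' : g ∉ ordGE σ (d + 1)) : ∃ v, hval d v g ≠ 0 := by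
  classical
  by_contra! hv
  refine hg' fun α hα => ?_
  rcases Nat.lt_succ_iff_lt_or_eq.1 hα with hα | hα
  · exact hg α hα
  have h0 : (∑ β ∈ degFin σ d, MvPolynomial.monomial β (MvPowerSeries.coeff β g)) = 0 := by
    refine MvPolynomial.funext fun v => ?_
    rw [map_sum, map_zero, ← hv v, hval_eq_sum]
    refine Finset.sum_congr rfl fun β _ => ?_
    rw [MvPolynomial.eval_monomial, Finsupp.prod_fintype _ _ (by simp)]
  have := congrArg (MvPolynomial.coeff α) h0
  rw [MvPolynomial.coeff_sum, MvPolynomial.coeff_zero] at this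
  simp_rw [MvPolynomial.coeff_monomial] at this
  rwa [Finset.sum_ite_eq', if_pos (mem_degFin.2 hα)] at this

theorem hval_mul {d e : ℕ} {g h : MvPowerSeries σ ℂ} (hg : g ∈ ordGE σ d) (hh : h ∈ ordGE σ e)
    (v : σ → ℂ) : hval (d + e) v (g * h) = hval d v g * hval e v h := by
  obtain ⟨p, hp⟩ : PowerSeries.X ^ d ∣ lineEv v g := X_pow_dvd_ev _ hg
  obtain ⟨q, hq⟩ : PowerSeries.X ^ e ∣ lineEv v h := X_pow_dvd_ev _ hh
  rw [hval_apply, hval_apply, hval_apply, map_mul, hp, hq,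
    show PowerSeries.X ^ d * p * (PowerSeries.X ^ e * q) = PowerSeries.X ^ (d + e) * (p * q) by ring]
  have h0 : ∀ (k : ℕ) (r : ℂ⟦X⟧), PowerSeries.coeff k (PowerSeries.X ^ k * r) =
      PowerSeries.constantCoeff r := fun k r => by
    rw [PowerSeries.coeff_X_pow_mul', if_pos le_rfl, Nat.sub_self,
      PowerSeries.coeff_zero_eq_constantCoeff_apply]
  rw [h0, h0, h0, map_mul]

/-- The lowest homogeneous component is moved by the linear part of an endomorphism. -/
theorem hval_algHom (T : MvPowerSeries σ ℂ →ₐ[ℂ] MvPowerSeries σ ℂ)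
    (hT : ∀ d, ∀ g ∈ ordGE σ d, T g ∈ ordGE σ d) (v : σ → ℂ) {d : ℕ} {g : MvPowerSeries σ ℂ}
    (hg : g ∈ ordGE σ d) :
    hval d v (T g) = hval d (fun a => hval 1 v (T (MvPowerSeries.X a))) g := by
  classical
  have hmon : ∀ α : σ →₀ ℕ, hval α.degree v (T (MvPowerSeries.monomial α 1)) =
      ∏ a, hval 1 v (T (MvPowerSeries.X a)) ^ α a := by
    have hadd : ∀ α β : σ →₀ ℕ,
        hval α.degree v (T (MvPowerSeries.monomial α 1)) =
          ∏ a, hval 1 v (T (MvPowerSeries.X a)) ^ α a →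
        hval β.degree v (T (MvPowerSeries.monomial β 1)) =
          ∏ a, hval 1 v (T (MvPowerSeries.X a)) ^ β a →
        hval (α + β).degree v (T (MvPowerSeries.monomial (α + β) 1)) =
          ∏ a, hval 1 v (T (MvPowerSeries.X a)) ^ (α + β) a := by
      intro α β hα hβ
      have h3 : (MvPowerSeries.monomial (α + β) (1 : ℂ)) =
          MvPowerSeries.monomial α 1 * MvPowerSeries.monomial β 1 := by
        rw [MvPowerSeries.monomial_mul_monomial, one_mul]
      have h4 : (α + β).degree = α.degree + β.degree := map_add _ _ _
      rw [h3, map_mul, h4, hval_mul (hT _ _ (monomial_mem_ordGE α 1))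
        (hT _ _ (monomial_mem_ordGE β 1)), hα, hβ, ← Finset.prod_mul_distrib]
      simp_rw [Finsupp.add_apply, pow_add]
    have hzero : hval (0 : σ →₀ ℕ).degree v (T (MvPowerSeries.monomial 0 1)) =
        ∏ a, hval 1 v (T (MvPowerSeries.X a)) ^ (0 : σ →₀ ℕ) a := by
      have : (MvPowerSeries.monomial (0 : σ →₀ ℕ) (1 : ℂ)) = 1 := rfl
      rw [this, map_one, hval_apply, map_one]
      simp
    intro α
    induction α using Finsupp.induction_linear with
    | zero => exact hzero
    | add α β hα hβ => exact hadd α β hα hβ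
    | single a n =>
      induction n with
      | zero => rw [Finsupp.single_zero]; exact hzero
      | succ n ih =>
        rw [Finsupp.single_add]
        refine hadd _ _ ih ?_
        rw [Finsupp.degree_single, Finset.prod_eq_single a]
        · simp [MvPowerSeries.X]
        · intro b _ hb
          simp [hb.symm]
        · simp
  have hsplit : g - ∑ α ∈ degFin σ d, MvPowerSeries.coeff α g • MvPowerSeries.monomial α (1 : ℂ) ∈
      ordGE σ (d + 1) := by
    intro β hβ
    rw [map_sub, map_sum]
    simp_rw [map_smul, MvPowerSeries.coeff_monomial, smul_eq_mul, mul_ite, mul_one, mul_zero]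
    rw [Finset.sum_ite_eq]
    rcases Nat.lt_succ_iff_lt_or_eq.1 hβ with hβ | hβ
    · rw [if_neg (by rw [mem_degFin]; omega), hg β hβ, sub_zero]
    · rw [if_pos (mem_degFin.2 hβ), sub_self]
  have h1 := hval_eq_zero (Nat.lt_succ_self d) v (hT _ _ hsplit)
  rw [map_sub, map_sub, sub_eq_zero] at h1
  rw [h1, map_sum, map_sum, hval_eq_sum]
  refine Finset.sum_congr rfl fun α hα => ?_
  rw [map_smul, map_smul, ← hmon α, mem_degFin.1 hα, smul_eq_mul]

theorem exists_horizontal_line {p : ℂ → ℂ} (hp : Differentiable ℂ p) {z : ℂ} (hz : p z ≠ 0) :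
    ∃ t : ℝ, ∀ s : ℝ, p (s + Complex.I * t) ≠ 0 := by
  have hcod := (hp.differentiableOn.analyticOnNhd isOpen_univ).preimage_zero_mem_codiscrete hz
  have hd : IsDiscrete (p ⁻¹' {0}) := by simpa using (mem_codiscrete'.mp hcod).2
  have := hd.to_subtype
  have hc : (p ⁻¹' {0}).Countable := TopologicalSpace.separableSpace_iff_countable.1 inferInstance
  have hc' := hc.image Complex.im
  obtain ⟨t, ht⟩ : ∃ t : ℝ, t ∉ Complex.im '' (p ⁻¹' {0}) := by
    by_contra! hall
    exact Cardinal.not_countable_real (hc'.mono fun t _ => hall t)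
  exact ⟨t, fun s hs => ht ⟨_, hs, by simp⟩⟩

/-- Generic vectors: the lowest component does not vanish along the circle orbit. -/
theorem exists_isOpen_hval_tor_ne_zero {E : Derivation ℂ (MvPowerSeries σ ℂ) (MvPowerSeries σ ℂ)}
    (hE : Filtered E) {χ : ℂ →+ ℂ} (hχ : IntegralAt E χ 2) {d : ℕ} {g : MvPowerSeries σ ℂ}
    (hg : g ∈ ordGE σ d) (hg' : g ∉ ordGE σ (d + 1)) :
    ∃ V : Set (σ → ℂ), IsOpen V ∧ V.Nonempty ∧
      ∀ v ∈ V, ∀ s : ℝ, hval d v (tor hE χ s g) ≠ 0 := by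
  obtain ⟨v₀, hv₀⟩ := exists_hval_ne_zero hg hg'
  obtain ⟨t, ht⟩ := exists_horizontal_line (differentiable_hval_tor hE χ v₀ d g) (z := 0)
    (by rwa [tor_zero])
  set v₁ : σ → ℂ := fun a => hval 1 v₀ (tor hE χ (Complex.I * t) (MvPowerSeries.X a)) with hv₁
  have h1 : ∀ s : ℝ, hval d v₁ (tor hE χ s g) ≠ 0 := by
    intro s
    rw [← hval_algHom (tor hE χ (Complex.I * t)) (fun _ _ h => tor_mem hE χ _ h) v₀
      (tor_mem hE χ s hg), tor_tor, add_comm]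
    exact ht s
  have h2 : ∀ᶠ v in 𝓝 v₁, ∀ s ∈ Set.Icc (0 : ℝ) (2 * Real.pi), hval d v (tor hE χ s g) ≠ 0 :=
    isCompact_Icc.eventually_forall_of_forall_eventually fun s _ =>
      (continuous_hval_tor hE χ d g).continuousAt.eventually_ne (h1 s)
  obtain ⟨V, hV, hVo, hv₁V⟩ := eventually_nhds_iff.1 h2
  refine ⟨V, hVo, ⟨v₁, hv₁V⟩, fun v hv s => ?_⟩
  have hpi : 0 < 2 * Real.pi := by positivity
  obtain ⟨k, hk, -⟩ := existsUnique_add_zsmul_mem_Ico hpi s 0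
  have h3 := hV v hv (s + k • (2 * Real.pi)) ⟨hk.1, by linarith [hk.2]⟩
  have h4 := tor_period hE hχ s k g
  rw [← h4]
  convert h3 using 4
  push_cast
  simp

end Generic

section Bounds
variable {σ : Type*} [Fintype σ]

theorem summable_pow_degree {r : ℝ} (hr : 0 ≤ r) (hr1 : r < 1) :
    Summable fun α : σ →₀ ℕ => r ^ α.degree := by
  classical
  refine summable_of_sum_le (c := ∏ _a : σ, (1 - r)⁻¹) (fun α => pow_nonneg hr _) fun u => ?_
  obtain ⟨M, hM⟩ : ∃ M : ℕ, ∀ α ∈ u, ∀ a, α a < M := by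
    refine ⟨u.sup Finsupp.degree + 1, fun α hα a => Nat.lt_succ_of_le ?_⟩
    exact (Finsupp.le_degree a α).trans (Finset.le_sup (f := Finsupp.degree) hα)
  calc ∑ α ∈ u, r ^ α.degree
      = ∑ f ∈ u.map (Finsupp.equivFunOnFinite (α := σ) (M := ℕ)).toEmbedding, ∏ a, r ^ f a := by
        rw [Finset.sum_map]
        refine Finset.sum_congr rfl fun α _ => ?_
        rw [Finset.prod_pow_eq_pow_sum, Finsupp.degree_eq_sum]
        rfl
    _ ≤ ∑ f ∈ Fintype.piFinset fun _ : σ => Finset.range M, ∏ a, r ^ f a := by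
        refine Finset.sum_le_sum_of_subset_of_nonneg ?_ fun f _ _ =>
          Finset.prod_nonneg fun a _ => pow_nonneg hr _
        intro f hf
        obtain ⟨α, hα, rfl⟩ := Finset.mem_map.1 hf
        exact Fintype.mem_piFinset.2 fun a => Finset.mem_range.2 (hM α hα a)
    _ = ∏ _a : σ, ∑ j ∈ Finset.range M, r ^ j := (Finset.prod_univ_sum _ _).symm
    _ ≤ ∏ _a : σ, (1 - r)⁻¹ := by
        refine Finset.prod_le_prod (fun a _ => Finset.sum_nonneg fun j _ => pow_nonneg hr _)
          fun a _ => ?_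
        rw [← tsum_geometric_of_lt_one hr hr1]
        exact (summable_geometric_of_lt_one hr hr1).sum_le_tsum _ fun j _ => pow_nonneg hr _

theorem sum_rootsOfUnity {N : ℕ} {ζ : ℂ} (hζ : IsPrimitiveRoot ζ N) {a b : ℕ} (ha : a < N)
    (hb : b < N) : ∑ j ∈ Finset.range N, (ζ ^ j) ^ b * (ζ ^ j) ^ (N - a) =
      if b = a then (N : ℂ) else 0 := by
  have h1 : ∀ j, (ζ ^ j) ^ b * (ζ ^ j) ^ (N - a) = (ζ ^ (b + (N - a))) ^ j := fun j => by
    rw [← pow_add, ← pow_mul, ← pow_mul, mul_comm]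
  simp_rw [h1]
  split_ifs with h
  · subst h
    rw [Nat.add_sub_of_le hb.le, hζ.pow_eq_one]
    simp
  · have h2 : ζ ^ (b + (N - a)) ≠ 1 := by
      rw [Ne, hζ.pow_eq_one_iff_dvd]
      rintro ⟨k, hk⟩
      rcases k with _ | _ | k
      · omega
      · omega
      · have : N * 2 ≤ N * (k + 1 + 1) := Nat.mul_le_mul_left _ (by omega)
        omega
    have h3 := geom_sum_mul (ζ ^ (b + (N - a))) N
    rw [← pow_mul, mul_comm _ N, pow_mul, hζ.pow_eq_one, one_pow, sub_self] at h3
    exact (mul_eq_zero.1 h3).resolve_right (sub_ne_zero.2 h2)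

/-- Cauchy estimate for a homogeneous component bounded on the torus of radius `r`. -/
theorem norm_coeff_mul_pow_le {H : MvPowerSeries σ ℂ} {d : ℕ} {r B : ℝ} (hr : 0 ≤ r)
    (hB : ∀ x : σ → ℂ, (∀ a, ‖x a‖ ≤ r) → ‖hval d x H‖ ≤ B) {α : σ →₀ ℕ} (hα : α.degree = d) :
    ‖MvPowerSeries.coeff α H‖ * r ^ d ≤ B := by
  classical
  set N := d + 1 with hN
  have hζ := Complex.isPrimitiveRoot_exp N (by omega)
  set ζ := Complex.exp (2 * Real.pi * Complex.I / N)
  have hζ1 : ‖ζ‖ = 1 := hζ.norm'_eq_one (by omega)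
  have hlt : ∀ β : σ →₀ ℕ, β.degree = d → ∀ a, β a < N := fun β hβ a =>
    Nat.lt_succ_of_le ((Finsupp.le_degree a β).trans hβ.le)
  have key : ∑ f ∈ Fintype.piFinset fun _ : σ => Finset.range N,
      hval d (fun a => (r : ℂ) * ζ ^ f a) H * ∏ a, (ζ ^ f a) ^ (N - α a) =
      MvPowerSeries.coeff α H * r ^ d * N ^ Fintype.card σ := by
    have h1 : ∀ f : σ → ℕ, hval d (fun a => (r : ℂ) * ζ ^ f a) H * ∏ a, (ζ ^ f a) ^ (N - α a) =
        ∑ β ∈ degFin σ d, MvPowerSeries.coeff β H * r ^ d *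
          ∏ a, ((ζ ^ f a) ^ β a * (ζ ^ f a) ^ (N - α a)) := by
      intro f
      rw [show (fun a => (r : ℂ) * ζ ^ f a) = (r : ℂ) • fun a => ζ ^ f a from rfl, hval_smul,
        hval_eq_sum, Finset.mul_sum, Finset.sum_mul]
      refine Finset.sum_congr rfl fun β _ => ?_
      rw [Finset.prod_mul_distrib]
      ring
    simp_rw [h1]
    rw [Finset.sum_comm]
    simp_rw [← Finset.mul_sum]
    have h2 : ∀ β ∈ degFin σ d, ∑ f ∈ Fintype.piFinset fun _ : σ => Finset.range N,
        ∏ a, ((ζ ^ f a) ^ β a * (ζ ^ f a) ^ (N - α a)) =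
        if β = α then (N : ℂ) ^ Fintype.card σ else 0 := by
      intro β hβ
      rw [← Finset.prod_univ_sum (fun _ : σ => Finset.range N)
        (fun a j => (ζ ^ j) ^ β a * (ζ ^ j) ^ (N - α a))]
      simp_rw [fun a => sum_rootsOfUnity hζ (hlt α hα a) (hlt β (mem_degFin.1 hβ) a)]
      split_ifs with h
      · simp [h]
      · obtain ⟨a, ha⟩ := DFunLike.ne_iff.1 h
        exact Finset.prod_eq_zero (Finset.mem_univ a) (if_neg ha)
    rw [Finset.sum_congr rfl fun β hβ => by rw [h2 β hβ], Finset.sum_eq_single α]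
    · simp
    · intro β _ hβ
      simp [hβ]
    · intro h
      exact absurd (mem_degFin.2 hα) h
  have hNpos : (0 : ℝ) < (N : ℝ) ^ Fintype.card σ := by positivity
  have h3 : ‖MvPowerSeries.coeff α H‖ * r ^ d * (N : ℝ) ^ Fintype.card σ ≤
      B * (N : ℝ) ^ Fintype.card σ := by
    have := congrArg norm key
    rw [norm_mul, norm_mul, norm_pow, norm_pow, Complex.norm_natCast, Complex.norm_real,
      Real.norm_of_nonneg hr] at this
    rw [← this]
    refine (norm_sum_le _ _).trans ((Finset.sum_le_card_nsmul _ _ B fun f _ => ?_).trans_eq ?_)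
    · rw [norm_mul, norm_prod]
      simp_rw [norm_pow, hζ1, one_pow, Finset.prod_const_one, mul_one]
      refine hB _ fun a => ?_
      rw [norm_mul, norm_pow, hζ1, one_pow, mul_one, Complex.norm_real, Real.norm_of_nonneg hr]
    · simp [Fintype.card_piFinset, mul_comm]
  exact le_of_mul_le_mul_right h3 hNpos

/-- Homogeneity and the maximum principle move a bound on a ball to a ball about the origin. -/
theorem norm_hval_le_of_ball {H : MvPowerSeries σ ℂ} {d : ℕ} {v₀ : σ → ℂ} {ε B : ℝ}
    (hB : ∀ v ∈ Metric.ball v₀ ε, ‖hval d v H‖ ≤ B) {x : σ → ℂ} (hx : ‖x‖ < ε) :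
    ‖hval d x H‖ ≤ B := by
  have hd : Differentiable ℂ fun w : ℂ => hval d (w • v₀ + x) H :=
    (differentiable_hval d H).comp (by fun_prop)
  have h0 := Complex.norm_le_of_forall_mem_frontier_norm_le (U := Metric.ball (0 : ℂ) 1)
    (f := fun w : ℂ => hval d (w • v₀ + x) H) Metric.isBounded_ball hd.diffContOnCl (C := B)
    (fun w hw => ?_) (z := 0) (subset_closure (by simp))
  · simpa using h0
  · rw [frontier_ball _ one_ne_zero, mem_sphere_zero_iff_norm] at hw
    have hw0 : w ≠ 0 := fun h => by simp [h] at hw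
    have h1 : w • v₀ + x = w • (v₀ + w⁻¹ • x) := by rw [smul_add, smul_inv_smul₀ hw0]
    change ‖hval d (w • v₀ + x) H‖ ≤ B
    rw [h1, hval_smul, norm_mul, norm_pow, hw, one_pow, one_mul]
    refine hB _ ?_
    rw [mem_ball_iff_norm, add_sub_cancel_left, norm_smul, norm_inv, hw, inv_one, one_mul]
    exact hx

/-- Geometric growth along an open set of lines implies convergence. -/
theorem cvg_of_growth {H : MvPowerSeries σ ℂ} {V : Set (σ → ℂ)} (hV : IsOpen V)
    (hVne : V.Nonempty) (h : ∀ v ∈ V, ∃ K : ℝ, ∀ d, ‖hval d v H‖ ≤ K ^ (d + 1)) : Cvg H := by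
  set A : ℕ → Set (σ → ℂ) := fun k => {v | ∀ d, ‖hval d v H‖ ≤ (k : ℝ) ^ (d + 1)} ∪ Vᶜ with hA
  have hclosed : ∀ k, IsClosed (A k) := fun k => by
    refine IsClosed.union ?_ hV.isClosed_compl
    rw [Set.ofPred_forall]
    exact isClosed_iInter fun d => isClosed_le (continuous_hval d H).norm continuous_const
  have hun : ⋃ k, A k = Set.univ := by
    refine Set.eq_univ_of_forall fun v => Set.mem_iUnion.2 ?_
    by_cases hv : v ∈ V
    · obtain ⟨K, hK⟩ := h v hv
      obtain ⟨k, hk⟩ := exists_nat_ge |K|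
      refine ⟨k, Or.inl fun d => (hK d).trans ?_⟩
      exact (le_abs_self _).trans (by rw [abs_pow]; gcongr)
    · exact ⟨0, Or.inr hv⟩
  obtain ⟨v₀, hv₀V, hv₀⟩ := (dense_iUnion_interior_of_closed hclosed hun).inter_open_nonempty V hV hVne
  obtain ⟨k, hk⟩ := Set.mem_iUnion.1 hv₀
  obtain ⟨ε, hε, hball⟩ := Metric.isOpen_iff.1 (isOpen_interior.inter hV) v₀ ⟨hk, hv₀V⟩
  have hb : ∀ d, ∀ v ∈ Metric.ball v₀ ε, ‖hval d v H‖ ≤ (k : ℝ) ^ (d + 1) := fun d v hv =>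
    (interior_subset (hball hv).1).elim (fun h => h d) fun h => absurd (hball hv).2 h
  set K : ℝ := k + 1
  have hK : 0 < K := by positivity
  have hcoeff : ∀ α : σ →₀ ℕ,
      ‖MvPowerSeries.coeff α H‖ * (ε / 2) ^ α.degree ≤ K ^ (α.degree + 1) := fun α => by
    refine norm_coeff_mul_pow_le (by positivity) (fun x hx => ?_) rfl
    refine (norm_hval_le_of_ball (hb _) (x := x) ?_).trans (by gcongr; simp [K])
    exact ((pi_norm_le_iff_of_nonneg (by positivity)).2 hx).trans_lt (by linarith)
  refine ⟨ε / (4 * K), by positivity, ?_⟩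
  refine Summable.of_nonneg_of_le (fun α => by positivity) (fun α => ?_)
    ((summable_pow_degree (σ := σ) (r := 1 / 2) (by norm_num) (by norm_num)).mul_left K)
  have h1 : ε / (4 * K) = ε / 2 * (1 / 2) * K⁻¹ := by field_simp; norm_num
  calc ‖MvPowerSeries.coeff α H‖ * (ε / (4 * K)) ^ α.degree
      = ‖MvPowerSeries.coeff α H‖ * (ε / 2) ^ α.degree * ((1 / 2) ^ α.degree * K⁻¹ ^ α.degree) := by
        rw [h1, mul_pow, mul_pow]; ring
    _ ≤ K ^ (α.degree + 1) * ((1 / 2) ^ α.degree * K⁻¹ ^ α.degree) := by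
        gcongr
        exact hcoeff α
    _ = K * (1 / 2) ^ α.degree * (K * K⁻¹) ^ α.degree := by rw [mul_pow]; ring
    _ = K * (1 / 2) ^ α.degree := by rw [mul_inv_cancel₀ hK.ne', one_pow, mul_one]

end Bounds

section Projection
variable {σ : Type*} [Fintype σ] {E : Derivation ℂ (MvPowerSeries σ ℂ) (MvPowerSeries σ ℂ)}

open Classical in
/-- The spectral projection onto an integral weight. -/
def proj (hE : Filtered E) (χ : ℂ →+ ℂ) (j : ℤ) : MvPowerSeries σ ℂ →ₗ[ℂ] MvPowerSeries σ ℂ :=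
  fcalc hE fun μ => if χ μ = j then 1 else 0

theorem hval_proj (hE : Filtered E) {χ : ℂ →+ ℂ} (hχ : IntegralAt E χ 2) (j : ℤ) (d : ℕ)
    (v : σ → ℂ) (g : MvPowerSeries σ ℂ) :
    2 * Real.pi * hval d v (proj hE χ j g) =
      ∫ s in (0 : ℝ)..2 * Real.pi, Complex.exp (-(Complex.I * s * j)) * hval d v (tor hE χ s g) := by
  classical
  have hInt : ∀ g : MvPowerSeries σ ℂ, IntervalIntegrable (fun s : ℝ =>
      Complex.exp (-(Complex.I * s * j)) * hval d v (tor hE χ s g)) MeasureTheory.volume 0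
      (2 * Real.pi) := fun g => by
    refine Continuous.intervalIntegrable ?_ _ _
    exact (by fun_prop : Continuous fun s : ℝ => Complex.exp (-(Complex.I * s * j))).mul
      ((differentiable_hval_tor hE χ v d g).continuous.comp Complex.continuous_ofReal)
  induction g using ge_induction hE (d + 1) with
  | h2 g h ihg ihh =>
    simp_rw [map_add, mul_add]
    rw [intervalIntegral.integral_add (hInt g) (hInt h), ← ihg, ← ihh]
  | h1 μ g hg =>
    by_cases hgd : g ∈ ordGE σ (d + 1)
    · have h1 : ∀ s : ℝ, hval d v (tor hE χ s g) = 0 := fun s =>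
        hval_eq_zero (Nat.lt_succ_self d) v (tor_mem hE χ s hgd)
      simp_rw [h1, mul_zero, intervalIntegral.integral_zero]
      rw [proj, hval_eq_zero (Nat.lt_succ_self d) v (fcalc_mem hE _ hgd), mul_zero]
    have hspec : ∀ c : ℂ → ℂ, hval d v (fcalc hE c g) = c μ * hval d v g := fun c => by
      have := hval_eq_zero (Nat.lt_succ_self d) v (fcalc_spec hE c hg)
      rwa [map_sub, map_smul, sub_eq_zero, smul_eq_mul] at this
    obtain ⟨k, hk⟩ := hχ.all hE (d + 1) μ g hg hgd
    simp_rw [proj, tor_apply, hspec, chr, hk, ← mul_assoc, ← Complex.exp_add]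
    rw [intervalIntegral.integral_mul_const]
    congr 1
    have h2 : ∀ s : ℝ, Complex.exp (-(Complex.I * s * j) + Complex.I * s * k) =
        Complex.exp (Complex.I * (k - j : ℤ) * s) := fun s => by
      congr 1
      push_cast
      ring
    simp_rw [h2]
    by_cases hkj : k = j
    · subst hkj
      simp
    · have hne : Complex.I * ((k - j : ℤ) : ℂ) ≠ 0 :=
        mul_ne_zero Complex.I_ne_zero (by exact_mod_cast sub_ne_zero.2 hkj)
      rw [integral_exp_mul_complex hne, if_neg (by exact_mod_cast hkj), mul_zero]
      have h3 : Complex.exp (Complex.I * ((k - j : ℤ) : ℂ) * ((2 * Real.pi : ℝ) : ℂ)) = 1 := by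
        rw [Complex.exp_eq_one_iff]
        exact ⟨k - j, by push_cast; ring⟩
      rw [h3]
      simp

theorem norm_hval_proj_le (hE : Filtered E) {χ : ℂ →+ ℂ} (hχ : IntegralAt E χ 2) (j : ℤ) (d : ℕ)
    (v : σ → ℂ) (g : MvPowerSeries σ ℂ) {B : ℝ}
    (hB : ∀ s ∈ Set.Icc (0 : ℝ) (2 * Real.pi), ‖hval d v (tor hE χ s g)‖ ≤ B) :
    ‖hval d v (proj hE χ j g)‖ ≤ B := by
  have h1 := congrArg norm (hval_proj hE hχ j d v g)
  have hpi : 0 < 2 * Real.pi := by positivity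
  have h2 := intervalIntegral.norm_integral_le_of_norm_le_const (a := 0) (b := 2 * Real.pi)
    (f := fun s : ℝ => Complex.exp (-(Complex.I * s * j)) * hval d v (tor hE χ s g)) (C := B)
    fun s hs => by
      rw [Set.uIoc_of_le hpi.le] at hs
      have : ‖Complex.exp (-(Complex.I * s * j))‖ = 1 := by
        rw [show -(Complex.I * s * j) = ((-(s * j) : ℝ) : ℂ) * Complex.I by push_cast; ring,
          Complex.norm_exp_ofReal_mul_I]
      rw [norm_mul, this, one_mul]
      exact hB s ⟨hs.1.le, hs.2⟩
  rw [← h1, norm_mul, sub_zero, abs_of_pos hpi, mul_comm B] at h2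
  have h3 : ‖(2 * Real.pi : ℂ)‖ = 2 * Real.pi := by
    rw [norm_mul, Complex.norm_real, Real.norm_of_nonneg Real.pi_pos.le]; simp
  rw [h3] at h2
  exact le_of_mul_le_mul_left h2 hpi

end Projection

section System
variable {σ ι κ : Type*} [Fintype σ] [Fintype ι] [Fintype κ] [DecidableEq ι] [DecidableEq κ]
  [DecidableEq σ] {Xf : ι → σ → MvPowerSeries σ ℂ} {F : κ → MvPowerSeries σ ℂ} {i₀ : ι}

theorem exists_mem_ordGE_notMem {g : MvPowerSeries σ ℂ} (hg : g ≠ 0) :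
    ∃ d, g ∈ ordGE σ d ∧ g ∉ ordGE σ (d + 1) := by
  classical
  have h : ∃ d, g ∉ ordGE σ d := by
    by_contra! h
    exact hg (eq_zero_of_forall_mem_ordGE h)
  have h0 : Nat.find h ≠ 0 := fun h0 => by
    have := Nat.find_spec h
    rw [h0] at this
    exact this (mem_ordGE_zero g)
  obtain ⟨d, hd⟩ := Nat.exists_eq_succ_of_ne_zero h0
  refine ⟨d, ?_, by simpa only [hd] using Nat.find_spec h⟩
  by_contra hc
  have := Nat.find_min' h hc
  omega

theorem FormalSystem.cvg_proj (h : FormalSystem Xf F i₀) (Cm : Matrix σ κ ℂ) (e : ι ⊕ κ ≃ σ)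
    (hd1 : ((frame Xf Cm).submatrix id e.symm).det ≠ 0) (hd2 : (jacC F Cm).det ≠ 0)
    {χ : ℂ →+ ℂ} (hχ : IntegralAt (vf (Xf i₀)) χ 2) (j : ℤ)
    {g : MvPowerSeries σ ℂ} (hg : Cvg g) : Cvg (proj h.filtered χ j g) := by
  obtain ⟨k, hk, hk'⟩ := exists_mem_ordGE_notMem hd1
  obtain ⟨l, hl, hl'⟩ := exists_mem_ordGE_notMem hd2
  set D1 := ((frame Xf Cm).submatrix id e.symm).det
  set D2 := (jacC F Cm).det
  have hprod : D1 * D2 ∉ ordGE σ (k + l + 1) := fun hmem => by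
    obtain ⟨V, hV, hVne, hV'⟩ := exists_isOpen_hval_tor_ne_zero h.filtered hχ hk hk'
    have hz : ∀ v ∈ V, hval l v D2 = 0 := fun v hv => by
      have h1 := hval_mul hk hl v
      rw [hval_eq_zero (Nat.lt_succ_self _) v hmem] at h1
      have h2 := hV' v hv 0
      rw [Complex.ofReal_zero, tor_zero] at h2
      exact (mul_eq_zero.1 h1.symm).resolve_left h2
    obtain ⟨w, hw⟩ := exists_hval_ne_zero hl hl'
    obtain ⟨v, hv⟩ := hVne
    have han : AnalyticOnNhd ℂ (fun v => hval l v D2) Set.univ := fun v _ => by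
      simp_rw [hval_eq_sum]
      exact Finset.analyticAt_fun_sum _ fun α _ => analyticAt_const.mul
        (Finset.analyticAt_fun_prod _ fun a _ =>
          ((ContinuousLinearMap.proj (R := ℂ) (φ := fun _ : σ => ℂ) a).analyticAt v).pow _)
    exact hw (han.eqOn_zero_of_preconnected_of_eventuallyEq_zero isPreconnected_univ
      (Set.mem_univ v) (eventually_of_mem (hV.mem_nhds hv) hz) (Set.mem_univ w))
  obtain ⟨V, hV, hVne, hV'⟩ :=
    exists_isOpen_hval_tor_ne_zero h.filtered hχ (mul_mem_ordGE hk hl) hprod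
  refine cvg_of_growth hV hVne fun v hv => ?_
  have hsplit : ∀ s : ℝ, hval k v (tor h.filtered χ s D1) ≠ 0 ∧
      hval l v (tor h.filtered χ s D2) ≠ 0 := fun s => by
    have h1 := hV' v hv s
    rw [map_mul, hval_mul (tor_mem _ χ s hk) (tor_mem _ χ s hl)] at h1
    exact ⟨left_ne_zero_of_mul h1, right_ne_zero_of_mul h1⟩
  obtain ⟨K, -, hK⟩ := growth_tor h Cm e hχ hk hl (fun s => (hsplit s).1) (fun s => (hsplit s).2) hg
  exact ⟨K, fun d => norm_hval_proj_le h.filtered hχ j d v g (hK d)⟩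

end System

theorem exists_integral_coordinates {Λ : Set ℂ} (hΛ : Λ.Finite) :
    ∃ (r : ℕ) (h : Fin r → ℂ →+ ℂ) (ρ : Fin r → ℂ),
      (∀ k, ∀ μ ∈ Λ, ∃ z : ℤ, h k μ = z) ∧ ∀ μ ∈ Λ, ∑ k, ρ k * h k μ = μ := by
  classical
  have hfin : Module.Finite ℚ (Submodule.span ℚ Λ) := Module.Finite.span_of_finite ℚ hΛ
  set b := Module.finBasis ℚ (Submodule.span ℚ Λ)
  have hext : ∀ k, ∃ g : ℂ →ₗ[ℚ] ℚ, g ∘ₗ (Submodule.span ℚ Λ).subtype = b.coord k := fun k =>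
    LinearMap.exists_extend (b.coord k)
  choose c hc using hext
  set D : ℕ := ∏ μ ∈ hΛ.toFinset, ∏ k, (c k μ).den with hD
  have hD0 : (D : ℂ) ≠ 0 := by
    rw [hD]
    exact_mod_cast Finset.prod_ne_zero_iff.2 fun μ _ =>
      Finset.prod_ne_zero_iff.2 fun k _ => (c k μ).den_nz
  have hc' : ∀ k, ∀ (x : Submodule.span ℚ Λ), c k x = b.coord k x := fun k x =>
    LinearMap.congr_fun (hc k) x
  refine ⟨_, fun k => (AddMonoidHom.mulLeft (D : ℂ)).comp
    ((Rat.castHom ℂ).toAddMonoidHom.comp (c k).toAddMonoidHom), fun k => (b k : ℂ) / D, ?_, ?_⟩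
  · intro k μ hμ
    obtain ⟨E, hE⟩ : (c k μ).den ∣ D :=
      (Finset.dvd_prod_of_mem _ (Finset.mem_univ k)).trans
        (Finset.dvd_prod_of_mem (fun μ => ∏ k, (c k μ).den) (hΛ.mem_toFinset.2 hμ))
    refine ⟨(c k μ).num * E, ?_⟩
    change (D : ℂ) * ((c k μ : ℚ) : ℂ) = _
    have h1 : (D : ℚ) * c k μ = (c k μ).num * E := by
      rw [hE]
      push_cast
      rw [mul_right_comm, Rat.den_mul_eq_num]
    exact_mod_cast congrArg (Rat.cast : ℚ → ℂ) h1
  · intro μ hμ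
    have h1 := congrArg (Submodule.subtype _) (b.sum_repr ⟨μ, Submodule.subset_span hμ⟩)
    rw [map_sum] at h1
    refine Eq.trans (Finset.sum_congr rfl fun k _ => ?_) h1
    change (b k : ℂ) / D * (D * ((c k μ : ℚ) : ℂ)) = _
    rw [hc' k ⟨μ, Submodule.subset_span hμ⟩, ← mul_assoc, div_mul_cancel₀ _ hD0]
    simp [Algebra.smul_def, mul_comm]

theorem exists_generalized_eigenbasis {σ : Type*} [Fintype σ]
    (f : Module.End ℂ (σ → ℂ)) : ∃ (b : Module.Basis σ ℂ (σ → ℂ)) (lam : σ → ℂ),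
      ∀ i, b i ∈ f.maxGenEigenspace (lam i) := by
  obtain ⟨s, hs, hspan, hli⟩ := exists_linearIndependent ℂ
    (⋃ μ, (f.maxGenEigenspace μ : Set (σ → ℂ)))
  have htop : Submodule.span ℂ s = ⊤ := by
    rw [hspan, Submodule.span_iUnion]
    simp_rw [Submodule.span_eq]
    exact f.iSup_maxGenEigenspace_eq_top
  set b₀ := Module.Basis.mk hli (by rw [Subtype.range_coe, htop])
  set b := b₀.reindex (b₀.indexEquiv (Pi.basisFun ℂ σ))
  have h : ∀ i, ∃ μ, b i ∈ f.maxGenEigenspace μ := fun i => by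
    rw [Module.Basis.reindex_apply, Module.Basis.mk_apply]
    exact Set.mem_iUnion.1 (hs (Subtype.coe_prop _))
  choose lam hlam using h
  exact ⟨b, lam, hlam⟩

section Lin
variable {σ : Type*} [Fintype σ]

/-- The linear part of a power series. -/
def lin (σ : Type*) : MvPowerSeries σ ℂ →ₗ[ℂ] (σ → ℂ) :=
  LinearMap.pi fun a => MvPowerSeries.coeff (Finsupp.single a 1)

theorem lin_apply (g : MvPowerSeries σ ℂ) (a : σ) :
    lin σ g a = MvPowerSeries.coeff (Finsupp.single a 1) g := rfl

theorem lin_eq_zero {g : MvPowerSeries σ ℂ} (hg : g ∈ ordGE σ 2) : lin σ g = 0 :=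
  funext fun a => hg _ (by simp)

theorem eq_single_of_degree_eq_one {α : σ →₀ ℕ} (hα : α.degree = 1) :
    ∃ a, α = Finsupp.single a 1 := by
  obtain ⟨a, ha⟩ : ∃ a, α a ≠ 0 := by
    by_contra! h
    rw [Finsupp.ext (g := 0) h] at hα
    simp at hα
  have hle : Finsupp.single a 1 ≤ α := by
    rw [Finsupp.single_le_iff]
    omega
  refine ⟨a, ?_⟩
  have h1 := tsub_add_cancel_of_le hle
  have h2 := congrArg Finsupp.degree h1
  rw [map_add, Finsupp.degree_single, hα] at h2
  have h3 : α - Finsupp.single a 1 = 0 := (Finsupp.degree_eq_zero_iff _).1 (by omega)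
  rw [← h1, h3, zero_add]

theorem mem_ordGE_two {g : MvPowerSeries σ ℂ} (hg : g ∈ ordGE σ 1) (h : lin σ g = 0) :
    g ∈ ordGE σ 2 := by
  intro α hα
  rcases Nat.lt_succ_iff_lt_or_eq.1 hα with hα | hα
  · exact hg α hα
  · obtain ⟨a, rfl⟩ := eq_single_of_degree_eq_one hα
    exact congrFun h a

/-- The linear form with given coefficients, as a power series. -/
def linForm (u : σ → ℂ) : MvPowerSeries σ ℂ := ∑ a, u a • MvPowerSeries.X a

theorem linForm_mem (u : σ → ℂ) : linForm u ∈ ordGE σ 1 :=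
  Submodule.sum_mem _ fun a _ => Submodule.smul_mem _ _ (X_mem_ordGE a)

theorem lin_linForm (u : σ → ℂ) : lin σ (linForm u) = u := by
  classical
  ext b
  rw [lin_apply, linForm, map_sum]
  simp [MvPowerSeries.coeff_X, Finsupp.single_left_inj]

theorem cvg_linForm (u : σ → ℂ) : Cvg (linForm u) := by
  classical
  refine ⟨1, one_pos, summable_of_ne_finset_zero (s := degFin σ 1) fun α hα => ?_⟩
  rw [mem_degFin] at hα
  rw [linForm, map_sum, Finset.sum_eq_zero, norm_zero, zero_mul]
  intro a _
  rw [map_smul, MvPowerSeries.coeff_X, if_neg, smul_zero]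
  rintro rfl
  simp at hα

/-- The matrix of linear parts. -/
def linMat (Y : σ → MvPowerSeries σ ℂ) : Matrix σ σ ℂ := fun a b =>
  MvPowerSeries.coeff (Finsupp.single b 1) (Y a)

theorem coeff_single_mul {Y g : MvPowerSeries σ ℂ} (hY : Y ∈ ordGE σ 1) (b : σ) :
    MvPowerSeries.coeff (Finsupp.single b 1) (Y * g) =
      MvPowerSeries.coeff (Finsupp.single b 1) Y * MvPowerSeries.constantCoeff g := by
  have h : Y * (g - MvPowerSeries.C (MvPowerSeries.constantCoeff g)) ∈ ordGE σ (1 + 1) := by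
    refine mul_mem_ordGE hY fun α hα => ?_
    have : α = 0 := by rwa [Nat.lt_one_iff, Finsupp.degree_eq_zero_iff] at hα
    subst this
    simp
  have := h (Finsupp.single b 1) (by simp)
  rw [mul_sub, map_sub, sub_eq_zero, MvPowerSeries.coeff_mul_C] at this
  exact this

theorem lin_vf [DecidableEq σ] {Y : σ → MvPowerSeries σ ℂ} (hY : ∀ a, Y a ∈ ordGE σ 1)
    (g : MvPowerSeries σ ℂ) : lin σ (vf Y g) = lin σ g ᵥ* linMat Y := by
  ext b
  rw [lin_apply, vf_apply, map_sum, Matrix.vecMul, dotProduct]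
  refine Finset.sum_congr rfl fun a _ => ?_
  rw [coeff_single_mul (hY a), ← MvPowerSeries.coeff_zero_eq_constantCoeff_apply,
    MvPowerSeries.coeff_pderiv, mul_comm]
  simp [lin_apply, linMat]

theorem lin_shift_pow [DecidableEq σ] {Y : σ → MvPowerSeries σ ℂ} (hY : ∀ a, Y a ∈ ordGE σ 1)
    (μ : ℂ) (k : ℕ) (g : MvPowerSeries σ ℂ) :
    lin σ ((shift (vf Y) μ ^ k) g) = lin σ g ᵥ* (linMat Y - μ • 1) ^ k := by
  induction k generalizing g with
  | zero => simp
  | succ k ih =>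
    rw [pow_succ, Module.End.mul_apply, ih, shift_apply, map_sub, lin_vf hY, map_smul, pow_succ',
      ← Matrix.vecMul_vecMul, Matrix.vecMul_sub, Matrix.vecMul_smul, Matrix.vecMul_one]

end Lin

section Normalization
variable {σ ι κ : Type*} [Fintype σ] [Fintype ι] [Fintype κ] [DecidableEq ι] [DecidableEq κ]
  [DecidableEq σ] {Xf : ι → σ → MvPowerSeries σ ℂ} {F : κ → MvPowerSeries σ ℂ} {i₀ : ι}

theorem finite_weights {E : Derivation ℂ (MvPowerSeries σ ℂ) (MvPowerSeries σ ℂ)}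
    (hE : Filtered E) (d : ℕ) : {μ | ∃ g, IsGE E d μ g ∧ g ∉ ordGE σ d}.Finite := by
  refine (Module.End.finite_hasEigenvalue (quotMap hE d)).subset ?_
  rintro μ ⟨g, hg, hgd⟩
  rw [← mkQ_mem_iff hE] at hg
  have h1 : (quotMap hE d).HasUnifEigenvalue μ ⊤ := fun h1 => by
    rw [Module.End.maxGenEigenspace, h1, Submodule.mem_bot] at hg
    exact hgd (by simpa using hg)
  exact h1.lt zero_lt_one

theorem fcalc_const {E : Derivation ℂ (MvPowerSeries σ ℂ) (MvPowerSeries σ ℂ)}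
    (hE : Filtered E) (c : ℂ) (g : MvPowerSeries σ ℂ) : fcalc hE (fun _ => c) g = c • g := by
  have : fcalc hE (fun _ => c) - c • LinearMap.id = 0 :=
    linearMap_ext hE (e := 0) fun d μ g hg => by simpa using fcalc_spec hE (fun _ => c) hg
  simpa [sub_eq_zero] using LinearMap.congr_fun this g

/-- Convergent linearizing coordinates of the semisimple part of an integrable system. -/
theorem FormalSystem.exists_normalization (h : FormalSystem Xf F i₀) (Cm : Matrix σ κ ℂ)
    (e : ι ⊕ κ ≃ σ) (hd1 : ((frame Xf Cm).submatrix id e.symm).det ≠ 0)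
    (hd2 : (jacC F Cm).det ≠ 0) :
    ∃ (lam : σ → ℂ) (ζ w : σ → MvPowerSeries σ ℂ), (∀ i, Cvg (ζ i)) ∧ (∀ i, ζ i ∈ ordGE σ 1) ∧
      IsUnit (linMat ζ) ∧ (∀ i, vf w (ζ i) = lam i • ζ i) ∧
      (∀ i, vf w (vf (Xf i₀) (ζ i)) = lam i • vf (Xf i₀) (ζ i)) ∧
      ∃ k, ∀ i, linMat ζ i ᵥ* (linMat (Xf i₀) - lam i • 1) ^ k = 0 := by
  classical
  set E := vf (Xf i₀) with hEdef
  have hE : Filtered E := h.filtered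
  set A := linMat (Xf i₀) with hA
  obtain ⟨b, lam, hb⟩ := exists_generalized_eigenbasis (Matrix.vecMulLinear A : Module.End ℂ (σ → ℂ))
  have hpow : ∀ (μ : ℂ) (k : ℕ) (u : σ → ℂ),
      ((Matrix.vecMulLinear A - algebraMap ℂ (Module.End ℂ (σ → ℂ)) μ) ^ k) u =
        u ᵥ* (A - μ • 1) ^ k := by
    intro μ k
    induction k with
    | zero => simp
    | succ k ih =>
      intro u
      rw [pow_succ, Module.End.mul_apply, ih, pow_succ', ← Matrix.vecMul_vecMul, Matrix.vecMul_sub,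
        Matrix.vecMul_smul, Matrix.vecMul_one]
      simp
  have hk : ∀ i, ∃ k, b i ᵥ* (A - lam i • 1) ^ k = 0 := fun i => by
    obtain ⟨k, hk⟩ := (Module.End.mem_maxGenEigenspace _ _ _).1 (hb i)
    exact ⟨k, by rw [← hpow]; exact hk⟩
  choose k hk using hk
  have hIsGE : ∀ i, IsGE E 2 (lam i) (linForm (b i)) := fun i => by
    refine ⟨k i, mem_ordGE_two ?_ ?_⟩
    · exact shift_pow_mem hE _ _ _ (linForm_mem _)
    · rw [hEdef, lin_shift_pow h.vanish, lin_linForm, hk i]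
  set Λ := {μ | ∃ g, IsGE E 2 μ g ∧ g ∉ ordGE σ 2} with hΛ
  obtain ⟨r, hh, ρ, hInt, hsum⟩ := exists_integral_coordinates (finite_weights hE 2)
  have hmem : ∀ i, lam i ∈ Λ := fun i => ⟨_, hIsGE i, fun h2 => by
    have := lin_eq_zero h2
    rw [lin_linForm] at this
    exact b.ne_zero i this⟩
  have hintegral : ∀ q, IntegralAt E (hh q) 2 := fun q μ g hg hg2 => hInt q μ ⟨g, hg, hg2⟩
  set c : σ → Finset (Fin r) → ℂ → ℂ := fun i s μ =>
    ∏ q ∈ s, if hh q μ = hh q (lam i) then 1 else 0 with hcdef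
  have hcvg : ∀ i s, Cvg (fcalc hE (c i s) (linForm (b i))) := by
    intro i s
    induction s using Finset.induction_on with
    | empty =>
      simp only [hcdef, Finset.prod_empty]
      rw [fcalc_one]
      exact cvg_linForm _
    | insert q s hq ih =>
      obtain ⟨z, hz⟩ := hInt q _ (hmem i)
      have h1 : c i (insert q s) = fun μ => (if hh q μ = z then 1 else 0) * c i s μ := by
        ext μ
        simp only [hcdef]
        rw [Finset.prod_insert hq, hz]
      rw [h1, ← fcalc_fcalc hE (fun μ => if hh q μ = z then 1 else 0)]
      have := h.cvg_proj Cm e hd1 hd2 (hintegral q) z ih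
      simpa only [proj] using this
  set ζ : σ → MvPowerSeries σ ℂ := fun i => fcalc hE (c i Finset.univ) (linForm (b i)) with hζ
  have hζ2 : ∀ i, ζ i - linForm (b i) ∈ ordGE σ 2 := fun i => by
    have := fcalc_spec hE (c i Finset.univ) (hIsGE i)
    have h1 : c i Finset.univ (lam i) = 1 := Finset.prod_eq_one fun q _ => if_pos rfl
    rwa [h1, one_smul] at this
  have hlinζ : ∀ i, linMat ζ i = b i := fun i => by
    have := lin_eq_zero (hζ2 i)
    rwa [map_sub, lin_linForm, sub_eq_zero] at this
  set χ : ℂ → ℂ := fun μ => ∑ q, ρ q * hh q μ with hχ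
  have hχadd : ∀ μ ν, χ (μ + ν) = χ μ + χ ν := fun μ ν => by
    simp only [hχ, map_add, mul_add, Finset.sum_add_distrib]
  set W := fcalcDer hE hχadd
  have hWapp : ∀ g, W g = fcalc hE χ g := fun g => rfl
  have hW : W = vf fun a => W (MvPowerSeries.X a) :=
    eq_vf W fun d g hg => fcalc_mem hE _ (ordGE_anti d.le_succ hg)
  have hWζ : ∀ i, W (ζ i) = lam i • ζ i := fun i => by
    rw [hWapp, hζ]
    simp only
    rw [fcalc_fcalc, ← fcalc_const hE (lam i), fcalc_fcalc]
    congr 2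
    ext μ
    by_cases hc : ∀ q, hh q μ = hh q (lam i)
    · have : χ μ = lam i := by
        rw [← hsum _ (hmem i)]
        simp only [hχ, hc]
      rw [this]
    · push Not at hc
      obtain ⟨q, hq⟩ := hc
      have : c i Finset.univ μ = 0 := Finset.prod_eq_zero (Finset.mem_univ q) (if_neg hq)
      rw [this, mul_zero, mul_zero]
  refine ⟨lam, ζ, fun a => W (MvPowerSeries.X a), fun i => hcvg i _, fun i => ?_, ?_, fun i => ?_,
    fun i => ?_, ∑ i, k i, fun i => ?_⟩
  · exact fcalc_mem hE _ (linForm_mem _)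
  · have h1 : linMat ζ = fun i => b i := funext hlinζ
    rw [h1]
    exact Matrix.linearIndependent_rows_iff_isUnit.1 b.linearIndependent
  · rw [← hW]
    exact hWζ i
  · rw [← hW]
    have := fcalc_comm hE χ (Y := E.toLinearMap) (fun _ => rfl)
      (fun d g hg => ordGE_anti d.le_succ (hE _ _ hg)) (ζ i)
    exact this.trans ((congrArg E (hWζ i)).trans (E.map_smul _ _))
  · rw [hlinζ, ← Finset.add_sum_erase _ k (Finset.mem_univ i), pow_add, ← Matrix.vecMul_vecMul, hk i,
      Matrix.zero_vecMul]

end Normalization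

section SumAt
variable {σ : Type*} [Fintype σ]

/-- The sum of a power series at a point. -/
def sumAt (G : MvPowerSeries σ ℂ) (x : σ → ℂ) : ℂ :=
  ∑' α, MvPowerSeries.coeff α G * ∏ a, x a ^ α a

theorem norm_prod_pow_le (x : σ → ℂ) (α : σ →₀ ℕ) : ‖∏ a, x a ^ α a‖ ≤ ‖x‖ ^ α.degree := by
  rw [norm_prod, Finsupp.degree_eq_sum, ← Finset.prod_pow_eq_pow_sum]
  refine Finset.prod_le_prod (fun a _ => norm_nonneg _) fun a _ => ?_
  rw [norm_pow]
  exact pow_le_pow_left₀ (norm_nonneg _) (norm_le_pi_norm x a) _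

theorem norm_term_le (G : MvPowerSeries σ ℂ) {x : σ → ℂ} {ρ : ℝ} (hx : ‖x‖ ≤ ρ) (α : σ →₀ ℕ) :
    ‖MvPowerSeries.coeff α G * ∏ a, x a ^ α a‖ ≤ ‖MvPowerSeries.coeff α G‖ * ρ ^ α.degree := by
  rw [norm_mul]
  gcongr
  exact (norm_prod_pow_le x α).trans (by gcongr)

theorem summable_norm_term {G : MvPowerSeries σ ℂ} {ρ : ℝ}
    (hG : Summable fun α => ‖MvPowerSeries.coeff α G‖ * ρ ^ α.degree) {x : σ → ℂ} (hx : ‖x‖ ≤ ρ) :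
    Summable fun α => ‖MvPowerSeries.coeff α G * ∏ a, x a ^ α a‖ :=
  Summable.of_nonneg_of_le (fun _ => norm_nonneg _) (norm_term_le G hx) hG

theorem Cvg.eventually_summable {G : MvPowerSeries σ ℂ} (hG : Cvg G) :
    ∀ᶠ x : σ → ℂ in 𝓝 0, Summable fun α => ‖MvPowerSeries.coeff α G * ∏ a, x a ^ α a‖ := by
  obtain ⟨ρ, hρ, h⟩ := hG
  filter_upwards [Metric.closedBall_mem_nhds (0 : σ → ℂ) hρ] with x hx
  exact summable_norm_term h (by simpa using hx)

theorem hasSum_hval {G : MvPowerSeries σ ℂ} {x : σ → ℂ}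
    (h : Summable fun α => ‖MvPowerSeries.coeff α G * ∏ a, x a ^ α a‖) :
    HasSum (fun d => hval d x G) (sumAt G x) := by
  have h1 := h.of_norm.hasSum.tsum_fiberwise Finsupp.degree
  refine h1.congr_fun ?_
  intro d
  rw [hval_eq_sum, ← Finset.tsum_subtype']
  have : (Finsupp.degree ⁻¹' {d} : Set (σ →₀ ℕ)) = (degFin σ d : Set (σ →₀ ℕ)) := by
    ext α
    simp [mem_degFin]
  rw [this]

theorem exists_prod_eq (α : σ →₀ ℕ) {n : ℕ} (hα : α.degree = n) :
    ∃ i : Fin n → σ, ∀ x : σ → ℂ, ∏ j, x (i j) = ∏ a, x a ^ α a := by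
  subst hα
  have hlen : (Finsupp.toMultiset α).toList.length = α.degree := by
    rw [Multiset.length_toList, Finsupp.card_toMultiset]
    rfl
  refine ⟨fun j => (Finsupp.toMultiset α).toList.get (j.cast hlen.symm), fun x => ?_⟩
  have h1 : ∏ a, x a ^ α a = ((Finsupp.toMultiset α).map x).prod := by
    rw [Finsupp.toMultiset_map, Finsupp.prod_toMultiset, Finsupp.prod_mapDomain_index (by simp)
      (by simp [pow_add]), Finsupp.prod_fintype _ _ (by simp)]
  rw [h1]
  conv_rhs => rw [← Multiset.coe_toList (Finsupp.toMultiset α), Multiset.map_coe, Multiset.prod_coe]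
  generalize (Finsupp.toMultiset α).toList = l at hlen
  have h2 : (l.map x).prod = ∏ j : Fin l.length, x (l.get j) := by
    rw [← List.prod_ofFn]
    congr 1
    conv_lhs => rw [← List.ofFn_get l, List.map_ofFn]
    rfl
  rw [h2]
  exact (finCongr hlen.symm).prod_comp fun j => x (l.get j)

theorem Cvg.exists_hasFPowerSeriesAt {G : MvPowerSeries σ ℂ} (hG : Cvg G) :
    ∃ p : FormalMultilinearSeries ℂ (σ → ℂ) ℂ, HasFPowerSeriesAt (sumAt G) p 0 ∧
      ∀ n x, p n (fun _ => x) = hval n x G := by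
  obtain ⟨ρ, hρ, hG⟩ := hG
  lift ρ to NNReal using hρ.le
  choose i hi using fun (n : ℕ) (α : {α : σ →₀ ℕ // α ∈ degFin σ n}) =>
    exists_prod_eq α.1 (mem_degFin.1 α.2)
  set p : FormalMultilinearSeries ℂ (σ → ℂ) ℂ := fun n => ∑ α : {α : σ →₀ ℕ // α ∈ degFin σ n},
    MvPowerSeries.coeff α.1 G • (ContinuousMultilinearMap.mkPiAlgebra ℂ (Fin n) ℂ).compContinuousLinearMap
      (fun j => ContinuousLinearMap.proj (R := ℂ) (φ := fun _ : σ => ℂ) (i n α j)) with hp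
  have hpv : ∀ n x, p n (fun _ => x) = hval n x G := by
    intro n x
    rw [hval_eq_sum, ← Finset.sum_coe_sort, hp, _root_.sum_apply]
    refine Finset.sum_congr rfl fun α _ => ?_
    rw [_root_.smul_apply, ContinuousMultilinearMap.compContinuousLinearMap_apply,
      ContinuousMultilinearMap.mkPiAlgebra_apply, ← hi n α x, smul_eq_mul]
    rfl
  have hnorm : ∀ n, ‖p n‖ * ρ ^ n ≤ ∑' α, ‖MvPowerSeries.coeff α G‖ * ρ ^ α.degree := by
    intro n
    have h1 : ‖p n‖ ≤ ∑ α : {α : σ →₀ ℕ // α ∈ degFin σ n}, ‖MvPowerSeries.coeff α.1 G‖ := by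
      refine (norm_sum_le _ _).trans (Finset.sum_le_sum fun α _ => ?_)
      rw [norm_smul]
      refine mul_le_of_le_one_right (norm_nonneg _) ?_
      refine ContinuousMultilinearMap.opNorm_le_bound zero_le_one fun m => ?_
      rw [ContinuousMultilinearMap.compContinuousLinearMap_apply,
        ContinuousMultilinearMap.mkPiAlgebra_apply, norm_prod, one_mul]
      exact Finset.prod_le_prod (fun j _ => norm_nonneg _) fun j _ => norm_le_pi_norm (m j) _
    rw [Finset.sum_coe_sort (degFin σ n) fun α => ‖MvPowerSeries.coeff α G‖] at h1
    calc ‖p n‖ * ρ ^ n ≤ (∑ α ∈ degFin σ n, ‖MvPowerSeries.coeff α G‖) * ρ ^ n := by gcongr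
      _ = ∑ α ∈ degFin σ n, ‖MvPowerSeries.coeff α G‖ * ρ ^ α.degree := by
        rw [Finset.sum_mul]
        exact Finset.sum_congr rfl fun α hα => by rw [mem_degFin.1 hα]
      _ ≤ _ := hG.sum_le_tsum _ fun α _ => by positivity
  refine ⟨p, ⟨ρ, ⟨p.le_radius_of_bound _ hnorm, by exact_mod_cast hρ, fun {y} hy => ?_⟩⟩, hpv⟩
  simp_rw [hpv, zero_add]
  refine hasSum_hval (summable_norm_term hG ?_)
  rw [Metric.mem_eball, edist_zero_right, enorm_eq_nnnorm] at hy
  have : ‖y‖₊ < ρ := by exact_mod_cast hy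
  exact le_of_lt this

theorem Cvg.analyticAt {G : MvPowerSeries σ ℂ} (hG : Cvg G) : AnalyticAt ℂ (sumAt G) 0 :=
  let ⟨p, hp, _⟩ := hG.exists_hasFPowerSeriesAt
  ⟨p, hp⟩

theorem Cvg.eq_zero_of_sumAt {G : MvPowerSeries σ ℂ} (hG : Cvg G) (h : sumAt G =ᶠ[𝓝 0] 0) :
    G = 0 := by
  obtain ⟨p, hp, hpv⟩ := hG.exists_hasFPowerSeriesAt
  have h0 := (hp.congr h).apply_eq_zero
  by_contra hne
  obtain ⟨d, hd, hd'⟩ : ∃ d, G ∈ ordGE σ d ∧ G ∉ ordGE σ (d + 1) := by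
    classical exact exists_mem_ordGE_notMem hne
  obtain ⟨v, hv⟩ := exists_hval_ne_zero hd hd'
  exact hv (by rw [← hpv, h0])

theorem exists_cvg_of_hasFPowerSeriesAt {g : (σ → ℂ) → ℂ}
    {p : FormalMultilinearSeries ℂ (σ → ℂ) ℂ} (hp : HasFPowerSeriesAt g p 0) :
    ∃ G, Cvg G ∧ ∀ n x, hval n x G = p n fun _ => x := by
  classical
  set con : ∀ n, (Fin n → σ) → σ →₀ ℕ := fun n i => ∑ j, Finsupp.single (i j) 1 with hcon
  have hcondeg : ∀ n i, (con n i).degree = n := fun n i => by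
    rw [hcon]
    simp [map_sum, Finsupp.degree_single]
  have hconprod : ∀ n i (x : σ → ℂ), ∏ a, x a ^ con n i a = ∏ j, x (i j) := fun n i x => by
    have h1 : ∀ a, x a ^ con n i a = ∏ j, if i j = a then x a else 1 := fun a => by
      rw [hcon, Finsupp.finsetSum_apply, ← Finset.prod_pow_eq_pow_sum]
      refine Finset.prod_congr rfl fun j _ => ?_
      rw [Finsupp.single_apply]
      split_ifs <;> simp
    simp_rw [h1]
    rw [Finset.prod_comm]
    exact Finset.prod_congr rfl fun j _ => by rw [Finset.prod_ite_eq]; simp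
  set G : MvPowerSeries σ ℂ := fun α =>
    ∑ i : Fin α.degree → σ, if con _ i = α then p α.degree (fun j => Pi.single (i j) 1) else 0 with hGdef
  have hG : ∀ n (α : σ →₀ ℕ), α.degree = n → MvPowerSeries.coeff α G =
      ∑ i : Fin n → σ, if con _ i = α then p n (fun j => Pi.single (i j) 1) else 0 := by
    rintro n α rfl
    rfl
  obtain ⟨C, r, hC, hr, hbound⟩ := p.le_mul_pow_of_radius_pos hp.radius_pos
  refine ⟨G, ?_, fun n x => ?_⟩
  · set s : ℝ := Fintype.card σ + 1 with hs
    have hs0 : 0 < s := by positivity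
    refine ⟨1 / (2 * s * r), by positivity, Summable.of_nonneg_of_le (fun α => by positivity)
      (fun α => ?_) ((summable_pow_degree (σ := σ) (r := 1 / 2) (by norm_num)
        (by norm_num)).mul_left C)⟩
    have h1 : ‖MvPowerSeries.coeff α G‖ ≤ s ^ α.degree * (C * r ^ α.degree) := by
      rw [hG _ α rfl]
      refine (norm_sum_le _ _).trans ((Finset.sum_le_card_nsmul _ _ (C * r ^ α.degree)
        fun i _ => ?_).trans ?_)
      · split_ifs
        · refine ((p α.degree).le_opNorm _).trans ?_
          have h2 : ∏ j : Fin α.degree, ‖(Pi.single (i j) 1 : σ → ℂ)‖ ≤ 1 := by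
            refine Finset.prod_le_one (fun j _ => norm_nonneg _) fun j _ => ?_
            rw [Pi.norm_single, norm_one]
          exact (mul_le_of_le_one_right (norm_nonneg _) h2).trans (hbound _)
        · rw [norm_zero]
          positivity
      · rw [nsmul_eq_mul, Finset.card_univ, Fintype.card_fun, Fintype.card_fin]
        push_cast
        gcongr
        rw [hs]
        linarith
    calc ‖MvPowerSeries.coeff α G‖ * (1 / (2 * s * r)) ^ α.degree
        ≤ s ^ α.degree * (C * r ^ α.degree) * (1 / (2 * s * r)) ^ α.degree := by gcongr
      _ = C * (s * r * (1 / (2 * s * r))) ^ α.degree := by rw [mul_pow, mul_pow]; ring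
      _ = C * (1 / 2) ^ α.degree := by
        congr 2
        field_simp
  · have h1 : (p n fun _ => x) = ∑ i : Fin n → σ, (∏ j, x (i j)) * p n fun j => Pi.single (i j) 1 := by
      have hx : x = ∑ a, x a • (Pi.single a 1 : σ → ℂ) := by
        ext b
        simp [Finset.sum_apply, Pi.single_apply]
      conv_lhs => rw [hx]
      have := (p n).toMultilinearMap.map_sum fun (_ : Fin n) (a : σ) =>
        x a • (Pi.single a 1 : σ → ℂ)
      refine this.trans (Finset.sum_congr rfl fun i _ => ?_)
      rw [MultilinearMap.map_smul_univ, smul_eq_mul]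
      rfl
    rw [h1, hval_eq_sum, Finset.sum_congr rfl fun α hα => by rw [hG n α (mem_degFin.1 hα)]]
    simp_rw [Finset.sum_mul]
    rw [Finset.sum_comm]
    refine Finset.sum_congr rfl fun i _ => ?_
    simp_rw [ite_mul, zero_mul]
    rw [Finset.sum_ite_eq, if_pos (mem_degFin.2 (hcondeg n i)), hconprod, mul_comm]

end SumAt

section Rep
variable {σ : Type*} [Fintype σ]

/-- The germ `g` at the origin is the sum of the convergent power series `G`. -/
def Rep (g : (σ → ℂ) → ℂ) (G : MvPowerSeries σ ℂ) : Prop := Cvg G ∧ g =ᶠ[𝓝 0] sumAt G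

theorem exists_rep {g : (σ → ℂ) → ℂ} (hg : AnalyticAt ℂ g 0) : ∃ G, Rep g G := by
  obtain ⟨p, hp⟩ := hg
  obtain ⟨G, hG, hGp⟩ := exists_cvg_of_hasFPowerSeriesAt hp
  refine ⟨G, hG, ?_⟩
  filter_upwards [hp.eventually_hasSum, hG.eventually_summable] with x hx hx'
  have h1 := hasSum_hval hx'
  simp_rw [hGp] at h1
  rw [zero_add] at hx
  exact hx.unique h1

theorem Rep.eq_zero_iff {g : (σ → ℂ) → ℂ} {G : MvPowerSeries σ ℂ} (h : Rep g G) :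
    G = 0 ↔ g =ᶠ[𝓝 0] 0 := by
  constructor
  · rintro rfl
    refine h.2.trans (Eventually.of_forall fun x => ?_)
    simp [sumAt]
  · intro h0
    exact h.1.eq_zero_of_sumAt (h.2.symm.trans h0)

theorem Rep.apply_zero {g : (σ → ℂ) → ℂ} {G : MvPowerSeries σ ℂ} (h : Rep g G) :
    g 0 = MvPowerSeries.constantCoeff G := by
  rw [h.2.self_of_nhds, sumAt, tsum_eq_single 0]
  · simp
  · intro α hα
    obtain ⟨a, ha⟩ := DFunLike.ne_iff.1 hα
    rw [Finset.prod_eq_zero (Finset.mem_univ a), mul_zero]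
    rw [Pi.zero_apply, zero_pow ha]

theorem Cvg.common {G H : MvPowerSeries σ ℂ} (hG : Cvg G) (hH : Cvg H) : ∃ ρ : ℝ, 0 < ρ ∧
    (Summable fun α => ‖MvPowerSeries.coeff α G‖ * ρ ^ α.degree) ∧
    Summable fun α => ‖MvPowerSeries.coeff α H‖ * ρ ^ α.degree := by
  obtain ⟨ρ, hρ, hG⟩ := hG
  obtain ⟨τ, hτ, hH⟩ := hH
  refine ⟨min ρ τ, lt_min hρ hτ, ?_, ?_⟩
  · refine Summable.of_nonneg_of_le (fun α => by positivity) (fun α => ?_) hG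
    gcongr
    exact min_le_left _ _
  · refine Summable.of_nonneg_of_le (fun α => by positivity) (fun α => ?_) hH
    gcongr
    exact min_le_right _ _

theorem Rep.add {g h : (σ → ℂ) → ℂ} {G H : MvPowerSeries σ ℂ} (hg : Rep g G) (hh : Rep h H) :
    Rep (fun x => g x + h x) (G + H) := by
  obtain ⟨ρ, hρ, hG, hH⟩ := hg.1.common hh.1
  refine ⟨⟨ρ, hρ, Summable.of_nonneg_of_le (fun α => by positivity) (fun α => ?_) (hG.add hH)⟩, ?_⟩
  · rw [map_add, ← add_mul]
    gcongr
    exact norm_add_le _ _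
  · filter_upwards [hg.2, hh.2, hg.1.eventually_summable, hh.1.eventually_summable] with x h1 h2 h3 h4
    rw [h1, h2, sumAt, sumAt, sumAt, ← h3.of_norm.tsum_add h4.of_norm]
    simp_rw [map_add, add_mul]

theorem Rep.mul {g h : (σ → ℂ) → ℂ} {G H : MvPowerSeries σ ℂ} (hg : Rep g G) (hh : Rep h H) :
    Rep (fun x => g x * h x) (G * H) := by
  classical
  obtain ⟨ρ, hρ, hG, hH⟩ := hg.1.common hh.1
  refine ⟨⟨ρ, hρ, ?_⟩, ?_⟩
  · have h0 : Summable fun p : (σ →₀ ℕ) × (σ →₀ ℕ) =>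
        (‖MvPowerSeries.coeff p.1 G‖ * ρ ^ p.1.degree) *
          (‖MvPowerSeries.coeff p.2 H‖ * ρ ^ p.2.degree) :=
      Summable.mul_of_nonneg (f := fun α : σ →₀ ℕ => ‖MvPowerSeries.coeff α G‖ * ρ ^ α.degree)
        (g := fun α : σ →₀ ℕ => ‖MvPowerSeries.coeff α H‖ * ρ ^ α.degree) hG hH
        (fun α => mul_nonneg (norm_nonneg _) (pow_nonneg hρ.le _))
        (fun α => mul_nonneg (norm_nonneg _) (pow_nonneg hρ.le _))
    have h1 := summable_sum_mul_antidiagonal_of_summable_mul (A := σ →₀ ℕ)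
      (f := fun α => ‖MvPowerSeries.coeff α G‖ * ρ ^ α.degree)
      (g := fun α => ‖MvPowerSeries.coeff α H‖ * ρ ^ α.degree) h0
    refine Summable.of_nonneg_of_le (fun α => by positivity) (fun α => ?_) h1
    rw [MvPowerSeries.coeff_mul]
    calc ‖∑ p ∈ Finset.HasAntidiagonal.antidiagonal α, MvPowerSeries.coeff p.1 G * MvPowerSeries.coeff p.2 H‖ *
          ρ ^ α.degree
        ≤ (∑ p ∈ Finset.HasAntidiagonal.antidiagonal α, ‖MvPowerSeries.coeff p.1 G * MvPowerSeries.coeff p.2 H‖) *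
          ρ ^ α.degree := by
          gcongr
          exact norm_sum_le _ _
      _ = _ := by
          rw [Finset.sum_mul]
          refine Finset.sum_congr rfl fun p hp => ?_
          rw [norm_mul, ← Finset.HasAntidiagonal.mem_antidiagonal.1 hp, map_add, pow_add]
          ring
  · filter_upwards [hg.2, hh.2, hg.1.eventually_summable, hh.1.eventually_summable] with x h1 h2 h3 h4
    have h5 := summable_mul_of_summable_norm (f := fun α : σ →₀ ℕ =>
      MvPowerSeries.coeff α G * ∏ a, x a ^ α a) (g := fun α : σ →₀ ℕ =>
      MvPowerSeries.coeff α H * ∏ a, x a ^ α a) h3 h4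
    have h6 := Summable.tsum_mul_tsum_eq_tsum_sum_antidiagonal (f := fun α : σ →₀ ℕ =>
      MvPowerSeries.coeff α G * ∏ a, x a ^ α a) (g := fun α : σ →₀ ℕ =>
      MvPowerSeries.coeff α H * ∏ a, x a ^ α a) h3.of_norm h4.of_norm h5
    rw [h1, h2]
    refine h6.trans (tsum_congr fun α => ?_)
    rw [MvPowerSeries.coeff_mul, Finset.sum_mul]
    refine Finset.sum_congr rfl fun p hp => ?_
    rw [← Finset.HasAntidiagonal.mem_antidiagonal.1 hp]
    simp_rw [Finsupp.add_apply, pow_add]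
    rw [Finset.prod_mul_distrib]
    ring

theorem Rep.const (c : ℂ) : Rep (fun _ : σ → ℂ => c) (algebraMap ℂ (MvPowerSeries σ ℂ) c) := by
  classical
  have hcoeff : ∀ α : σ →₀ ℕ, α ≠ 0 →
      MvPowerSeries.coeff α (algebraMap ℂ (MvPowerSeries σ ℂ) c) = 0 := fun α hα => by
    rw [MvPowerSeries.algebraMap_apply, MvPowerSeries.coeff_C, if_neg hα]
  refine ⟨⟨1, one_pos, summable_of_ne_finset_zero (s := {0}) fun α hα => ?_⟩, ?_⟩
  · rw [hcoeff α (by simpa using hα), norm_zero, zero_mul]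
  · refine Eventually.of_forall fun x => ?_
    change c = _
    rw [sumAt, tsum_eq_single 0 fun α hα => by rw [hcoeff α hα, zero_mul]]
    simp [MvPowerSeries.algebraMap_apply]

theorem Rep.sum {τ : Type*} (s : Finset τ) {g : τ → (σ → ℂ) → ℂ} {G : τ → MvPowerSeries σ ℂ}
    (h : ∀ t ∈ s, Rep (g t) (G t)) : Rep (fun x => ∑ t ∈ s, g t x) (∑ t ∈ s, G t) := by
  classical
  induction s using Finset.induction_on with
  | empty => simpa using Rep.const (σ := σ) 0
  | insert t s ht ih =>
    simp_rw [Finset.sum_insert ht]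
    exact (h t (by simp)).add (ih fun t ht => h t (by simp [ht]))

theorem Rep.prod {τ : Type*} (s : Finset τ) {g : τ → (σ → ℂ) → ℂ} {G : τ → MvPowerSeries σ ℂ}
    (h : ∀ t ∈ s, Rep (g t) (G t)) : Rep (fun x => ∏ t ∈ s, g t x) (∏ t ∈ s, G t) := by
  classical
  induction s using Finset.induction_on with
  | empty => simpa using Rep.const (σ := σ) 1
  | insert t s ht ih =>
    simp_rw [Finset.prod_insert ht]
    exact (h t (by simp)).mul (ih fun t ht => h t (by simp [ht]))

theorem Rep.smul (c : ℂ) {g : (σ → ℂ) → ℂ} {G : MvPowerSeries σ ℂ} (h : Rep g G) :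
    Rep (fun x => c * g x) (c • G) := by
  rw [Algebra.smul_def]
  exact (Rep.const c).mul h

theorem Rep.sub {g h : (σ → ℂ) → ℂ} {G H : MvPowerSeries σ ℂ} (hg : Rep g G) (hh : Rep h H) :
    Rep (fun x => g x - h x) (G - H) := by
  have := hg.add (hh.smul (-1))
  simpa [sub_eq_add_neg] using this

theorem Rep.det {τ : Type*} [Fintype τ] [DecidableEq τ] {M : (σ → ℂ) → Matrix τ τ ℂ}
    {Mf : Matrix τ τ (MvPowerSeries σ ℂ)} (h : ∀ i j, Rep (fun x => M x i j) (Mf i j)) :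
    Rep (fun x => (M x).det) Mf.det := by
  simp_rw [Matrix.det_apply']
  refine Rep.sum _ fun s _ => Rep.mul ?_ (Rep.prod _ fun i _ => h _ _)
  have := Rep.const (σ := σ) ((Equiv.Perm.sign s : ℤ) : ℂ)
  simpa using this

theorem Rep.eq_iff {g h : (σ → ℂ) → ℂ} {G H : MvPowerSeries σ ℂ} (hg : Rep g G) (hh : Rep h H) :
    G = H ↔ g =ᶠ[𝓝 0] h := by
  rw [← sub_eq_zero, (hg.sub hh).eq_zero_iff]
  exact ⟨fun h => h.mono fun x hx => sub_eq_zero.1 hx, fun h => h.mono fun x hx => sub_eq_zero.2 hx⟩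

end Rep

section RepDeriv
variable {σ : Type*} [Fintype σ] [DecidableEq σ]

theorem prod_update_pow (x : σ → ℂ) (a : σ) (t : ℂ) (α : σ →₀ ℕ) :
    ∏ b, Function.update x a t b ^ α b = t ^ α a * ∏ b ∈ Finset.univ.erase a, x b ^ α b := by
  rw [← Finset.mul_prod_erase _ _ (Finset.mem_univ a), Function.update_self]
  congr 1
  refine Finset.prod_congr rfl fun b hb => ?_
  rw [Function.update_of_ne (Finset.ne_of_mem_erase hb)]

theorem apply_eq_zero_of_notMem_range_add_single {α : σ →₀ ℕ} {a : σ}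
    (h : α ∉ Set.range fun β : σ →₀ ℕ => β + Finsupp.single a 1) : α a = 0 := by
  by_contra h0
  refine h ⟨α - Finsupp.single a 1, ?_⟩
  refine tsub_add_cancel_of_le ?_
  rw [Finsupp.single_le_iff]
  exact Nat.one_le_iff_ne_zero.2 h0

theorem hasDerivAt_sumAt_update {G : MvPowerSeries σ ℂ} {a : σ} {r : ℝ} (hr : 0 < r)
    (hG : Summable fun α => ‖MvPowerSeries.coeff α G‖ * r ^ α.degree)
    (hG' : Summable fun α => ‖MvPowerSeries.coeff α (MvPowerSeries.pderiv ℂ a G)‖ * r ^ α.degree)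
    {x : σ → ℂ} (hx : ‖x‖ < r) :
    HasDerivAt (fun t => sumAt G (Function.update x a t))
      (sumAt (MvPowerSeries.pderiv ℂ a G) x) (x a) := by
  have hinj : Function.Injective fun β : σ →₀ ℕ => β + Finsupp.single a 1 :=
    fun β γ h => add_right_cancel h
  have hxb : ∀ b, ‖x b‖ ≤ r := fun b => (norm_le_pi_norm x b).trans hx.le
  set g : (σ →₀ ℕ) → ℂ → ℂ := fun α t =>
    MvPowerSeries.coeff α G * (t ^ α a * ∏ b ∈ Finset.univ.erase a, x b ^ α b) with hg
  set g' : (σ →₀ ℕ) → ℂ → ℂ := fun α t =>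
    MvPowerSeries.coeff α G * ((α a * t ^ (α a - 1)) * ∏ b ∈ Finset.univ.erase a, x b ^ α b) with hg'
  set u : (σ →₀ ℕ) → ℝ := fun α => ‖MvPowerSeries.coeff α G‖ * (α a * r ^ (α.degree - 1)) with hu
  have hus : Summable u := by
    rw [← hinj.summable_iff]
    · refine hG'.congr fun β => ?_
      rw [MvPowerSeries.coeff_pderiv, norm_mul, hu]
      simp only [Function.comp, Finsupp.add_apply, Finsupp.single_eq_same, map_add,
        Finsupp.degree_single, Nat.add_sub_cancel]
      have : ‖((β a : ℂ) + 1)‖ = (β a : ℝ) + 1 := by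
        rw [← Nat.cast_add_one, Complex.norm_natCast, Nat.cast_add_one]
      rw [this]
      push_cast
      ring
    · intro α hα
      rw [hu]
      simp [apply_eq_zero_of_notMem_range_add_single hα]
  have hgd : ∀ α t, HasDerivAt (g α) (g' α t) t := fun α t =>
    ((hasDerivAt_pow (α a) t).mul_const _).const_mul _
  have hdeg : ∀ α : σ →₀ ℕ, α.degree = α a + ∑ b ∈ Finset.univ.erase a, α b := fun α => by
    rw [Finsupp.degree_eq_sum, Finset.add_sum_erase _ _ (Finset.mem_univ a)]
  have hpr : ∀ α : σ →₀ ℕ, ‖∏ b ∈ Finset.univ.erase a, x b ^ α b‖ ≤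
      r ^ ∑ b ∈ Finset.univ.erase a, α b := fun α => by
    rw [norm_prod, ← Finset.prod_pow_eq_pow_sum]
    refine Finset.prod_le_prod (fun b _ => norm_nonneg _) fun b _ => ?_
    rw [norm_pow]
    exact pow_le_pow_left₀ (norm_nonneg _) (hxb b) _
  have hg'u : ∀ α t, t ∈ Metric.ball (0 : ℂ) r → ‖g' α t‖ ≤ u α := by
    intro α t ht
    rw [hg', hu]
    simp only [norm_mul, Complex.norm_natCast]
    rcases Nat.eq_zero_or_pos (α a) with h0 | h0
    · simp [h0]
    · have h1 : α.degree - 1 = (α a - 1) + ∑ b ∈ Finset.univ.erase a, α b := by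
        rw [hdeg]; omega
      rw [h1, pow_add, mul_assoc (α a : ℝ)]
      have ht' : ‖t‖ ≤ r := by simpa using (Metric.mem_ball.1 ht).le
      rw [norm_pow]
      gcongr
      exact hpr α
  have hxa : x a ∈ Metric.ball (0 : ℂ) r := by
    simpa using (norm_le_pi_norm x a).trans_lt hx
  have hg0 : Summable fun α => g α (x a) := by
    refine (summable_norm_term hG hx.le).of_norm.congr fun α => ?_
    rw [hg]
    simp only
    rw [← prod_update_pow, Function.update_eq_self]
  have hD := hasDerivAt_tsum_of_isPreconnected hus Metric.isOpen_ball
    (convex_ball (0 : ℂ) r).isPreconnected (fun α t _ => hgd α t) hg'u hxa hg0 hxa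
  have hfun : (fun t => sumAt G (Function.update x a t)) = fun t => ∑' α, g α t := by
    funext t
    simp_rw [sumAt, prod_update_pow]
    rfl
  suffices hval : sumAt (MvPowerSeries.pderiv ℂ a G) x = ∑' α, g' α (x a) by
    rw [hfun, hval]
    exact hD
  rw [sumAt, ← hinj.tsum_eq (f := fun α => g' α (x a))]
  · refine tsum_congr fun β => ?_
    have h2 : ∏ b ∈ Finset.univ.erase a, x b ^ (β + Finsupp.single a 1 : σ →₀ ℕ) b =
        ∏ b ∈ Finset.univ.erase a, x b ^ β b := Finset.prod_congr rfl fun b hb => by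
      rw [Finsupp.add_apply, Finsupp.single_eq_of_ne (Finset.ne_of_mem_erase hb), add_zero]
    rw [hg']
    simp only
    rw [h2, MvPowerSeries.coeff_pderiv, ← Finset.mul_prod_erase _ _ (Finset.mem_univ a)]
    simp only [Finsupp.add_apply, Finsupp.single_eq_same, Nat.add_sub_cancel]
    push_cast
    ring
  · intro α hα
    by_contra h
    refine hα ?_
    rw [hg']
    simp [apply_eq_zero_of_notMem_range_add_single h]

theorem Rep.pderiv {g : (σ → ℂ) → ℂ} {G : MvPowerSeries σ ℂ} (h : Rep g G) (a : σ) :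
    Rep (fun x => fderiv ℂ g x (Pi.single a 1)) (MvPowerSeries.pderiv ℂ a G) := by
  have hG' : Cvg (MvPowerSeries.pderiv ℂ a G) := h.1.pderiv a
  refine ⟨hG', ?_⟩
  obtain ⟨r, hr, hs, hs'⟩ := h.1.common hG'
  filter_upwards [Metric.ball_mem_nhds (0 : σ → ℂ) hr, h.1.analyticAt.eventually_analyticAt,
    h.2.eventuallyEq_nhds] with x hx hxa hxe
  have h1 := hasDerivAt_sumAt_update hr hs hs' (x := x) (a := a) (by simpa using hx)
  have h2 : HasFDerivAt (sumAt G) (fderiv ℂ (sumAt G) x) (Function.update x a (x a)) := by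
    rw [Function.update_eq_self]
    exact hxa.differentiableAt.hasFDerivAt
  rw [hxe.fderiv_eq]
  exact (h2.comp_hasDerivAt (x a) (hasDerivAt_update x a (x a))).unique h1

theorem Rep.coeff_single {g : (σ → ℂ) → ℂ} {G : MvPowerSeries σ ℂ} (h : Rep g G) (a : σ) :
    MvPowerSeries.coeff (Finsupp.single a 1) G = fderiv ℂ g 0 (Pi.single a 1) := by
  have h1 := (h.pderiv a).apply_zero
  rw [h1, ← MvPowerSeries.coeff_zero_eq_constantCoeff_apply, MvPowerSeries.coeff_pderiv]
  simp

theorem apply_eq_sum_single (L : (σ → ℂ) →L[ℂ] ℂ) (v : σ → ℂ) :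
    L v = ∑ a, v a * L (Pi.single a 1) := by
  conv_lhs => rw [pi_eq_sum_univ' v, map_sum]
  simp

/-- The Lie derivative of a germ is represented by the formal derivation. -/
theorem Rep.vf {X : (σ → ℂ) → (σ → ℂ)} {Xf : σ → MvPowerSeries σ ℂ}
    (hX : ∀ b, Rep (fun x => X x b) (Xf b)) {g : (σ → ℂ) → ℂ} {G : MvPowerSeries σ ℂ}
    (h : Rep g G) : Rep (fun x => fderiv ℂ g x (X x)) (vf Xf G) := by
  rw [vf_apply]
  simp_rw [fun x => apply_eq_sum_single (fderiv ℂ g x) (X x)]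
  exact Rep.sum _ fun a _ => (hX a).mul (h.pderiv a)

end RepDeriv

section LinearAlgebra
variable {σ ι κ : Type*} [Fintype σ] [Fintype ι] [Fintype κ] [DecidableEq ι] [DecidableEq κ]
  [DecidableEq σ]

theorem exists_leftInverse_of_linearIndependent {v : ι → σ → ℂ} (hv : LinearIndependent ℂ v) :
    ∃ B : (σ → ℂ) →ₗ[ℂ] (ι → ℂ), ∀ i, B (v i) = Pi.single i 1 := by
  obtain ⟨B, hB⟩ := LinearMap.exists_leftInverse_of_injective (Fintype.linearCombination ℂ v)
    (LinearMap.ker_eq_bot.2 hv.fintypeLinearCombination_injective)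
  refine ⟨B, fun i => ?_⟩
  have := LinearMap.congr_fun hB (Pi.single i 1)
  simpa [Fintype.linearCombination_apply_single] using this

theorem exists_dual_family {ℓ : κ → (σ → ℂ) →L[ℂ] ℂ} (hℓ : LinearIndependent ℂ ℓ) :
    ∃ c : κ → σ → ℂ, ∀ i j, ℓ i (c j) = if i = j then 1 else 0 := by
  set L : (σ → ℂ) →ₗ[ℂ] (κ → ℂ) := LinearMap.pi fun i => (ℓ i : (σ → ℂ) →ₗ[ℂ] ℂ) with hL
  have hsurj : LinearMap.range L = ⊤ := by
    by_contra h
    obtain ⟨φ, hφ, hker⟩ := Submodule.exists_le_ker_of_lt_top _ (lt_top_iff_ne_top.2 h)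
    refine hφ (LinearMap.pi_ext' fun i => LinearMap.ext_ring ?_)
    have hsum : ∑ i, φ (Pi.single i 1) • ℓ i = 0 := by
      ext1 x
      have h1 : φ (L x) = 0 := hker ⟨x, rfl⟩
      rw [pi_eq_sum_univ' (L x), map_sum] at h1
      rw [_root_.zero_apply, ← h1]
      simp [hL, mul_comm, _root_.sum_apply]
    simpa using Fintype.linearIndependent_iff.1 hℓ _ hsum i
  choose c hc using fun j => LinearMap.range_eq_top.1 hsurj (Pi.single j 1)
  refine ⟨c, fun i j => ?_⟩
  have := congrFun (hc j) i
  simpa [hL, Pi.single_apply] using this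

theorem linearIndependent_sum_elim {v : ι → σ → ℂ} {ℓ : κ → (σ → ℂ) →L[ℂ] ℂ} {c : κ → σ → ℂ}
    (hv : LinearIndependent ℂ v) (hc : ∀ i j, ℓ i (c j) = if i = j then 1 else 0)
    (h0 : ∀ i j, ℓ j (v i) = 0) : LinearIndependent ℂ (Sum.elim v c) := by
  rw [Fintype.linearIndependent_iff]
  intro g hg
  simp only [Fintype.sum_sum_type, Sum.elim_inl, Sum.elim_inr] at hg
  have hr : ∀ j, g (Sum.inr j) = 0 := fun j => by
    have := congrArg (ℓ j) hg
    simpa [h0, hc] using this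
  have hl := Fintype.linearIndependent_iff.1 hv (fun i => g (Sum.inl i)) (by simpa [hr] using hg)
  rintro (i | j)
  · exact hl i
  · exact hr j

theorem det_ne_zero_of_linearIndependent {M : Matrix σ σ ℂ}
    (h : LinearIndependent ℂ M.col) : M.det ≠ 0 := by
  rw [Matrix.linearIndependent_cols_iff_isUnit, Matrix.isUnit_iff_isUnit_det] at h
  exact h.ne_zero

end LinearAlgebra

section Germs
variable {σ ι κ : Type*} [Fintype σ] [Fintype ι] [Fintype κ] [DecidableEq ι] [DecidableEq κ]
  [DecidableEq σ]

theorem analyticOnNhd_det {τ : Type*} [Fintype τ] [DecidableEq τ] {U : Set (σ → ℂ)}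
    {M : (σ → ℂ) → Matrix τ τ ℂ} (h : ∀ i j, AnalyticOnNhd ℂ (fun x => M x i j) U) :
    AnalyticOnNhd ℂ (fun x => (M x).det) U := by
  intro x hx
  simp_rw [Matrix.det_apply']
  exact Finset.analyticAt_fun_sum _ fun s _ => analyticAt_const.mul
    (Finset.analyticAt_fun_prod _ fun i _ => h _ _ x hx)

variable {U : Set (σ → ℂ)} {X : ι → (σ → ℂ) → (σ → ℂ)} {f : κ → (σ → ℂ) → ℂ}

theorem analyticOnNhd_component {Y : (σ → ℂ) → (σ → ℂ)} (hY : AnalyticOnNhd ℂ Y U) (b : σ) :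
    AnalyticOnNhd ℂ (fun x => Y x b) U := fun x hx =>
  ((ContinuousLinearMap.proj (R := ℂ) (φ := fun _ : σ => ℂ) b).analyticAt _).comp (hY x hx)

theorem analyticOnNhd_fderiv_apply {g : (σ → ℂ) → ℂ} (hg : AnalyticOnNhd ℂ g U) (v : σ → ℂ) :
    AnalyticOnNhd ℂ (fun x => fderiv ℂ g x v) U := fun x hx =>
  ((ContinuousLinearMap.apply ℂ ℂ v).analyticAt _).comp (hg.fderiv x hx)

/-- There is a point at which the fields and the differentials are both independent. -/
theorem exists_common_independent (hU : IsOpen U) (hUc : IsPreconnected U)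
    (hX : ∀ i, AnalyticOnNhd ℂ (X i) U) (hf : ∀ j, AnalyticOnNhd ℂ (f j) U)
    (hXind : ∃ x ∈ U, LinearIndependent ℂ (fun i => X i x))
    (hfind : ∃ x ∈ U, LinearIndependent ℂ (fun j => fderiv ℂ (f j) x)) :
    ∃ x ∈ U, LinearIndependent ℂ (fun i => X i x) ∧
      LinearIndependent ℂ (fun j => fderiv ℂ (f j) x) := by
  obtain ⟨x, hx, hXx⟩ := hXind
  obtain ⟨y, hy, hfy⟩ := hfind
  obtain ⟨B, hB⟩ := exists_leftInverse_of_linearIndependent hXx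
  obtain ⟨c, hc⟩ := exists_dual_family hfy
  set p : (σ → ℂ) → ℂ := fun z => (Matrix.of fun i j => B (X j z) i).det with hp
  set q : (σ → ℂ) → ℂ := fun z => (Matrix.of fun i j => fderiv ℂ (f i) z (c j)).det with hq
  have hpa : AnalyticOnNhd ℂ p U := analyticOnNhd_det fun i j z hz =>
    ((LinearMap.toContinuousLinearMap ((LinearMap.proj i : (ι → ℂ) →ₗ[ℂ] ℂ) ∘ₗ B)).analyticAt
      _).comp (hX j z hz)
  have hqa : AnalyticOnNhd ℂ q U := analyticOnNhd_det fun i j =>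
    analyticOnNhd_fderiv_apply (hf i) (c j)
  have hpx : p x ≠ 0 := by
    have : (Matrix.of fun i j => B (X j x) i) = 1 := by
      ext i j
      rw [Matrix.of_apply, hB, Matrix.one_apply, Pi.single_apply]
    rw [hp]
    simp [this]
  have hqy : q y ≠ 0 := by
    have : (Matrix.of fun i j => fderiv ℂ (f i) y (c j)) = 1 := by
      ext i j
      rw [Matrix.of_apply, hc, Matrix.one_apply]
    rw [hq]
    simp [this]
  have hqx : ∃ᶠ z in 𝓝 x, q z ≠ 0 := by
    intro h
    exact hqy (hqa.eqOn_zero_of_preconnected_of_eventuallyEq_zero hUc hx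
      (h.mono fun z hz => not_not.1 hz) hy)
  have hev : ∀ᶠ z in 𝓝 x, p z ≠ 0 ∧ z ∈ U :=
    ((hpa x hx).continuousAt.eventually_ne hpx).and (hU.mem_nhds hx)
  obtain ⟨z, hqz, hpz, hz⟩ := (hqx.and_eventually hev).exists
  refine ⟨z, hz, ?_, ?_⟩
  · have h1 : LinearIndependent ℂ (B ∘ fun i => X i z) := by
      have := Matrix.linearIndependent_cols_iff_isUnit.2
        ((Matrix.isUnit_iff_isUnit_det _).2 (isUnit_iff_ne_zero.2 hpz))
      exact this
    exact h1.of_comp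
  · set T : ((σ → ℂ) →L[ℂ] ℂ) →ₗ[ℂ] (κ → ℂ) := LinearMap.pi fun j =>
      (ContinuousLinearMap.apply ℂ ℂ (c j) : ((σ → ℂ) →L[ℂ] ℂ) →ₗ[ℂ] ℂ) with hT
    have h1 : LinearIndependent ℂ (T ∘ fun j => fderiv ℂ (f j) z) := by
      have := Matrix.linearIndependent_rows_iff_isUnit.2
        ((Matrix.isUnit_iff_isUnit_det _).2 (isUnit_iff_ne_zero.2 hqz))
      exact this
    exact h1.of_comp

theorem fderiv_component {Y : (σ → ℂ) → (σ → ℂ)} {x : σ → ℂ} (hY : AnalyticAt ℂ Y x) (b : σ)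
    (v : σ → ℂ) : fderiv ℂ (fun x => Y x b) x v = fderiv ℂ Y x v b := by
  rw [fderiv_apply hY.differentiableAt]
  rfl

/-- Passage from an analytic integrable system to its formal counterpart at the origin. -/
theorem exists_formalSystem (hU : IsOpen U) (hUc : IsPreconnected U) (h0 : (0 : σ → ℂ) ∈ U)
    (hX : ∀ i, AnalyticOnNhd ℂ (X i) U) (hf : ∀ j, AnalyticOnNhd ℂ (f j) U) {i₀ : ι}
    (hX0 : X i₀ 0 = 0)
    (hcomm : ∀ i j, ∀ x ∈ U, VectorField.lieBracket ℂ (X i) (X j) x = 0)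
    (hfirst : ∀ i j, ∀ x ∈ U, fderiv ℂ (f j) x (X i x) = 0)
    (hXind : ∃ x ∈ U, LinearIndependent ℂ (fun i => X i x))
    (hfind : ∃ x ∈ U, LinearIndependent ℂ (fun j => fderiv ℂ (f j) x)) (e : ι ⊕ κ ≃ σ) :
    ∃ (Xf : ι → σ → MvPowerSeries σ ℂ) (F : κ → MvPowerSeries σ ℂ) (Cm : Matrix σ κ ℂ),
      (∀ i b, Rep (fun x => X i x b) (Xf i b)) ∧ FormalSystem Xf F i₀ ∧
      ((frame Xf Cm).submatrix id e.symm).det ≠ 0 ∧ (jacC F Cm).det ≠ 0 := by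
  obtain ⟨z, hz, hXz, hfz⟩ := exists_common_independent hU hUc hX hf hXind hfind
  obtain ⟨c, hc⟩ := exists_dual_family hfz
  choose Xf hXf using fun i b => exists_rep (analyticOnNhd_component (hX i) b 0 h0)
  choose F hF using fun j => exists_rep (hf j 0 h0)
  have hUn : ∀ᶠ x in 𝓝 (0 : σ → ℂ), x ∈ U := hU.mem_nhds h0
  refine ⟨Xf, F, fun b j => c j b, hXf, ⟨fun i b => (hXf i b).1, fun j => (hF j).1, fun i l b => ?_,
    fun i j => ?_, fun b α hα => ?_⟩, ?_, ?_⟩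
  · refine ((Rep.vf (hXf i) (hXf l b)).eq_iff (Rep.vf (hXf l) (hXf i b))).2 ?_
    filter_upwards [hUn] with x hx
    have := congrFun (hcomm i l x hx) b
    rw [fderiv_component (hX l x hx), fderiv_component (hX i x hx)]
    simpa [VectorField.lieBracket_eq, sub_eq_zero] using this
  · refine (Rep.vf (hXf i) (hF j)).eq_zero_iff.2 ?_
    filter_upwards [hUn] with x hx
    exact hfirst i j x hx
  · have hα0 : α = 0 := by
      rw [← Finsupp.degree_eq_zero_iff]
      omega
    have := (hXf i₀ b).apply_zero
    rw [hX0] at this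
    rw [hα0, MvPowerSeries.coeff_zero_eq_constantCoeff_apply, ← this]
    rfl
  · set M : (σ → ℂ) → Matrix σ σ ℂ := fun x => (Matrix.of fun b =>
      Sum.elim (fun i => X i x b) (fun j => c j b)).submatrix id e.symm with hM
    have hrep : Rep (fun x => (M x).det) ((frame Xf fun b j => c j b).submatrix id e.symm).det := by
      refine Rep.det fun b s => ?_
      simp only [hM, Matrix.submatrix_apply, Matrix.of_apply, frame, id]
      rcases e.symm s with i | j
      · exact hXf i b
      · exact Rep.const _
    rw [Ne, hrep.eq_zero_iff]
    intro h
    have hMa : AnalyticOnNhd ℂ (fun x => (M x).det) U := by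
      refine analyticOnNhd_det fun b s => ?_
      simp only [hM, Matrix.submatrix_apply, Matrix.of_apply, id]
      rcases e.symm s with i | j
      · exact analyticOnNhd_component (hX i) b
      · exact analyticOnNhd_const
    refine det_ne_zero_of_linearIndependent ?_
      (hMa.eqOn_zero_of_preconnected_of_eventuallyEq_zero hUc h0 h hz)
    have h1 := (linearIndependent_sum_elim hXz hc fun i j => hfirst i j z hz).comp e.symm
      e.symm.injective
    convert h1 using 1
    funext s b
    simp only [hM, Matrix.col_apply, Matrix.submatrix_apply, Matrix.of_apply, id, Function.comp]
    rcases e.symm s with i | j <;> rfl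
  · set M : (σ → ℂ) → Matrix κ κ ℂ := fun x => Matrix.of fun i j => fderiv ℂ (f i) x (c j) with hM
    have hrep : Rep (fun x => (M x).det) (jacC F fun b j => c j b).det := by
      refine Rep.det fun i j => ?_
      simp only [hM, Matrix.of_apply, jacC]
      simp_rw [fun x => apply_eq_sum_single (fderiv ℂ (f i) x) (c j)]
      refine Rep.sum _ fun a _ => ?_
      rw [mul_comm]
      exact (Rep.const _).mul ((hF i).pderiv a)
    rw [Ne, hrep.eq_zero_iff]
    intro h
    have hMa : AnalyticOnNhd ℂ (fun x => (M x).det) U :=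
      analyticOnNhd_det fun i j => analyticOnNhd_fderiv_apply (hf i) (c j)
    have h1 := hMa.eqOn_zero_of_preconnected_of_eventuallyEq_zero hUc h0 h hz
    have h2 : M z = 1 := by
      ext i j
      rw [Matrix.one_apply, ← hc]
      rfl
    simp [h2] at h1

end Germs

section Diagonal
variable {σ : Type*} [Fintype σ] [DecidableEq σ]

theorem isSemisimple_diagonal (lam : σ → ℂ) :
    Module.End.IsSemisimple (Matrix.toLinAlgEquiv' (Matrix.diagonal lam) : Module.End ℂ (σ → ℂ)) := by
  set p : Polynomial ℂ := ∏ μ ∈ Finset.univ.image lam, (Polynomial.X - Polynomial.C μ) with hp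
  have hsq : Squarefree p :=
    (Polynomial.separable_prod_X_sub_C_iff'.2 fun _ _ _ _ h => h).squarefree
  refine Module.End.isSemisimple_of_squarefree_aeval_eq_zero hsq ?_
  have h1 : Polynomial.aeval lam p = 0 := by
    funext i
    have h2 := Polynomial.aeval_algHom_apply (Pi.evalAlgHom ℂ (fun _ : σ => ℂ) i) lam p
    rw [Pi.evalAlgHom_apply, Pi.evalAlgHom_apply] at h2
    rw [← h2, Pi.zero_apply, Polynomial.coe_aeval_eq_eval, hp, Polynomial.eval_prod]
    exact Finset.prod_eq_zero (Finset.mem_image_of_mem lam (Finset.mem_univ i)) (by simp)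
  have h2 := Polynomial.aeval_algHom_apply ((Matrix.toLinAlgEquiv' (R := ℂ) (n := σ)).toAlgHom.comp
    (Matrix.diagonalAlgHom ℂ)) lam p
  rw [h1, map_zero] at h2
  exact h2

theorem isNilpotent_sub_diagonal {P Q A : Matrix σ σ ℂ} {lam : σ → ℂ} {k : ℕ}
    (hQ : IsUnit Q) (hPQ : P * Q = Q * A) (hcomm : Commute P (Matrix.diagonal lam))
    (hk : ∀ i, Q i ᵥ* (A - lam i • 1) ^ k = 0) : IsNilpotent (P - Matrix.diagonal lam) := by
  set N := P - Matrix.diagonal lam with hN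
  have hNP : Commute N P := (Commute.refl P).sub_left hcomm.symm
  refine ⟨k, ?_⟩
  have hrow : ∀ i l, (Pi.single i 1 : σ → ℂ) ᵥ* N ^ l = Pi.single i 1 ᵥ* (P - lam i • 1) ^ l := by
    intro i l
    induction l with
    | zero => rfl
    | succ l ih =>
      have hc : Commute (P - lam i • 1) (N ^ l) :=
        (hNP.symm.sub_left ((Commute.one_left _).smul_left _)).pow_right l
      have h1 : (Pi.single i 1 : σ → ℂ) ᵥ* N = Pi.single i 1 ᵥ* (P - lam i • 1) := by
        rw [hN, Matrix.vecMul_sub, Matrix.vecMul_sub, Matrix.vecMul_smul, Matrix.vecMul_one]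
        congr 1
        ext j
        rw [Matrix.vecMul_diagonal]
        by_cases h : j = i
        · subst h; simp
        · simp [h]
      rw [pow_succ', ← Matrix.vecMul_vecMul, h1, Matrix.vecMul_vecMul, hc.eq,
        ← Matrix.vecMul_vecMul, ih, Matrix.vecMul_vecMul, pow_succ]
  have hconj : ∀ (μ : ℂ) l, (P - μ • 1) ^ l * Q = Q * (A - μ • 1) ^ l := fun μ l => by
    have : SemiconjBy Q (A - μ • 1) (P - μ • 1) := by
      rw [SemiconjBy, mul_sub, sub_mul, hPQ]
      simp
    exact (this.pow_right l).eq.symm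
  rw [← hQ.mul_left_inj, zero_mul]
  refine Matrix.ext fun i j => ?_
  have h1 : (Pi.single i 1 : σ → ℂ) ᵥ* (N ^ k * Q) = 0 := by
    rw [← Matrix.vecMul_vecMul, hrow, Matrix.vecMul_vecMul, hconj, ← Matrix.vecMul_vecMul,
      Matrix.single_one_vecMul]
    exact hk i
  rw [Matrix.single_one_vecMul] at h1
  exact congrFun h1 j

end Diagonal

section Adjugate
variable {σ : Type*} [Fintype σ] [DecidableEq σ]

theorem Cvg.rep {G : MvPowerSeries σ ℂ} (h : Cvg G) : Rep (sumAt G) G := ⟨h, EventuallyEq.rfl⟩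

theorem Cvg.det {τ : Type*} [Fintype τ] [DecidableEq τ] {M : Matrix τ τ (MvPowerSeries σ ℂ)}
    (h : ∀ i j, Cvg (M i j)) : Cvg M.det :=
  (Rep.det (M := fun x => Matrix.of fun i j => sumAt (M i j) x) fun i j => (h i j).rep).1

theorem Cvg.adjugate {τ : Type*} [Fintype τ] [DecidableEq τ] {M : Matrix τ τ (MvPowerSeries σ ℂ)}
    (h : ∀ i j, Cvg (M i j)) (i j : τ) : Cvg (M.adjugate i j) := by
  rw [Matrix.adjugate_apply]
  refine Cvg.det fun k l => ?_
  rw [Matrix.updateRow_apply]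
  split_ifs
  · rw [Pi.single_apply]
    split_ifs
    · simpa using (Rep.const (σ := σ) 1).1
    · simpa using (Rep.const (σ := σ) 0).1
  · exact h k l

/-- A formal vector field with prescribed convergent values on convergent coordinates becomes
convergent after multiplication by the Jacobian determinant. -/
theorem exists_cvg_vf {ζ u w : σ → MvPowerSeries σ ℂ} (hζ : ∀ i, Cvg (ζ i)) (hu : ∀ i, Cvg (u i))
    (hw : ∀ i, vf w (ζ i) = u i) : ∃ (D : MvPowerSeries σ ℂ) (W : σ → MvPowerSeries σ ℂ),
      Cvg D ∧ (∀ a, Cvg (W a)) ∧ MvPowerSeries.constantCoeff D = (linMat ζ).det ∧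
      ∀ g, vf W g = D * vf w g := by
  set J : Matrix σ σ (MvPowerSeries σ ℂ) := fun i a => MvPowerSeries.pderiv ℂ a (ζ i) with hJ
  have hJc : ∀ i a, Cvg (J i a) := fun i a => (hζ i).pderiv a
  have hJw : J *ᵥ w = u := by
    funext i
    rw [← hw, vf_apply, Matrix.mulVec, dotProduct]
    exact Finset.sum_congr rfl fun a _ => mul_comm _ _
  have hW : J.adjugate *ᵥ u = J.det • w := by
    rw [← hJw, Matrix.mulVec_mulVec, Matrix.adjugate_mul, Matrix.smul_mulVec, Matrix.one_mulVec]
  refine ⟨J.det, J.adjugate *ᵥ u, Cvg.det hJc, fun a => ?_, ?_, fun g => ?_⟩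
  · rw [Matrix.mulVec, dotProduct]
    exact (Rep.sum _ fun i _ => (Cvg.adjugate hJc a i).rep.mul (hu i).rep).1
  · rw [RingHom.map_det]
    congr 1
    refine Matrix.ext fun i a => ?_
    rw [RingHom.mapMatrix_apply, Matrix.map_apply, hJ,
      ← MvPowerSeries.coeff_zero_eq_constantCoeff_apply, MvPowerSeries.coeff_pderiv]
    simp [linMat]
  · rw [hW, vf_apply, vf_apply, Finset.mul_sum]
    exact Finset.sum_congr rfl fun a _ => by rw [Pi.smul_apply, smul_eq_mul, mul_assoc]

end Adjugate

section Assembly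
variable {σ : Type*} [Fintype σ] [DecidableEq σ]

theorem exists_analytic_localInverse {z : (σ → ℂ) → (σ → ℂ)} (hz : AnalyticAt ℂ z 0) (hz0 : z 0 = 0)
    {i : (σ → ℂ) ≃L[ℂ] (σ → ℂ)} (hi : fderiv ℂ z 0 = i) :
    ∃ φ : (σ → ℂ) → (σ → ℂ), AnalyticAt ℂ φ 0 ∧ φ 0 = 0 ∧ (∀ᶠ x in 𝓝 0, φ (z x) = x) ∧
      ∀ᶠ y in 𝓝 0, z (φ y) = y := by
  have hfd : HasStrictFDerivAt z (i : (σ → ℂ) →L[ℂ] (σ → ℂ)) 0 := hi ▸ hz.hasStrictFDerivAt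
  set R := hfd.toOpenPartialHomeomorph z with hR
  have h0 : (0 : σ → ℂ) ∈ R.source := hfd.mem_toOpenPartialHomeomorph_source
  have hR0 : R 0 = 0 := hz0
  have h1 := R.analyticAt_symm' h0 (i := i) hz hi
  rw [hR0] at h1
  refine ⟨R.symm, h1, ?_, ?_, ?_⟩
  · conv_lhs => rw [← hR0]
    exact R.left_inv h0
  · exact R.eventually_left_inverse h0
  · exact R.eventually_right_inverse (hR0 ▸ R.map_source h0)

/-- Vanishing of the bracket with the diagonal field, read off in the original coordinates. -/
theorem fderiv_apply_diagonal_eq {z X Y φ W : (σ → ℂ) → (σ → ℂ)} {D : (σ → ℂ) → ℂ} {lam : σ → ℂ}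
    (hz : AnalyticAt ℂ z 0) (hz0 : z 0 = 0) (hY : AnalyticAt ℂ Y 0)
    (hφ : AnalyticAt ℂ φ 0) (hφ0 : φ 0 = 0) (hzφ : ∀ᶠ y in 𝓝 0, z (φ y) = y)
    (hYz : ∀ᶠ x in 𝓝 0, Y (z x) = fderiv ℂ z x (X x)) (hD : ∀ᶠ x in 𝓝 0, D x ≠ 0)
    (h1 : ∀ i, ∀ᶠ x in 𝓝 0, fderiv ℂ (fun x => z x i) x (W x) = D x * (lam i * z x i))
    (h2 : ∀ i, ∀ᶠ x in 𝓝 0, fderiv ℂ (fun x => fderiv ℂ (fun x => z x i) x (X x)) x (W x) =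
      D x * (lam i * fderiv ℂ (fun x => z x i) x (X x))) :
    ∀ᶠ y in 𝓝 0, fderiv ℂ Y y (fun i => lam i * y i) = fun i => lam i * Y y i := by
  have hφt : Tendsto φ (𝓝 0) (𝓝 0) := by
    have := hφ.continuousAt.tendsto
    rwa [hφ0] at this
  have hzt : Tendsto z (𝓝 0) (𝓝 0) := by
    have := hz.continuousAt.tendsto
    rwa [hz0] at this
  have key : ∀ᶠ x in 𝓝 (0 : σ → ℂ),
      fderiv ℂ Y (z x) (fun i => lam i * z x i) = fun i => lam i * Y (z x) i := by
    filter_upwards [hYz.eventually_nhds, hz.eventually_analyticAt.eventually_nhds, hD,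
      eventually_all.2 h1, eventually_all.2 h2, hzt.eventually hY.eventually_analyticAt]
      with x hYx hzx hDx h1x h2x hYa
    have hza := hzx.self_of_nhds
    have hcomp : fderiv ℂ (fun x => Y (z x)) x (W x) = fderiv ℂ Y (z x) (fderiv ℂ z x (W x)) := by
      rw [fderiv_fun_comp x hYa.differentiableAt hza.differentiableAt]
      rfl
    have hzW : fderiv ℂ z x (W x) = D x • fun i => lam i * z x i := by
      funext i
      rw [← fderiv_component hza, h1x]
      rfl
    rw [hzW, map_smul] at hcomp
    funext i
    have hη : (fun x => fderiv ℂ (fun x => z x i) x (X x)) =ᶠ[𝓝 x] fun x => Y (z x) i := by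
      filter_upwards [hYx, hzx] with t ht hzt
      rw [fderiv_component hzt, ht]
    have h3 := h2x i
    have h4 : fderiv ℂ (fun x => z x i) x (X x) = Y (z x) i := hη.self_of_nhds
    rw [hη.fderiv_eq, h4, fderiv_component (Y := fun x => Y (z x)) (hYa.comp hza),
      hcomp] at h3
    exact mul_left_cancel₀ hDx h3
  filter_upwards [hφt.eventually key, hzφ] with y hy hy'
  rw [hy'] at hy
  exact hy

theorem fderiv_comp_diagonal_eq {Y : (σ → ℂ) → (σ → ℂ)} (hY : AnalyticAt ℂ Y 0)
    {S : (σ → ℂ) →L[ℂ] (σ → ℂ)} (h : ∀ᶠ y in 𝓝 0, fderiv ℂ Y y (S y) = S (Y y)) :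
    S ∘L fderiv ℂ Y 0 = fderiv ℂ Y 0 ∘L S := by
  have h1 : HasFDerivAt (fun y => fderiv ℂ Y y (S y)) (fderiv ℂ Y 0 ∘L S +
      (fderiv ℂ (fderiv ℂ Y) 0).flip (S 0)) 0 :=
    hY.fderiv.differentiableAt.hasFDerivAt.clm_apply S.hasFDerivAt
  rw [map_zero, map_zero, add_zero] at h1
  have h2 : HasFDerivAt (fun y => S (Y y)) (S ∘L fderiv ℂ Y 0) 0 :=
    S.hasFDerivAt.comp 0 hY.differentiableAt.hasFDerivAt
  exact h2.unique (h1.congr_of_eventuallyEq (h.mono fun y hy => hy.symm))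

theorem fderiv_eq_mulVec {z : (σ → ℂ) → (σ → ℂ)} {ζ : σ → MvPowerSeries σ ℂ}
    (h : ∀ i, Rep (fun x => z x i) (ζ i)) (hz : AnalyticAt ℂ z 0) (v : σ → ℂ) :
    fderiv ℂ z 0 v = linMat ζ *ᵥ v := by
  funext i
  rw [← fderiv_component hz, apply_eq_sum_single, Matrix.mulVec, dotProduct]
  refine Finset.sum_congr rfl fun a _ => ?_
  rw [← (h i).coeff_single a, mul_comm]
  rfl

end Assembly

/-- An analytic field with convergent normalizing coordinates admits a normalization. -/
theorem admitsPDNormalization_of_coordinates {n : ℕ} {X : (Fin n → ℂ) → (Fin n → ℂ)}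
    (hX : AnalyticAt ℂ X 0) (hX0 : X 0 = 0) {Xf : Fin n → MvPowerSeries (Fin n) ℂ}
    (hXf : ∀ b, Rep (fun x => X x b) (Xf b)) (hord : ∀ b, Xf b ∈ ordGE (Fin n) 1)
    {lam : Fin n → ℂ} {ζ w : Fin n → MvPowerSeries (Fin n) ℂ} (hζ : ∀ i, Cvg (ζ i))
    (hζ1 : ∀ i, ζ i ∈ ordGE (Fin n) 1) (hunit : IsUnit (linMat ζ))
    (hw : ∀ i, vf w (ζ i) = lam i • ζ i)
    (hwX : ∀ i, vf w (vf Xf (ζ i)) = lam i • vf Xf (ζ i))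
    (hnil : ∃ k, ∀ i, linMat ζ i ᵥ* (linMat Xf - lam i • 1) ^ k = 0) :
    AdmitsPDNormalization ℂ X := by
  classical
  set z : (Fin n → ℂ) → (Fin n → ℂ) := fun x i => sumAt (ζ i) x with hzdef
  have hrep : ∀ i, Rep (fun x => z x i) (ζ i) := fun i => (hζ i).rep
  have hz : AnalyticAt ℂ z 0 := analyticAt_pi_iff.2 fun i => (hζ i).analyticAt
  have hz0 : z 0 = 0 := by
    funext i
    rw [(hrep i).apply_zero, ← MvPowerSeries.coeff_zero_eq_constantCoeff_apply]
    exact hζ1 i 0 (by simp)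
  set T : (Fin n → ℂ) ≃L[ℂ] (Fin n → ℂ) :=
    (LinearEquiv.ofBijective (Matrix.mulVecLin (linMat ζ))
      ⟨Matrix.mulVec_injective_iff_isUnit.2 hunit,
        Matrix.mulVec_surjective_iff_isUnit.2 hunit⟩).toContinuousLinearEquiv with hT
  have hi : fderiv ℂ z 0 = T := by
    ext1 v
    exact fderiv_eq_mulVec hrep hz v
  obtain ⟨φ, hφ, hφ0, hφz, hzφ⟩ := exists_analytic_localInverse hz hz0 hi
  have hφt : Tendsto φ (𝓝 0) (𝓝 0) := by
    have := hφ.continuousAt.tendsto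
    rwa [hφ0] at this
  set Y : (Fin n → ℂ) → (Fin n → ℂ) := fun y => fderiv ℂ z (φ y) (X (φ y)) with hYdef
  have hYan : AnalyticAt ℂ Y 0 := by
    have h1 : AnalyticAt ℂ (fun y => fderiv ℂ z (φ y)) 0 :=
      AnalyticAt.comp (by rw [hφ0]; exact hz.fderiv) hφ
    have h2 : AnalyticAt ℂ (fun y => X (φ y)) 0 := AnalyticAt.comp (by rwa [hφ0]) hφ
    exact AnalyticAt.fun_comp (f := fun y => (fderiv ℂ z (φ y), X (φ y)))
      ((ContinuousLinearMap.id ℂ _).analyticAt_bilinear _) (h1.prod h2)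
  have hY0 : Y 0 = 0 := by rw [hYdef]; simp [hφ0, hX0]
  have hYz : ∀ᶠ x in 𝓝 0, Y (z x) = fderiv ℂ z x (X x) := by
    filter_upwards [hφz] with x hx
    rw [hYdef]
    simp only [hx]
  obtain ⟨D, W, hD, hW, hD0, hWv⟩ := exists_cvg_vf hζ (fun i => ((hζ i).rep.smul (lam i)).1) hw
  have hDne : ∀ᶠ x in 𝓝 (0 : Fin n → ℂ), sumAt D x ≠ 0 := by
    refine hD.analyticAt.continuousAt.eventually_ne ?_
    rw [hD.rep.apply_zero, hD0]
    exact ((Matrix.isUnit_iff_isUnit_det _).1 hunit).ne_zero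
  set Wf : (Fin n → ℂ) → (Fin n → ℂ) := fun x a => sumAt (W a) x with hWf
  have hWrep : ∀ a, Rep (fun x => Wf x a) (W a) := fun a => (hW a).rep
  have h1 : ∀ i, ∀ᶠ x in 𝓝 0, fderiv ℂ (fun x => z x i) x (Wf x) = sumAt D x * (lam i * z x i) :=
    fun i => ((Rep.vf hWrep (hrep i)).eq_iff (hD.rep.mul ((hrep i).smul (lam i)))).1
      (by rw [hWv, hw])
  have h2 : ∀ i, ∀ᶠ x in 𝓝 0, fderiv ℂ (fun x => fderiv ℂ (fun x => z x i) x (X x)) x (Wf x) =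
      sumAt D x * (lam i * fderiv ℂ (fun x => z x i) x (X x)) := fun i =>
    ((Rep.vf hWrep (Rep.vf hXf (hrep i))).eq_iff
      (hD.rep.mul ((Rep.vf hXf (hrep i)).smul (lam i)))).1 (by rw [hWv, hwX])
  have hdiag := fderiv_apply_diagonal_eq hz hz0 hYan hφ hφ0 hzφ hYz hDne h1 h2
  set S : (Fin n → ℂ) →L[ℂ] (Fin n → ℂ) := LinearMap.toContinuousLinearMap
    (Matrix.toLinAlgEquiv' (Matrix.diagonal lam) : Module.End ℂ (Fin n → ℂ)) with hS
  have hSapp : ∀ v, S v = fun i => lam i * v i := fun v => by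
    funext i
    simp [hS, Matrix.mulVec_diagonal]
  have hSY : ∀ᶠ y in 𝓝 0, fderiv ℂ Y y (S y) = S (Y y) := by
    filter_upwards [hdiag] with y hy
    rw [hSapp, hSapp, hy]
  have hcomm := fderiv_comp_diagonal_eq hYan hSY
  set P : Matrix (Fin n) (Fin n) ℂ := LinearMap.toMatrixAlgEquiv'
    (fderiv ℂ Y 0 : (Fin n → ℂ) →ₗ[ℂ] (Fin n → ℂ)) with hP
  have hPapp : ∀ v, P *ᵥ v = fderiv ℂ Y 0 v := fun v =>
    LinearMap.toMatrix'_mulVec _ v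
  have hPQ : P * linMat ζ = linMat ζ * linMat Xf := by
    refine Matrix.ext_of_mulVec_single fun b => ?_
    rw [← Matrix.mulVec_mulVec, hPapp, ← fderiv_eq_mulVec hrep hz]
    have h3 : fderiv ℂ (fun x => Y (z x)) 0 = fderiv ℂ Y 0 ∘L fderiv ℂ z 0 := by
      rw [fderiv_fun_comp 0 (by rw [hz0]; exact hYan.differentiableAt) hz.differentiableAt, hz0]
    have h4 : ∀ i, Rep (fun x => Y (z x) i) (vf Xf (ζ i)) := fun i => by
      refine ⟨(Rep.vf hXf (hrep i)).1, EventuallyEq.trans ?_ (Rep.vf hXf (hrep i)).2⟩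
      filter_upwards [hYz, hz.eventually_analyticAt] with x hx hxa
      rw [hx, fderiv_component hxa]
    have h5 := fderiv_eq_mulVec (z := fun x => Y (z x)) h4
      (AnalyticAt.fun_comp (by rwa [hz0]) hz) (Pi.single b 1)
    rw [h3] at h5
    refine h5.trans ?_
    congr 1
    refine Matrix.ext fun i a => ?_
    exact congrFun (lin_vf hord (ζ i)) a
  have hPS : Commute P (Matrix.diagonal lam) := by
    refine Matrix.ext_of_mulVec_single fun b => ?_
    rw [← Matrix.mulVec_mulVec, ← Matrix.mulVec_mulVec, hPapp, hPapp]
    exact (DFunLike.congr_fun hcomm (Pi.single b 1)).symm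
  obtain ⟨k, hk⟩ := hnil
  have hNnil := isNilpotent_sub_diagonal hunit hPQ hPS hk
  have hφan := hφ.eventually_analyticAt
  have hconj : ∀ᶠ y in 𝓝 0, fderiv ℂ φ y (Y y) = X (φ y) := by
    filter_upwards [hφt.eventually hφz.eventually_nhds, hzφ, hφan,
      hφt.eventually hz.eventually_analyticAt] with y hy hy' hya hza
    have h3 : fderiv ℂ (fun x => φ (z x)) (φ y) = ContinuousLinearMap.id ℂ _ := by
      have : (fun x => φ (z x)) =ᶠ[𝓝 (φ y)] fun x => x := hy
      rw [this.fderiv_eq, fderiv_fun_id]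
    rw [fderiv_fun_comp (φ y) (by rw [hy']; exact hya.differentiableAt) hza.differentiableAt,
      hy'] at h3
    exact DFunLike.congr_fun h3 (X (φ y))
  have hφbij : Function.Bijective (fderiv ℂ φ 0) := by
    have h3 : fderiv ℂ (fun x => φ (z x)) 0 = ContinuousLinearMap.id ℂ _ := by
      have : (fun x => φ (z x)) =ᶠ[𝓝 0] fun x => x := hφz
      rw [this.fderiv_eq, fderiv_fun_id]
    rw [fderiv_fun_comp 0 (by rw [hz0]; exact hφ.differentiableAt) hz.differentiableAt, hz0,
      hi] at h3
    have h4 : fderiv ℂ φ 0 = T.symm := by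
      ext1 v
      have := DFunLike.congr_fun h3 (T.symm v)
      simpa using this
    rw [h4]
    exact T.symm.bijective
  obtain ⟨V, hV, hVo, h0V⟩ := eventually_nhds_iff.1
    (hYan.eventually_analyticAt.and (hφan.and (hSY.and hconj)))
  refine ⟨V, Y, φ, hVo, h0V, fun y hy => (hV y hy).1, fun y hy => (hV y hy).2.1, hY0, hφ0, hφbij,
    ⟨S, fderiv ℂ Y 0 - S, by abel, isSemisimple_diagonal lam, ?_, ?_, fun y hy => ?_⟩,
    fun y hy => (hV y hy).2.2.2⟩
  · have h3 := hNnil.map (Matrix.toLinAlgEquiv' (R := ℂ) (n := Fin n))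
    rw [map_sub, hP, Matrix.toLinAlgEquiv'_toMatrixAlgEquiv'] at h3
    exact h3
  · rw [ContinuousLinearMap.comp_sub, ContinuousLinearMap.sub_comp, hcomm]
  · rw [VectorField.lieBracket_eq]
    have h3 : fderiv ℂ (fun y => S y) y = S := S.fderiv
    simp only [h3, (hV y hy).2.2.1, sub_self]

end PoincareDulac
end

/-- **Convergence versus integrability in Poincaré–Dulac normal form** (Zung).
A holomorphic vector field on `(ℂⁿ, 0)` which is integrable in the
non-Hamiltonian sense (it belongs to an `m`-tuple of pairwise commuting,
almost-everywhere linearly independent analytic vector fields admitting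
`n - m` almost-everywhere functionally independent common analytic first
integrals) admits a convergent Poincaré–Dulac normalization. -/
theorem integrable_admitsPDNormalization_complex
    (n m : ℕ) (hn : 1 ≤ n) (hm : 1 ≤ m) (hmn : m ≤ n)
    (U : Set (Fin n → ℂ)) (hUopen : IsOpen U) (hUconn : IsConnected U)
    (h0U : (0 : Fin n → ℂ) ∈ U)
    (X : Fin m → (Fin n → ℂ) → (Fin n → ℂ))
    (f : Fin (n - m) → (Fin n → ℂ) → ℂ)
    (hXan : ∀ i, AnalyticOnNhd ℂ (X i) U)
    (hfan : ∀ j, AnalyticOnNhd ℂ (f j) U)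
    (hX10 : X ⟨0, hm⟩ 0 = 0)
    (hcomm : ∀ i j, ∀ x ∈ U, VectorField.lieBracket ℂ (X i) (X j) x = 0)
    (hfirst : ∀ i j, ∀ x ∈ U, fderiv ℂ (f j) x (X i x) = 0)
    (hXind : ∃ x ∈ U, LinearIndependent ℂ (fun i => X i x))
    (hfind : ∃ x ∈ U, LinearIndependent ℂ (fun j => fderiv ℂ (f j) x)) :
    AdmitsPDNormalization ℂ (X ⟨0, hm⟩) := by
  obtain ⟨Xf, F, Cm, hXf, hsys, hd1, hd2⟩ := PoincareDulac.exists_formalSystem hUopen hUconn.isPreconnected h0U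
    hXan hfan (i₀ := ⟨0, hm⟩) hX10 hcomm hfirst hXind hfind
    (finSumFinEquiv.trans (finCongr (Nat.add_sub_cancel' hmn)))
  obtain ⟨lam, ζ, w, hζ, hζ1, hunit, hw, hwX, hnil⟩ := hsys.exists_normalization Cm _ hd1 hd2
  exact PoincareDulac.admitsPDNormalization_of_coordinates (hXan _ 0 h0U) hX10 (hXf _) hsys.vanish hζ hζ1 hunit
    hw hwX hnil
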